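/- Let M be an irreducible euclidean Coxeter matrix with index set S, let (W,S) be the corresponding Coxeter group with simple generators S, let R = {g s g⁻¹ : s ∈ S, g ∈ W} be its set of reflections, and let ℓ_R denote word length in W with respect to R. Fix an ordering s_1,…,s_k of S and let w = s_1 s_2 ⋯ s_k be the resulting Coxeter element, with N = ℓ_R(w). Let R_0 ⊆ R be the set of reflections that occur in some factorization of w as a product of N reflections, and let W_w be the presented group with generating set R_0 and one relation r_1 r_2 ⋯ r_N = r'_1 r'_2 ⋯ r'_N for every pair of minimal-length reflection factorizations of w. Then S ⊆ R_0 and the map sending each s ∈ S to the corresponding generator of W_w extends to a group isomorphism from the Artin group A(M) onto W_w. -/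

import Mathlib

open CoxeterSystem

section ArtinGroup

variable {B : Type*}

/-- The product in the free group of a list of generators. -/
def freeWord (l : List B) : FreeGroup B := (l.map FreeGroup.of).prod

/-- The Artin relations of a Coxeter matrix `M`: for each pair `i ≠ j` with `m = M i j ≠ 0`
(`0` encodes `∞`), the relation equating the two alternating words of length `m` in `i` and
`j`. -/
def artinRelationsSet (M : CoxeterMatrix B) : Set (FreeGroup B) :=
  {r | ∃ i j : B, i ≠ j ∧ M i j ≠ 0 ∧
        r = freeWord (alternatingWord i j (M i j)) *
            (freeWord (alternatingWord j i (M i j)))⁻¹}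

/-- The Artin group of a Coxeter matrix `M`. -/
def ArtinGroup (M : CoxeterMatrix B) : Type _ := PresentedGroup (artinRelationsSet M)

instance (M : CoxeterMatrix B) : Group (ArtinGroup M) :=
  inferInstanceAs (Group (PresentedGroup (artinRelationsSet M)))

/-- The generator of the Artin group corresponding to the index `i`. -/
def ArtinGroup.of (M : CoxeterMatrix B) (i : B) : ArtinGroup M :=
  PresentedGroup.of i

end ArtinGroup

section EuclideanMatrices

variable {B : Type*} [DecidableEq B]

/-- Build a symmetric matrix with diagonal `1` from an edge-label function `f`: off-diagonal
entries are `2` when unlabeled (`f i j ⊔ f j i = 0`), `0` (encoding `∞`) when labeled `1`,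
and the label otherwise. -/
def edgeMatrix (f : B → B → ℕ) : Matrix B B ℕ :=
  Matrix.of fun i j =>
    if i = j then 1
    else if f i j ⊔ f j i = 0 then 2
    else if f i j ⊔ f j i = 1 then 0
    else f i j ⊔ f j i

/-- The Coxeter matrix associated to an edge-label function. -/
def edgeCoxeterMatrix (f : B → B → ℕ) : CoxeterMatrix B where
  M := edgeMatrix f
  isSymm := by
    ext i j
    simp only [Matrix.transpose_apply, edgeMatrix, Matrix.of_apply]
    by_cases h : i = j
    · simp [h]
    · rw [if_neg (Ne.symm h), if_neg h, sup_comm (f j i) (f i j)]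
  diagonal := by intro i; simp [edgeMatrix]
  off_diagonal := by
    intro i j h
    simp only [edgeMatrix, Matrix.of_apply, if_neg h]
    split_ifs <;> omega

/-- The extended Dynkin diagram of type `Ã₁`: two vertices with `m(s,t) = ∞`. -/
def tildeA1 : CoxeterMatrix (Fin 2) :=
  edgeCoxeterMatrix fun i j => if i = 0 ∧ j = 1 then 1 else 0

/-- The extended Dynkin diagram of type `Ã_n`, `n ≥ 2`: a cycle of length `n + 1`. -/
def tildeA (n : ℕ) : CoxeterMatrix (ZMod (n + 1)) :=
  edgeCoxeterMatrix fun i j => if j = i + 1 then 3 else 0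

/-- The extended Dynkin diagram of type `C̃_n`, `n ≥ 2`, on vertices `0, …, n`. -/
def tildeC (n : ℕ) : CoxeterMatrix (Fin (n + 1)) :=
  edgeCoxeterMatrix fun i j =>
    if ((i : ℕ) = 0 ∧ (j : ℕ) = 1) ∨ ((i : ℕ) = n - 1 ∧ (j : ℕ) = n) then 4
    else if (j : ℕ) = (i : ℕ) + 1 then 3
    else 0

/-- The extended Dynkin diagram of type `B̃_n`, `n ≥ 3`, on vertices `0, …, n`. -/
def tildeB (n : ℕ) : CoxeterMatrix (Fin (n + 1)) :=
  edgeCoxeterMatrix fun i j =>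
    if (i : ℕ) = 0 ∧ (j : ℕ) = 1 then 4
    else if (j : ℕ) = (i : ℕ) + 1 ∧ 1 ≤ (i : ℕ) ∧ (j : ℕ) ≤ n - 1 then 3
    else if (i : ℕ) = n - 2 ∧ (j : ℕ) = n then 3
    else 0

/-- The extended Dynkin diagram of type `D̃_n`, `n ≥ 4`, on vertices `0, …, n`. -/
def tildeD (n : ℕ) : CoxeterMatrix (Fin (n + 1)) :=
  edgeCoxeterMatrix fun i j =>
    if (j : ℕ) = (i : ℕ) + 1 ∧ 2 ≤ (i : ℕ) ∧ (i : ℕ) ≤ n - 3 then 3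
    else if ((i : ℕ) = 0 ∨ (i : ℕ) = 1) ∧ (j : ℕ) = 2 then 3
    else if (i : ℕ) = n - 2 ∧ ((j : ℕ) = n - 1 ∨ (j : ℕ) = n) then 3
    else 0

/-- The extended Dynkin diagram of type `G̃₂`. -/
def tildeG2 : CoxeterMatrix (Fin 3) :=
  edgeCoxeterMatrix fun i j =>
    if (i : ℕ) = 0 ∧ (j : ℕ) = 1 then 6
    else if (i : ℕ) = 1 ∧ (j : ℕ) = 2 then 3
    else 0

/-- The extended Dynkin diagram of type `F̃₄`. -/
def tildeF4 : CoxeterMatrix (Fin 5) :=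
  edgeCoxeterMatrix fun i j =>
    if (i : ℕ) = 1 ∧ (j : ℕ) = 2 then 4
    else if (j : ℕ) = (i : ℕ) + 1 then 3
    else 0

/-- The extended Dynkin diagram of type `Ẽ₆`: a path `0 — 1 — 2 — 3 — 4` with an edge
`2 — 5` and an edge `5 — 6`. -/
def tildeE6 : CoxeterMatrix (Fin 7) :=
  edgeCoxeterMatrix fun i j =>
    if ((j : ℕ) = (i : ℕ) + 1 ∧ (j : ℕ) ≤ 4) ∨ ((i : ℕ) = 2 ∧ (j : ℕ) = 5) ∨
        ((i : ℕ) = 5 ∧ (j : ℕ) = 6) then 3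
    else 0

/-- The extended Dynkin diagram of type `Ẽ₇`: a path `0 — 1 — ⋯ — 6` with an edge `3 — 7`. -/
def tildeE7 : CoxeterMatrix (Fin 8) :=
  edgeCoxeterMatrix fun i j =>
    if ((j : ℕ) = (i : ℕ) + 1 ∧ (j : ℕ) ≤ 6) ∨ ((i : ℕ) = 3 ∧ (j : ℕ) = 7) then 3
    else 0

/-- The extended Dynkin diagram of type `Ẽ₈`: a path `0 — 1 — ⋯ — 7` with an edge `2 — 8`. -/
def tildeE8 : CoxeterMatrix (Fin 9) :=
  edgeCoxeterMatrix fun i j =>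
    if ((j : ℕ) = (i : ℕ) + 1 ∧ (j : ℕ) ≤ 7) ∨ ((i : ℕ) = 2 ∧ (j : ℕ) = 8) then 3
    else 0

end EuclideanMatrices

/-- A Coxeter matrix is irreducible euclidean if, up to a bijective relabeling of its index
set, it is one of the extended Dynkin types `Ã₁`, `Ã_n (n ≥ 2)`, `B̃_n (n ≥ 3)`,
`C̃_n (n ≥ 2)`, `D̃_n (n ≥ 4)`, `G̃₂`, `F̃₄`, `Ẽ₆`, `Ẽ₇`, `Ẽ₈`. -/
def IsIrreducibleEuclidean {B : Type*} (M : CoxeterMatrix B) : Prop :=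
  (∃ e : Fin 2 ≃ B, M = tildeA1.reindex e) ∨
  (∃ n : ℕ, 2 ≤ n ∧ ∃ e : ZMod (n + 1) ≃ B, M = (tildeA n).reindex e) ∨
  (∃ n : ℕ, 3 ≤ n ∧ ∃ e : Fin (n + 1) ≃ B, M = (tildeB n).reindex e) ∨
  (∃ n : ℕ, 2 ≤ n ∧ ∃ e : Fin (n + 1) ≃ B, M = (tildeC n).reindex e) ∨
  (∃ n : ℕ, 4 ≤ n ∧ ∃ e : Fin (n + 1) ≃ B, M = (tildeD n).reindex e) ∨
  (∃ e : Fin 3 ≃ B, M = tildeG2.reindex e) ∨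
  (∃ e : Fin 5 ≃ B, M = tildeF4.reindex e) ∨
  (∃ e : Fin 7 ≃ B, M = tildeE6.reindex e) ∨
  (∃ e : Fin 8 ≃ B, M = tildeE7.reindex e) ∨
  (∃ e : Fin 9 ≃ B, M = tildeE8.reindex e)



section DualArtin

variable {B : Type*} (M : CoxeterMatrix B)

/-- The set of reflections of the Coxeter group of `M`: all conjugates of the simple
generators. -/
def reflections : Set M.Group :=
  {x | ∃ (i : B) (g : M.Group), x = g * M.simple i * g⁻¹}

/-- Word length with respect to a generating set `S`. -/
noncomputable def wordLength {G : Type*} [Group G] (S : Set G) (g : G) : ℕ :=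
  sInf {k | ∃ l : List G, l.length = k ∧ (∀ x ∈ l, x ∈ S) ∧ l.prod = g}

/-- The Coxeter element obtained by multiplying the simple generators in the order given by
the list `l`. -/
def coxeterElt (l : List B) : M.Group := (l.map M.simple).prod

/-- `f` is a minimal-length factorization of the Coxeter element determined by `l` into
reflections. -/
def IsMinFactorization (l : List B) (f : List M.Group) : Prop :=
  f.length = wordLength (reflections M) (coxeterElt M l) ∧
  (∀ x ∈ f, x ∈ reflections M) ∧ f.prod = coxeterElt M l

/-- The set `R₀` of reflections occurring in some minimal-length reflection factorization of
the Coxeter element. -/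
def dualGens (l : List B) : Set M.Group :=
  {r | ∃ f : List M.Group, IsMinFactorization M l f ∧ r ∈ f}

/-- The defining relations of the dual Artin group: two minimal-length reflection
factorizations of the Coxeter element are equated. -/
def dualRels (l : List B) : Set (FreeGroup ↥(dualGens M l)) :=
  {x | ∃ f₁ f₂ : List ↥(dualGens M l),
        IsMinFactorization M l (f₁.map Subtype.val) ∧
        IsMinFactorization M l (f₂.map Subtype.val) ∧
        x = (f₁.map FreeGroup.of).prod * ((f₂.map FreeGroup.of).prod)⁻¹}

/-- The dual Artin group `W_w` determined by the Coxeter element `w` given by the ordering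
`l` of the simple generators. -/
def DualArtinGroup (l : List B) : Type _ := PresentedGroup (dualRels M l)

instance (l : List B) : Group (DualArtinGroup M l) :=
  inferInstanceAs (Group (PresentedGroup (dualRels M l)))

end DualArtin

set_option linter.unusedSectionVars false

section GeometricRepresentation

variable {B : Type*} [Fintype B] [DecidableEq B] (M : CoxeterMatrix B)

/-- The simple root attached to an index. -/
def simpleRoot (b : B) : B → ℝ := Pi.single b 1

/-- The canonical symmetric bilinear form of a Coxeter matrix. -/
noncomputable def CoxeterMatrix.form : LinearMap.BilinForm ℝ (B → ℝ) :=
  Matrix.toBilin' (Matrix.of fun i j => -Real.cos (Real.pi / M i j))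

/-- The orthogonal reflection in a vector of norm one. -/
noncomputable def CoxeterMatrix.reflect (v : B → ℝ) : Module.End ℝ (B → ℝ) :=
  LinearMap.id - (2 • M.form v).smulRight v

theorem CoxeterMatrix.reflect_apply (v x : B → ℝ) :
    M.reflect v x = x - (2 * M.form v x) • v := by
  simp [CoxeterMatrix.reflect]

theorem CoxeterMatrix.form_simpleRoot (i j : B) :
    M.form (simpleRoot i) (simpleRoot j) = -Real.cos (Real.pi / M i j) := by
  simp [CoxeterMatrix.form, simpleRoot, Matrix.toBilin'_single]

theorem CoxeterMatrix.form_comm (x y : B → ℝ) : M.form x y = M.form y x := by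
  simp only [CoxeterMatrix.form, Matrix.toBilin'_apply, Matrix.of_apply]
  rw [Finset.sum_comm]
  refine Finset.sum_congr rfl fun i _ => Finset.sum_congr rfl fun j _ => ?_
  rw [M.symmetric j i]
  ring

theorem CoxeterMatrix.form_simpleRoot_self (i : B) :
    M.form (simpleRoot i) (simpleRoot i) = 1 := by
  simp [CoxeterMatrix.form_simpleRoot]

theorem CoxeterMatrix.reflect_self {v : B → ℝ} (hv : M.form v v = 1) : M.reflect v v = -v := by
  rw [CoxeterMatrix.reflect_apply, hv]
  module

theorem CoxeterMatrix.reflect_reflect {v : B → ℝ} (hv : M.form v v = 1) (x : B → ℝ) :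
    M.reflect v (M.reflect v x) = x := by
  simp only [CoxeterMatrix.reflect_apply, map_sub, map_smul, hv]
  module

theorem CoxeterMatrix.form_reflect {v : B → ℝ} (hv : M.form v v = 1) (x y : B → ℝ) :
    M.form (M.reflect v x) (M.reflect v y) = M.form x y := by
  simp only [CoxeterMatrix.reflect_apply, map_sub, map_smul, hv, smul_eq_mul,
    LinearMap.sub_apply, LinearMap.smul_apply]
  rw [M.form_comm x v]
  ring

/-- The coefficients `sin (k θ) / sin θ`, `θ = π / m`, with the limiting values `k` for `m = 0`. -/
noncomputable def dihedralCoeff (m k : ℕ) : ℝ :=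
  if m = 0 then k else Real.sin (k * (Real.pi / m)) / Real.sin (Real.pi / m)

theorem sin_pi_div_pos {m : ℕ} (hm : 2 ≤ m) : 0 < Real.sin (Real.pi / m) := by
  have h2 : (2 : ℝ) ≤ m := by exact_mod_cast hm
  apply Real.sin_pos_of_pos_of_lt_pi
  · positivity
  · rw [div_lt_iff₀ (by linarith)]
    nlinarith [Real.pi_pos]

theorem dihedralCoeff_zero (m : ℕ) : dihedralCoeff m 0 = 0 := by
  simp [dihedralCoeff]

theorem dihedralCoeff_one {m : ℕ} (hm : m ≠ 1) : dihedralCoeff m 1 = 1 := by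
  unfold dihedralCoeff
  split_ifs with h
  · simp
  · rw [Nat.cast_one, one_mul, div_self (sin_pi_div_pos (by omega)).ne']

theorem dihedralCoeff_succ_succ (m k : ℕ) :
    dihedralCoeff m (k + 2) =
      2 * Real.cos (Real.pi / m) * dihedralCoeff m (k + 1) - dihedralCoeff m k := by
  unfold dihedralCoeff
  split_ifs with h
  · subst h
    simp
    ring
  · set θ := Real.pi / m
    have : Real.sin (((k + 2 : ℕ) : ℝ) * θ) =
        2 * Real.cos θ * Real.sin (((k + 1 : ℕ) : ℝ) * θ) - Real.sin (k * θ) := by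
      push_cast
      rw [show ((k : ℝ) + 2) * θ = (k + 1) * θ + θ by ring,
        show (k : ℝ) * θ = (k + 1) * θ - θ by ring, Real.sin_add, Real.sin_sub]
      ring
    rw [this]
    ring

theorem dihedralCoeff_nonneg {m k : ℕ} (hm : m ≠ 1) (hk : m = 0 ∨ k ≤ m) :
    0 ≤ dihedralCoeff m k := by
  unfold dihedralCoeff
  split_ifs with h
  · positivity
  · have hkm : k ≤ m := by tauto
    have hm' : (0 : ℝ) < m := by exact_mod_cast Nat.pos_of_ne_zero h
    refine div_nonneg (Real.sin_nonneg_of_nonneg_of_le_pi (by positivity) ?_)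
      (sin_pi_div_pos (by omega)).le
    rw [mul_div_assoc', div_le_iff₀ hm', mul_comm]
    gcongr

theorem dihedralCoeff_two_mul {m : ℕ} (hm : m ≠ 0) : dihedralCoeff m (2 * m) = 0 := by
  have hm' : (m : ℝ) ≠ 0 := by exact_mod_cast hm
  rw [dihedralCoeff, if_neg hm]
  push_cast
  rw [show 2 * (m : ℝ) * (Real.pi / m) = 2 * Real.pi by field_simp, Real.sin_two_pi, zero_div]

theorem dihedralCoeff_two_mul_add_one {m : ℕ} (hm : 2 ≤ m) : dihedralCoeff m (2 * m + 1) = 1 := by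
  have hm' : (m : ℝ) ≠ 0 := by positivity
  rw [dihedralCoeff, if_neg (by omega)]
  push_cast
  rw [show (2 * (m : ℝ) + 1) * (Real.pi / m) = Real.pi / m + 2 * Real.pi by field_simp; ring,
    Real.sin_add_two_pi, div_self (sin_pi_div_pos hm).ne']

theorem CoxeterMatrix.reflect_simpleRoot_smul_add (i j : B) (p q : ℝ) :
    M.reflect (simpleRoot j) (p • simpleRoot i + q • simpleRoot j) =
      p • simpleRoot i + (2 * Real.cos (Real.pi / M i j) * p - q) • simpleRoot j := by
  simp only [CoxeterMatrix.reflect_apply, map_add, map_smul,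
    M.form_simpleRoot_self, M.form_comm (simpleRoot j) (simpleRoot i), M.form_simpleRoot i j]
  module

theorem CoxeterMatrix.reflect_mul_reflect_pow_simpleRoot {i j : B} (hij : i ≠ j) (k : ℕ) :
    ((M.reflect (simpleRoot i) * M.reflect (simpleRoot j)) ^ k) (simpleRoot i) =
      dihedralCoeff (M i j) (2 * k + 1) • simpleRoot i +
        dihedralCoeff (M i j) (2 * k) • simpleRoot j := by
  induction k with
  | zero => simp [dihedralCoeff_zero, dihedralCoeff_one (M.off_diagonal i j hij)]
  | succ k ih =>
    rw [pow_succ', Module.End.mul_apply, ih, Module.End.mul_apply,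
      M.reflect_simpleRoot_smul_add i j, ← dihedralCoeff_succ_succ, add_comm,
      M.reflect_simpleRoot_smul_add j i, M.symmetric j i, ← dihedralCoeff_succ_succ, add_comm]
    rfl

theorem CoxeterMatrix.isLiftable_reflect :
    M.IsLiftable fun i => M.reflect (simpleRoot i) := by
  intro i j
  rcases eq_or_ne i j with rfl | hij
  · rw [M.diagonal, pow_one]
    refine LinearMap.ext fun x => ?_
    exact M.reflect_reflect (M.form_simpleRoot_self i) _
  rcases eq_or_ne (M i j) 0 with h0 | h0
  · rw [h0, pow_zero]
  have hm1 := M.off_diagonal i j hij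
  have hm : 2 ≤ M i j := by omega
  have hsin := sin_pi_div_pos hm
  set r := M.reflect (simpleRoot i) * M.reflect (simpleRoot j) with hr
  have h1 : (r ^ M i j) (simpleRoot i) = simpleRoot i := by
    rw [M.reflect_mul_reflect_pow_simpleRoot hij, dihedralCoeff_two_mul h0,
      dihedralCoeff_two_mul_add_one hm]
    simp
  have h2 : (r ^ M i j) (simpleRoot j) = simpleRoot j := by
    have hinv : r * (M.reflect (simpleRoot j) * M.reflect (simpleRoot i)) = 1 := by
      refine LinearMap.ext fun x => ?_
      simp [hr, M.reflect_reflect (M.form_simpleRoot_self _)]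
    have hcomm : (M.reflect (simpleRoot j) * M.reflect (simpleRoot i)) * r = 1 := by
      refine LinearMap.ext fun x => ?_
      simp [hr, M.reflect_reflect (M.form_simpleRoot_self _)]
    have hp : r ^ M i j * (M.reflect (simpleRoot j) * M.reflect (simpleRoot i)) ^ M i j = 1 := by
      rw [← (show Commute r _ from hinv.trans hcomm.symm).mul_pow, hinv, one_pow]
    have h3 := M.reflect_mul_reflect_pow_simpleRoot hij.symm (M i j)
    rw [M.symmetric j i, dihedralCoeff_two_mul h0, dihedralCoeff_two_mul_add_one hm] at h3
    simp only [one_smul, zero_smul, add_zero] at h3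
    conv_lhs => rw [← h3]
    rw [← Module.End.mul_apply, hp, Module.End.one_apply]
  have h3 : ∀ x, M.form (simpleRoot i) x = 0 → M.form (simpleRoot j) x = 0 →
      (r ^ M i j) x = x := by
    intro x hi hj
    have : r x = x := by simp [hr, CoxeterMatrix.reflect_apply, hi, hj]
    generalize M i j = n
    induction n with
    | zero => simp
    | succ n ih => rw [pow_succ, Module.End.mul_apply, this, ih]
  refine LinearMap.ext fun x => ?_
  set c := Real.cos (Real.pi / M i j) with hc
  set s := Real.sin (Real.pi / M i j) with hs
  have hcs : s ^ 2 = 1 - c ^ 2 := by rw [hs, hc, Real.sin_sq]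
  set u := M.form (simpleRoot i) x
  set v := M.form (simpleRoot j) x
  set p := (u + c * v) / s ^ 2
  set q := (c * u + v) / s ^ 2
  have hx : x =
      (x - p • simpleRoot i - q • simpleRoot j) + p • simpleRoot i + q • simpleRoot j := by
    module
  have hne : s ^ 2 ≠ 0 := by positivity
  have h4 := h3 (x - p • simpleRoot i - q • simpleRoot j)
    (by
      simp only [map_sub, map_smul, smul_eq_mul, M.form_simpleRoot_self, M.form_simpleRoot i j]
      change u - p * 1 - q * -c = 0
      simp only [p, q]
      field_simp
      rw [hcs]; ring)
    (by
      simp only [map_sub, map_smul, smul_eq_mul, M.form_simpleRoot_self,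
        M.form_comm (simpleRoot j) (simpleRoot i), M.form_simpleRoot i j]
      change v - p * -c - q * 1 = 0
      simp only [p, q]
      field_simp
      rw [hcs]; ring)
  conv_lhs => rw [hx]
  rw [map_add, map_add, map_smul, map_smul, h1, h2, h4, ← hx]
  rfl

variable {M} {W : Type*} [Group W] (cs : CoxeterSystem M W)

/-- The geometric representation of a Coxeter group. -/
noncomputable def CoxeterSystem.rep : W →* Module.End ℝ (B → ℝ) :=
  cs.lift ⟨_, M.isLiftable_reflect⟩

theorem CoxeterSystem.rep_simple (i : B) : cs.rep (cs.simple i) = M.reflect (simpleRoot i) :=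
  cs.lift_apply_simple M.isLiftable_reflect i

theorem CoxeterSystem.rep_mul_apply (g h : W) (x : B → ℝ) :
    cs.rep (g * h) x = cs.rep g (cs.rep h x) := by
  rw [map_mul, Module.End.mul_apply]

theorem CoxeterSystem.rep_inv_rep (g : W) (x : B → ℝ) : cs.rep g⁻¹ (cs.rep g x) = x := by
  rw [← cs.rep_mul_apply, inv_mul_cancel, map_one, Module.End.one_apply]

theorem CoxeterSystem.rep_rep_inv (g : W) (x : B → ℝ) : cs.rep g (cs.rep g⁻¹ x) = x := by
  rw [← cs.rep_mul_apply, mul_inv_cancel, map_one, Module.End.one_apply]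

theorem CoxeterSystem.form_rep (g : W) (x y : B → ℝ) :
    M.form (cs.rep g x) (cs.rep g y) = M.form x y := by
  induction g using cs.simple_induction_left generalizing x y with
  | one => simp
  | mul_simple_left g i ih =>
    rw [cs.rep_mul_apply, cs.rep_mul_apply, cs.rep_simple,
      M.form_reflect (M.form_simpleRoot_self i), ih]

end GeometricRepresentation

section PositiveRoots

variable {B : Type*} [Fintype B] [DecidableEq B] {M : CoxeterMatrix B}
  {W : Type*} [Group W] (cs : CoxeterSystem M W)

theorem CoxeterSystem.rep_alternatingWord {i j : B} (hij : i ≠ j) (k : ℕ) :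
    cs.rep (cs.wordProd (alternatingWord i j k)) (simpleRoot i) =
      if Even k then
        dihedralCoeff (M i j) (k + 1) • simpleRoot i + dihedralCoeff (M i j) k • simpleRoot j
      else
        dihedralCoeff (M i j) k • simpleRoot i +
          dihedralCoeff (M i j) (k + 1) • simpleRoot j := by
  induction k with
  | zero => simp [alternatingWord, dihedralCoeff_zero, dihedralCoeff_one (M.off_diagonal i j hij)]
  | succ k ih =>
    rw [alternatingWord_succ', wordProd_cons, cs.rep_mul_apply, ih, cs.rep_simple]
    by_cases hk : Even k
    · simp only [hk, if_true, Nat.even_add_one, not_true_eq_false, if_false]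
      rw [M.reflect_simpleRoot_smul_add i j, ← dihedralCoeff_succ_succ]
    · simp only [hk, if_false, Nat.even_add_one, not_false_eq_true, if_true]
      rw [add_comm, M.reflect_simpleRoot_smul_add j i, M.symmetric j i, ← dihedralCoeff_succ_succ,
        add_comm]

theorem CoxeterSystem.exists_dihedral_decomposition {w : W} {i j : B}
    (hj : cs.IsRightDescent w j) :
    ∃ (v : W) (k : ℕ), 1 ≤ k ∧ w = v * cs.wordProd (alternatingWord i j k) ∧
      cs.length w = cs.length v + k ∧ ¬ cs.IsRightDescent v i ∧ ¬ cs.IsRightDescent v j := by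
  classical
  let P : ℕ → Prop := fun k => ∃ v : W, w = v * cs.wordProd (alternatingWord i j k) ∧
    cs.length w = cs.length v + k
  have hP1 : P 1 := by
    refine ⟨w * cs.simple j, by simp [alternatingWord], ?_⟩
    exact ((cs.isRightDescent_iff).1 hj).symm
  have hbound : ∀ k, P k → k ≤ cs.length w := by
    rintro k ⟨v, -, h⟩
    omega
  set k := Nat.findGreatest P (cs.length w) with hkdef
  have hk1 : 1 ≤ k := Nat.le_findGreatest (hbound 1 hP1) hP1
  obtain ⟨v, hv, hl⟩ : P k := Nat.findGreatest_spec (hbound 1 hP1) hP1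
  have hmax : ¬ P (k + 1) := fun h => by
    have := Nat.le_findGreatest (hbound _ h) h
    omega
  have hfirst : ¬ cs.IsRightDescent v (if Even k then j else i) := by
    intro hd
    refine hmax ⟨v * cs.simple (if Even k then j else i), ?_, ?_⟩
    · rw [alternatingWord_succ', wordProd_cons, mul_assoc, cs.simple_mul_simple_cancel_left, hv]
    · have := (cs.isRightDescent_iff).1 hd
      omega
  have hsecond : ¬ cs.IsRightDescent v (if Even k then i else j) := by
    intro hd
    obtain ⟨n, hn⟩ : ∃ n, k = n + 1 := ⟨k - 1, by omega⟩
    have h1 := (cs.isRightDescent_iff).1 hd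
    have h2 : w = v * cs.simple (if Even k then i else j) *
        cs.wordProd (alternatingWord i j n) := by
      rw [hv, hn, alternatingWord_succ', wordProd_cons, mul_assoc]
      congr 3
      by_cases h : Even n <;> simp [h, Nat.even_add_one]
    have h3 := cs.length_mul_le (v * cs.simple (if Even k then i else j))
      (cs.wordProd (alternatingWord i j n))
    have h4 := cs.length_wordProd_le (alternatingWord i j n)
    rw [length_alternatingWord] at h4
    rw [← h2] at h3
    omega
  by_cases h : Even k
  · rw [if_pos h] at hfirst hsecond
    exact ⟨v, k, hk1, hv, hl, hsecond, hfirst⟩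
  · rw [if_neg h] at hfirst hsecond
    exact ⟨v, k, hk1, hv, hl, hfirst, hsecond⟩

theorem CoxeterSystem.rep_nonneg_of_not_isRightDescent {w : W} {i : B}
    (hi : ¬ cs.IsRightDescent w i) : 0 ≤ cs.rep w (simpleRoot i) := by
  induction hn : cs.length w using Nat.strong_induction_on generalizing w i with
  | _ n ih =>
    have h0 : ∀ b : B, (0 : B → ℝ) ≤ simpleRoot b := fun b => Pi.single_nonneg.2 zero_le_one
    rcases eq_or_ne w 1 with rfl | hw
    · simpa using h0 i
    obtain ⟨j, hj⟩ := cs.exists_rightDescent_of_ne_one hw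
    have hij : i ≠ j := by
      rintro rfl
      exact hi hj
    obtain ⟨v, k, hk, hv, hl, hvi, hvj⟩ := cs.exists_dihedral_decomposition (i := i) hj
    have hm : M i j = 0 ∨ k + 1 ≤ M i j := by
      by_contra hcon
      push Not at hcon
      have hred := cs.not_isReduced_alternatingWord j i (m := k + 1)
        (by rw [M.symmetric]; exact hcon.1)
        (by rw [M.symmetric]; exact hcon.2)
      apply hred
      have h1 := (cs.not_isRightDescent_iff).1 hi
      have h2 : w * cs.simple i = v * cs.wordProd (alternatingWord j i (k + 1)) := by
        rw [hv, alternatingWord_succ, wordProd_concat, mul_assoc]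
      have h3 := cs.length_mul_le v (cs.wordProd (alternatingWord j i (k + 1)))
      have h4 := cs.length_wordProd_le (alternatingWord j i (k + 1))
      rw [← h2] at h3
      unfold CoxeterSystem.IsReduced
      rw [length_alternatingWord] at *
      omega
    have hm1 := M.off_diagonal i j hij
    have hp := dihedralCoeff_nonneg (k := k) hm1 (hm.imp_right fun h => by omega)
    have hq := dihedralCoeff_nonneg (k := k + 1) hm1 hm
    have hi' := ih _ (by omega) hvi rfl
    have hj' := ih _ (by omega) hvj rfl
    rw [hv, cs.rep_mul_apply, cs.rep_alternatingWord hij]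
    split_ifs <;> rw [map_add, map_smul, map_smul] <;> positivity

theorem simpleRoot_ne_zero (b : B) : simpleRoot b ≠ (0 : B → ℝ) := by
  simp [simpleRoot]

theorem CoxeterSystem.rep_injective_apply (w : W) : Function.Injective (cs.rep w) :=
  Function.LeftInverse.injective (cs.rep_inv_rep w)

theorem CoxeterSystem.rep_mul_simple_simpleRoot (w : W) (i : B) :
    cs.rep (w * cs.simple i) (simpleRoot i) = -cs.rep w (simpleRoot i) := by
  rw [cs.rep_mul_apply, cs.rep_simple, M.reflect_self (M.form_simpleRoot_self i), map_neg]

theorem CoxeterSystem.rep_nonpos_of_isRightDescent {w : W} {i : B}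
    (hi : cs.IsRightDescent w i) : cs.rep w (simpleRoot i) ≤ 0 := by
  rw [cs.isRightDescent_iff_not_isRightDescent_mul] at hi
  have := cs.rep_nonneg_of_not_isRightDescent hi
  rw [cs.rep_mul_simple_simpleRoot] at this
  exact neg_nonneg.1 this

theorem CoxeterSystem.not_isRightDescent_of_rep_nonneg {w : W} {i : B}
    (hi : 0 ≤ cs.rep w (simpleRoot i)) : ¬ cs.IsRightDescent w i := by
  intro h
  have := le_antisymm (cs.rep_nonpos_of_isRightDescent h) hi
  exact simpleRoot_ne_zero i (cs.rep_injective_apply w (this.trans (map_zero _).symm))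

theorem CoxeterSystem.rep_injective : Function.Injective cs.rep := by
  rw [injective_iff_map_eq_one]
  intro w hw
  by_contra h
  obtain ⟨j, hj⟩ := cs.exists_rightDescent_of_ne_one h
  have h1 := cs.rep_nonpos_of_isRightDescent hj j
  rw [hw] at h1
  simp [simpleRoot] at h1
  linarith

theorem CoxeterSystem.isReduced_append_singleton {ω : List B} {i : B} (h : cs.IsReduced ω)
    (hi : ¬ cs.IsRightDescent (cs.wordProd ω) i) : cs.IsReduced (ω ++ [i]) := by
  have := (cs.not_isRightDescent_iff).1 hi
  unfold CoxeterSystem.IsReduced at *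
  rw [wordProd_append, wordProd_singleton, this, h]
  simp

theorem CoxeterSystem.not_isRightDescent_of_isReduced {ω : List B} {i : B}
    (h : cs.IsReduced (ω ++ [i])) : ¬ cs.IsRightDescent (cs.wordProd ω) i := by
  rw [cs.not_isRightDescent_iff]
  have h1 : cs.IsReduced ω := by simpa using h.take ω.length
  unfold CoxeterSystem.IsReduced at *
  rw [wordProd_append, wordProd_singleton] at h
  rw [h1, h]
  simp

theorem CoxeterSystem.isReduced_of_append {ω η : List B} (h : cs.IsReduced (ω ++ η)) :
    cs.IsReduced ω := by
  simpa using h.take ω.length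

/-- A map into a monoid satisfying the braid relations of a Coxeter matrix. -/
def CoxeterMatrix.IsBraided {G : Type*} [Monoid G] (M : CoxeterMatrix B) (σ : B → G) : Prop :=
  ∀ i j, i ≠ j → M i j ≠ 0 →
    ((alternatingWord i j (M i j)).map σ).prod = ((alternatingWord j i (M i j)).map σ).prod

/-- Matsumoto's theorem. -/
theorem CoxeterSystem.prod_map_eq_of_isReduced {G : Type*} [Monoid G] {σ : B → G}
    (hσ : M.IsBraided σ) {ω η : List B} (hω : cs.IsReduced ω) (hη : cs.IsReduced η)
    (h : cs.wordProd ω = cs.wordProd η) : (ω.map σ).prod = (η.map σ).prod := by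
  induction hn : ω.length generalizing ω η with
  | zero =>
    have : η.length = 0 := by rw [← hη.eq, ← h, hω.eq, hn]
    rw [List.length_eq_zero_iff.1 hn, List.length_eq_zero_iff.1 this]
  | succ n ih =>
    have hsame : ∀ {ω η : List B} {a : B}, cs.IsReduced (ω ++ [a]) → cs.IsReduced (η ++ [a]) →
        cs.wordProd (ω ++ [a]) = cs.wordProd (η ++ [a]) → ω.length = n →
        ((ω ++ [a]).map σ).prod = ((η ++ [a]).map σ).prod := by
      intro ω η a hω hη h hn
      rw [wordProd_append, wordProd_append, mul_left_inj] at h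
      rw [List.map_append, List.prod_append, List.map_append, List.prod_append,
        ih (cs.isReduced_of_append hω) (cs.isReduced_of_append hη) h hn]
    have hlen : η.length = n + 1 := by rw [← hη.eq, ← h, hω.eq, hn]
    rcases List.eq_nil_or_concat' ω with rfl | ⟨ω, a, rfl⟩
    · simp at hn
    rcases List.eq_nil_or_concat' η with rfl | ⟨η, b, rfl⟩
    · simp at hlen
    have hωn : ω.length = n := by simpa using hn
    have hηn : η.length = n := by simpa using hlen
    rcases eq_or_ne a b with rfl | hab
    · exact hsame hω hη h hωn
    set z := cs.wordProd (η ++ [b]) with hz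
    have hza : cs.IsRightDescent z a := by
      rw [← h, cs.isRightDescent_iff_not_isRightDescent_mul, wordProd_append, wordProd_singleton,
        cs.simple_mul_simple_cancel_right]
      exact cs.not_isRightDescent_of_isReduced hω
    have hzb : cs.IsRightDescent z b := by
      rw [hz, cs.isRightDescent_iff_not_isRightDescent_mul, wordProd_append, wordProd_singleton,
        cs.simple_mul_simple_cancel_right]
      exact cs.not_isRightDescent_of_isReduced hη
    obtain ⟨v, k, hk, hv, hl, hva, hvb⟩ := cs.exists_dihedral_decomposition (i := a) hzb
    obtain ⟨ζ, hζ, rfl⟩ := cs.exists_isReduced v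
    have hred : cs.IsReduced (ζ ++ alternatingWord a b k) := by
      unfold CoxeterSystem.IsReduced
      rw [wordProd_append, ← hv, hl, hζ.eq, List.length_append, length_alternatingWord]
    have hmle : M a b ≠ 0 → k ≤ M a b := by
      intro h0
      by_contra hlt
      refine cs.not_isReduced_alternatingWord a b h0 (not_le.1 hlt) ?_
      simpa using hred.drop ζ.length
    have hm : M a b ≠ 0 ∧ k = M a b := by
      by_contra hcon
      have hm : M a b = 0 ∨ k + 1 ≤ M a b := by
        by_cases h0 : M a b = 0
        · exact Or.inl h0
        · have := hmle h0
          have : k ≠ M a b := fun h => hcon ⟨h0, h⟩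
          omega
      have hm1 := M.off_diagonal a b hab
      have hp := dihedralCoeff_nonneg (k := k) hm1 (hm.imp_right fun h => by omega)
      have hq := dihedralCoeff_nonneg (k := k + 1) hm1 hm
      have hi' := cs.rep_nonneg_of_not_isRightDescent hva
      have hj' := cs.rep_nonneg_of_not_isRightDescent hvb
      refine cs.not_isRightDescent_of_rep_nonneg ?_ hza
      rw [hv, cs.rep_mul_apply, cs.rep_alternatingWord hab]
      split_ifs <;> rw [map_add, map_smul, map_smul] <;> positivity
    obtain ⟨h0, rfl⟩ := hm
    have hbraid : cs.wordProd (alternatingWord a b (M a b)) =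
        cs.wordProd (alternatingWord b a (M a b)) := by
      have := cs.wordProd_braidWord_eq a b
      rwa [braidWord, braidWord, M.symmetric b a] at this
    have hred' : cs.IsReduced (ζ ++ alternatingWord b a (M a b)) := by
      unfold CoxeterSystem.IsReduced
      rw [wordProd_append, ← hbraid, ← hv, hl, hζ.eq, List.length_append, length_alternatingWord]
    obtain ⟨m, hm⟩ : ∃ m, M a b = m + 1 := ⟨M a b - 1, by omega⟩
    have e1 : ((ζ ++ alternatingWord a b (M a b)).map σ).prod =
        ((ζ ++ alternatingWord b a (M a b)).map σ).prod := by
      rw [List.map_append, List.prod_append, List.map_append, List.prod_append, hσ a b hab h0]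
    have hL : ζ.length + m = n := by
      have := hred.eq
      rw [wordProd_append, ← hv, hz, hη.eq] at this
      simp [hm] at this
      omega
    have e2 : ((ζ ++ alternatingWord a b (M a b)).map σ).prod = ((η ++ [b]).map σ).prod := by
      rw [← wordProd_append] at hv
      rw [hm, alternatingWord_succ, List.concat_eq_append, ← List.append_assoc] at hred hv ⊢
      exact hsame hred hη (by rw [← hz, hv]) (by simp [hL])
    have e3 : ((ζ ++ alternatingWord b a (M a b)).map σ).prod = ((ω ++ [a]).map σ).prod := by
      rw [hbraid, ← wordProd_append] at hv
      rw [hm, alternatingWord_succ, List.concat_eq_append, ← List.append_assoc] at hred' hv ⊢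
      exact hsame hred' hω (by rw [h, hv]) (by simp [hL])
    rw [← e3, ← e1, e2]

end PositiveRoots

section Roots

variable {B : Type*} [Fintype B] [DecidableEq B] {M : CoxeterMatrix B}
  {W : Type*} [Group W] (cs : CoxeterSystem M W)

/-- The positive roots of a Coxeter system. -/
def CoxeterSystem.IsPosRoot (β : B → ℝ) : Prop :=
  0 ≤ β ∧ ∃ w i, β = cs.rep w (simpleRoot i)

variable {cs}

theorem CoxeterSystem.nonneg_or_nonpos (w : W) (i : B) :
    0 ≤ cs.rep w (simpleRoot i) ∨ cs.rep w (simpleRoot i) ≤ 0 := by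
  by_cases h : cs.IsRightDescent w i
  · exact Or.inr (cs.rep_nonpos_of_isRightDescent h)
  · exact Or.inl (cs.rep_nonneg_of_not_isRightDescent h)

theorem CoxeterSystem.isPosRoot_simpleRoot (i : B) : cs.IsPosRoot (simpleRoot i) :=
  ⟨Pi.single_nonneg.2 zero_le_one, 1, i, by simp⟩

theorem CoxeterSystem.IsPosRoot.form_self {β : B → ℝ} (h : cs.IsPosRoot β) :
    M.form β β = 1 := by
  obtain ⟨-, w, i, rfl⟩ := h
  rw [cs.form_rep, M.form_simpleRoot_self]

theorem CoxeterSystem.IsPosRoot.ne_zero {β : B → ℝ} (h : cs.IsPosRoot β) : β ≠ 0 := by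
  rintro rfl
  simpa using h.form_self

theorem CoxeterSystem.IsPosRoot.not_nonpos {β : B → ℝ} (h : cs.IsPosRoot β) : ¬ β ≤ 0 :=
  fun h' => h.ne_zero (le_antisymm h' h.1)

theorem CoxeterSystem.IsPosRoot.rep_pos_or_neg {β : B → ℝ} (h : cs.IsPosRoot β) (w : W) :
    cs.IsPosRoot (cs.rep w β) ∨ cs.IsPosRoot (-cs.rep w β) := by
  obtain ⟨-, v, i, rfl⟩ := h
  rw [← cs.rep_mul_apply]
  rcases cs.nonneg_or_nonpos (w * v) i with h | h
  · exact Or.inl ⟨h, _, _, rfl⟩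
  · exact Or.inr ⟨neg_nonneg.2 h, w * v * cs.simple i, i, by rw [cs.rep_mul_simple_simpleRoot]⟩

theorem CoxeterSystem.IsPosRoot.rep_of_not_nonpos {β : B → ℝ} (h : cs.IsPosRoot β) {w : W}
    (hw : ¬ cs.rep w β ≤ 0) : cs.IsPosRoot (cs.rep w β) :=
  (h.rep_pos_or_neg w).resolve_right fun h' => hw (neg_nonneg.1 h'.1)

theorem CoxeterMatrix.reflect_simpleRoot_apply_of_ne {a b : B} (h : b ≠ a) (x : B → ℝ) :
    M.reflect (simpleRoot a) x b = x b := by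
  simp [CoxeterMatrix.reflect_apply, simpleRoot, h]

theorem CoxeterMatrix.reflect_simpleRoot_apply_self (a : B) (x : B → ℝ) :
    M.reflect (simpleRoot a) x a = x a - 2 * M.form (simpleRoot a) x := by
  simp [CoxeterMatrix.reflect_apply, simpleRoot]

theorem CoxeterSystem.IsPosRoot.exists_pos_of_ne {β : B → ℝ} (h : cs.IsPosRoot β) {a : B}
    (ha : β ≠ simpleRoot a) : ∃ b, b ≠ a ∧ 0 < β b := by
  by_contra hcon
  push Not at hcon
  have h1 : β = β a • simpleRoot a := by
    ext b
    rcases eq_or_ne b a with rfl | hb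
    · simp [simpleRoot]
    · simpa [simpleRoot, hb] using le_antisymm (hcon b hb) (h.1 b)
  have h2 := h.form_self
  have h3 := h.1 a
  rw [h1] at h2
  simp only [map_smul, LinearMap.smul_apply, M.form_simpleRoot_self, smul_eq_mul] at h2
  have h4 : β a = 1 := by
    simp only [Pi.zero_apply] at h3
    nlinarith
  rw [h4, one_smul] at h1
  exact ha h1

theorem CoxeterSystem.IsPosRoot.reflect_simpleRoot {β : B → ℝ} (h : cs.IsPosRoot β) {a : B}
    (ha : β ≠ simpleRoot a) : cs.IsPosRoot (M.reflect (simpleRoot a) β) := by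
  rw [← cs.rep_simple]
  refine h.rep_of_not_nonpos fun hle => ?_
  obtain ⟨b, hb, hpos⟩ := h.exists_pos_of_ne ha
  have := hle b
  rw [cs.rep_simple, M.reflect_simpleRoot_apply_of_ne hb] at this
  exact absurd hpos (not_lt.2 this)

theorem CoxeterSystem.rep_conj_simple (w : W) (i : B) :
    cs.rep (w * cs.simple i * w⁻¹) = M.reflect (cs.rep w (simpleRoot i)) := by
  refine LinearMap.ext fun x => ?_
  rw [cs.rep_mul_apply, cs.rep_mul_apply, cs.rep_simple, M.reflect_apply, M.reflect_apply, map_sub,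
    map_smul, cs.rep_rep_inv]
  congr 3
  rw [← cs.form_rep w, cs.rep_rep_inv]

theorem CoxeterMatrix.rep_reflect_rep_inv (w : W) {v : B → ℝ} :
    cs.rep w * M.reflect v * cs.rep w⁻¹ = M.reflect (cs.rep w v) := by
  refine LinearMap.ext fun x => ?_
  rw [Module.End.mul_apply, Module.End.mul_apply, M.reflect_apply, M.reflect_apply, map_sub,
    map_smul, cs.rep_rep_inv]
  congr 3
  rw [← cs.form_rep w, cs.rep_rep_inv]

theorem CoxeterMatrix.reflect_neg (v : B → ℝ) : M.reflect (-v) = M.reflect v := by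
  refine LinearMap.ext fun x => ?_
  simp [CoxeterMatrix.reflect_apply]

theorem CoxeterSystem.mul_simple_eq_of_rep_eq {w : W} {i j : B}
    (h : cs.rep w (simpleRoot i) = simpleRoot j) : w * cs.simple i = cs.simple j * w := by
  have := cs.rep_conj_simple w i
  rw [h, ← cs.rep_simple] at this
  rw [← cs.rep_injective this]
  group

theorem CoxeterSystem.IsPosRoot.eq_of_reflect_eq {β γ : B → ℝ} (hβ : cs.IsPosRoot β)
    (hγ : cs.IsPosRoot γ) (h : M.reflect β = M.reflect γ) : β = γ := by
  have h1 : M.reflect γ β = -β := by rw [← h, M.reflect_self hβ.form_self]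
  rw [M.reflect_apply] at h1
  set t := M.form γ β with ht
  have h2 : β = t • γ := by
    have : (2 : ℝ) • β = (2 : ℝ) • (t • γ) := by
      calc (2 : ℝ) • β = β - -β := by module
        _ = β - (β - (2 * t) • γ) := by rw [h1]
        _ = _ := by module
    exact smul_right_injective _ two_ne_zero this
  have h3 : t ^ 2 = 1 := by
    have := hβ.form_self
    rw [h2] at this
    simp only [map_smul, LinearMap.smul_apply, hγ.form_self, smul_eq_mul] at this
    linarith
  have h4 : 0 ≤ t := by
    by_contra hneg
    refine hβ.not_nonpos ?_
    rw [h2]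
    exact smul_nonpos_of_nonpos_of_nonneg (not_le.1 hneg).le hγ.1
  have h5 : t = 1 := by nlinarith
  rw [h2, h5, one_smul]

theorem CoxeterSystem.exists_isPosRoot_of_isConj (w : W) (i : B) :
    ∃ β, cs.IsPosRoot β ∧ cs.rep (w * cs.simple i * w⁻¹) = M.reflect β := by
  rw [cs.rep_conj_simple]
  rcases cs.isPosRoot_simpleRoot i |>.rep_pos_or_neg w with h | h
  · exact ⟨_, h, rfl⟩
  · exact ⟨_, h, (M.reflect_neg _).symm⟩

end Roots

section EulerForm

variable {B : Type*} [Fintype B] [DecidableEq B] (M : CoxeterMatrix B)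

/-- The coordinate projection onto the span of the simple roots in a list. -/
def restrictTo (l : List B) : (B → ℝ) →ₗ[ℝ] (B → ℝ) where
  toFun x b := if b ∈ l then x b else 0
  map_add' x y := by ext b; by_cases h : b ∈ l <;> simp [h]
  map_smul' c x := by ext b; simp

theorem restrictTo_apply (l : List B) (x : B → ℝ) (b : B) :
    restrictTo l x b = if b ∈ l then x b else 0 := rfl

theorem restrictTo_nil (x : B → ℝ) : restrictTo [] x = 0 := by
  ext
  simp [restrictTo_apply]

omit [Fintype B] [DecidableEq B] in
theorem nodup_append_singleton_iff {a : B} {l : List B} : (l ++ [a]).Nodup ↔ (a :: l).Nodup :=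
  (List.perm_append_singleton a l).nodup_iff

/-- The vectors supported in a list of indices. -/
def SupportedIn (l : List B) (x : B → ℝ) : Prop := ∀ b, b ∉ l → x b = 0

theorem restrictTo_of_supportedIn {l : List B} {x : B → ℝ} (h : SupportedIn l x) :
    restrictTo l x = x := by
  ext b
  by_cases hb : b ∈ l <;> simp [restrictTo_apply, hb, h b]

theorem restrictTo_cons {a : B} {l : List B} (ha : a ∉ l) (x : B → ℝ) :
    restrictTo (a :: l) x = x a • simpleRoot a + restrictTo l x := by
  ext b
  rcases eq_or_ne b a with rfl | hb
  · simp [restrictTo_apply, simpleRoot, ha]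
  · simp [restrictTo_apply, simpleRoot, hb]

theorem restrictTo_congr {l : List B} {x y : B → ℝ} (h : ∀ b ∈ l, x b = y b) :
    restrictTo l x = restrictTo l y := by
  ext b
  by_cases hb : b ∈ l <;> simp [restrictTo_apply, hb, h b]

theorem restrictTo_reverse (l : List B) (x : B → ℝ) :
    restrictTo l.reverse x = restrictTo l x := by
  ext b
  simp [restrictTo_apply]

/-- The Euler form attached to an ordering of the simple roots; its symmetrization is twice the
canonical form. -/
noncomputable def CoxeterMatrix.euler : List B → LinearMap.BilinForm ℝ (B → ℝ)
  | [] => 0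
  | a :: l => (LinearMap.proj a + 2 • (M.form (simpleRoot a)) ∘ₗ restrictTo l).smulRight
      (LinearMap.proj a : (B → ℝ) →ₗ[ℝ] ℝ) + CoxeterMatrix.euler l

theorem CoxeterMatrix.euler_nil (x y : B → ℝ) : M.euler [] x y = 0 := rfl

theorem CoxeterMatrix.euler_cons (a : B) (l : List B) (x y : B → ℝ) :
    M.euler (a :: l) x y =
      (x a + 2 * M.form (simpleRoot a) (restrictTo l x)) * y a + M.euler l x y := by
  simp [CoxeterMatrix.euler]

theorem CoxeterMatrix.euler_congr {l : List B} {x x' y y' : B → ℝ} (hx : ∀ b ∈ l, x b = x' b)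
    (hy : ∀ b ∈ l, y b = y' b) : M.euler l x y = M.euler l x' y' := by
  induction l with
  | nil => rfl
  | cons a l ih =>
    rw [M.euler_cons, M.euler_cons, ih (fun b hb => hx b (List.mem_cons_of_mem _ hb))
      (fun b hb => hy b (List.mem_cons_of_mem _ hb)), hx a List.mem_cons_self,
      hy a List.mem_cons_self, restrictTo_congr fun b hb => hx b (List.mem_cons_of_mem _ hb)]

theorem CoxeterMatrix.euler_append_singleton {a : B} {l : List B} (hl : (l ++ [a]).Nodup)
    (x y : B → ℝ) : M.euler (l ++ [a]) x y =
      M.euler l x y + x a * (y a + 2 * M.form (simpleRoot a) (restrictTo l y)) := by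
  induction l with
  | nil =>
    simp only [List.nil_append, M.euler_cons, M.euler_nil, restrictTo_nil, map_zero]
    ring
  | cons b l ih =>
    rw [List.cons_append, List.nodup_cons] at hl
    have hb : b ∉ l := fun h => hl.1 (by simp [h])
    have hba : b ≠ a := fun h => hl.1 (by simp [h])
    have ha := (List.nodup_cons.1 (nodup_append_singleton_iff.1 hl.2)).1
    have h1 : restrictTo (l ++ [a]) x = x a • simpleRoot a + restrictTo l x := by
      rw [← restrictTo_cons ha]
      ext c
      simp [restrictTo_apply, or_comm]
    rw [List.cons_append, M.euler_cons, ih hl.2, M.euler_cons, h1, restrictTo_cons hb,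
      map_add, map_add, map_smul, map_smul, M.form_comm (simpleRoot a) (simpleRoot b)]
    simp only [smul_eq_mul]
    ring

theorem CoxeterMatrix.euler_reverse {l : List B} (hl : l.Nodup) (x y : B → ℝ) :
    M.euler l.reverse x y = M.euler l y x := by
  induction l with
  | nil => rfl
  | cons a l ih =>
    rw [List.reverse_cons, M.euler_append_singleton (by simpa using List.nodup_reverse.2 hl),
      ih hl.of_cons, M.euler_cons, restrictTo_reverse]
    ring

theorem CoxeterMatrix.euler_add_euler {l : List B} (hl : l.Nodup) (x y : B → ℝ) :
    M.euler l x y + M.euler l y x = 2 * M.form (restrictTo l x) (restrictTo l y) := by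
  induction l with
  | nil =>
    simp [M.euler_nil, restrictTo_nil]
  | cons a l ih =>
    have ha := (List.nodup_cons.1 hl).1
    have := ih hl.of_cons
    rw [M.euler_cons, M.euler_cons, restrictTo_cons ha, restrictTo_cons ha]
    simp only [map_add, map_smul, LinearMap.add_apply, LinearMap.smul_apply, smul_eq_mul,
      M.form_simpleRoot_self, M.form_comm (restrictTo l x) (simpleRoot a)]
    linarith

theorem CoxeterMatrix.euler_right_eq_zero {a : B} {l : List B} (ha : a ∉ l) (x : B → ℝ) :
    M.euler l x (simpleRoot a) = 0 := by
  rw [M.euler_congr (x' := x) (y' := 0) (fun _ _ => rfl)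
    fun b hb => by simp [simpleRoot, show b ≠ a from fun h => ha (h ▸ hb)], map_zero]

theorem CoxeterMatrix.euler_left_eq_zero {a : B} {l : List B} (ha : a ∉ l) (y : B → ℝ) :
    M.euler l (simpleRoot a) y = 0 := by
  rw [M.euler_congr (x' := 0) (y' := y)
    (fun b hb => by simp [simpleRoot, show b ≠ a from fun h => ha (h ▸ hb)])
    fun _ _ => rfl, map_zero, LinearMap.zero_apply]

theorem CoxeterMatrix.euler_simpleRoot_left {a : B} {l : List B} (ha : a ∉ l) (y : B → ℝ) :
    M.euler (a :: l) (simpleRoot a) y = y a := by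
  have : restrictTo l (simpleRoot a) = 0 := by
    ext b
    by_cases hb : b ∈ l
    · simp [restrictTo_apply, simpleRoot, show b ≠ a from fun h => ha (h ▸ hb)]
    · simp [restrictTo_apply, hb]
  rw [M.euler_cons, M.euler_left_eq_zero ha, this]
  simp [simpleRoot]

theorem CoxeterMatrix.euler_simpleRoot_right {a : B} {l : List B} (ha : a ∉ l) {y : B → ℝ}
    (hy : SupportedIn (a :: l) y) :
    M.euler (a :: l) y (simpleRoot a) = -M.reflect (simpleRoot a) y a := by
  have h : M.form (simpleRoot a) y = y a + M.form (simpleRoot a) (restrictTo l y) := by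
    conv_lhs => rw [← restrictTo_of_supportedIn hy, restrictTo_cons ha]
    rw [map_add, map_smul, M.form_simpleRoot_self]
    simp
  rw [M.euler_cons, M.euler_right_eq_zero ha, M.reflect_simpleRoot_apply_self, h]
  simp [simpleRoot]
  ring

theorem CoxeterMatrix.euler_reflect {a : B} {l : List B} (hl : (a :: l).Nodup) {x y : B → ℝ}
    (hx : SupportedIn (a :: l) x) (hy : SupportedIn (a :: l) y) :
    M.euler (l ++ [a]) (M.reflect (simpleRoot a) x) (M.reflect (simpleRoot a) y) =
      M.euler (a :: l) x y := by
  have ha := (List.nodup_cons.1 hl).1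
  have hne : ∀ b ∈ l, b ≠ a := fun b hb h => ha (h ▸ hb)
  have h : ∀ y, SupportedIn (a :: l) y →
      M.form (simpleRoot a) y = y a + M.form (simpleRoot a) (restrictTo l y) := by
    intro y hy
    conv_lhs => rw [← restrictTo_of_supportedIn hy, restrictTo_cons ha]
    rw [map_add, map_smul, M.form_simpleRoot_self]
    simp
  have h' : ∀ y : B → ℝ, ∀ b ∈ l, M.reflect (simpleRoot a) y b = y b := fun y b hb =>
    M.reflect_simpleRoot_apply_of_ne (hne b hb) y
  rw [M.euler_append_singleton (nodup_append_singleton_iff.2 hl), M.euler_cons,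
    restrictTo_congr (h' y), M.euler_congr (h' x) (h' y), M.reflect_simpleRoot_apply_self,
    M.reflect_simpleRoot_apply_self, h x hx, h y hy]
  ring

variable {M} {W : Type*} [Group W] (cs : CoxeterSystem M W)

theorem CoxeterSystem.rep_wordProd_apply_of_notMem {l : List B} {b : B} (hb : b ∉ l)
    (x : B → ℝ) : cs.rep (cs.wordProd l) x b = x b := by
  induction l with
  | nil => simp
  | cons a l ih =>
    rw [List.mem_cons, not_or] at hb
    rw [wordProd_cons, cs.rep_mul_apply, cs.rep_simple, M.reflect_simpleRoot_apply_of_ne hb.1,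
      ih hb.2]

theorem CoxeterSystem.rep_wordProd_inv_apply_of_notMem {l : List B} {b : B} (hb : b ∉ l)
    (x : B → ℝ) : cs.rep (cs.wordProd l)⁻¹ x b = x b := by
  rw [← wordProd_reverse]
  exact cs.rep_wordProd_apply_of_notMem (by simpa using hb) x

theorem CoxeterSystem.euler_sub_rep_inv {l : List B} (hl : l.Nodup) (x y : B → ℝ) :
    M.euler l x (y - cs.rep (cs.wordProd l)⁻¹ y) = 2 * M.form (restrictTo l x) y := by
  induction l generalizing y with
  | nil =>
    simp [restrictTo_nil]
  | cons a l ih =>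
    have ha := (List.nodup_cons.1 hl).1
    rw [wordProd_cons, mul_inv_rev, cs.inv_simple, cs.rep_mul_apply, cs.rep_simple,
      M.euler_cons, restrictTo_cons ha]
    set z := M.reflect (simpleRoot a) y with hz
    have h1 : y - cs.rep (cs.wordProd l)⁻¹ z =
        (2 * M.form (simpleRoot a) y) • simpleRoot a + (z - cs.rep (cs.wordProd l)⁻¹ z) := by
      rw [hz, M.reflect_apply]
      module
    have h2 : (y - cs.rep (cs.wordProd l)⁻¹ z) a = 2 * M.form (simpleRoot a) y := by
      rw [Pi.sub_apply, cs.rep_wordProd_inv_apply_of_notMem ha, hz,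
        M.reflect_simpleRoot_apply_self]
      ring
    have h3 : M.euler l x (y - cs.rep (cs.wordProd l)⁻¹ z) = 2 * M.form (restrictTo l x) z := by
      rw [h1, map_add, map_smul, M.euler_right_eq_zero ha, ih hl.of_cons]
      simp
    rw [h2, h3, hz, M.reflect_apply]
    simp only [map_add, map_sub, map_smul, LinearMap.add_apply, LinearMap.smul_apply, smul_eq_mul,
      M.form_comm (simpleRoot a) (restrictTo l x)]
    ring

end EulerForm

section Lifts

variable {B : Type*} [Fintype B] [DecidableEq B] (M : CoxeterMatrix B)
  {G : Type*} [Group G] {σ : B → G}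

/-- The lift of a positive root to a conjugate of a generator obtained by moving the letters of
an ordering of the simple roots from the left end to the right end. -/
inductive LeftLift (σ : B → G) : List B → (B → ℝ) → G → Prop
  | base (a : B) (l : List B) : LeftLift σ (a :: l) (simpleRoot a) (σ a)
  | drop (a : B) (l : List B) (β : B → ℝ) (x : G) :
      β a = 0 → LeftLift σ l β x → LeftLift σ (a :: l) β x
  | refl (a : B) (l : List B) (β : B → ℝ) (x : G) :
      β a ≠ 0 → β ≠ simpleRoot a → LeftLift σ (l ++ [a]) (M.reflect (simpleRoot a) β) x →
      LeftLift σ (a :: l) β (σ a * x * (σ a)⁻¹)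

/-- The mirror image of `LeftLift`. -/
def RightLift (σ : B → G) (l : List B) (β : B → ℝ) (x : G) : Prop :=
  LeftLift M (fun b => MulOpposite.op (σ b)) l.reverse β (MulOpposite.op x)

variable {M}

theorem LeftLift.map {H : Type*} [Group H] (f : G →* H) {l : List B} {β : B → ℝ} {x : G}
    (h : LeftLift M σ l β x) : LeftLift M (fun b => f (σ b)) l β (f x) := by
  induction h with
  | base a l => exact .base (σ := fun b => f (σ b)) a l
  | drop a l β x hβ _ ih => exact .drop a l β _ hβ ih
  | refl a l β x hβ hne _ ih =>
    rw [map_mul, map_mul, map_inv]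
    exact .refl (σ := fun b => f (σ b)) a l β _ hβ hne ih

theorem RightLift.base (a : B) (l : List B) : RightLift M σ (l ++ [a]) (simpleRoot a) (σ a) := by
  unfold RightLift
  rw [List.reverse_append]
  exact LeftLift.base (σ := fun b => MulOpposite.op (σ b)) a l.reverse

theorem RightLift.refl {a : B} {l : List B} {β : B → ℝ} {x : G} (h0 : β a ≠ 0)
    (hne : β ≠ simpleRoot a) (h : RightLift M σ (a :: l) (M.reflect (simpleRoot a) β) x) :
    RightLift M σ (l ++ [a]) β ((σ a)⁻¹ * x * σ a) := by
  unfold RightLift at *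
  rw [List.reverse_append]
  rw [List.reverse_cons] at h
  have := LeftLift.refl a l.reverse β _ h0 hne h
  simpa [mul_assoc] using this

theorem LeftLift.insert {l₁ l₂ : List B} {β : B → ℝ} {x : G} {a : B}
    (h : LeftLift M σ (l₁ ++ l₂) β x) (ha : β a = 0) : LeftLift M σ (l₁ ++ a :: l₂) β x := by
  generalize hL : l₁ ++ l₂ = L at h
  induction h generalizing l₁ l₂ with
  | base b l =>
    cases l₁ with
    | nil =>
      rw [List.nil_append] at hL ⊢
      exact .drop _ _ _ _ ha (hL ▸ .base b l)
    | cons c l₁ =>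
      obtain ⟨rfl, -⟩ := List.cons.inj hL
      exact .base c _
  | drop b l β x hβ h ih =>
    cases l₁ with
    | nil =>
      rw [List.nil_append] at hL ⊢
      exact .drop _ _ _ _ ha (hL ▸ .drop b l β x hβ h)
    | cons c l₁ =>
      obtain ⟨rfl, hl⟩ := List.cons.inj hL
      exact .drop _ _ _ _ hβ (ih ha hl)
  | refl b l β x hβ hne h ih =>
    cases l₁ with
    | nil =>
      rw [List.nil_append] at hL ⊢
      exact .drop _ _ _ _ ha (hL ▸ .refl b l β x hβ hne h)
    | cons c l₁ =>
      obtain ⟨rfl, rfl⟩ := List.cons.inj hL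
      have hab : a ≠ c := by
        rintro rfl
        exact hβ ha
      have := ih (l₁ := l₁) (l₂ := l₂ ++ [c])
        (by rwa [M.reflect_simpleRoot_apply_of_ne hab]) (by simp)
      refine .refl _ _ _ _ hβ hne ?_
      simpa using this

theorem RightLift.insert {l₁ l₂ : List B} {β : B → ℝ} {x : G} {a : B}
    (h : RightLift M σ (l₁ ++ l₂) β x) (ha : β a = 0) : RightLift M σ (l₁ ++ a :: l₂) β x := by
  unfold RightLift at *
  rw [List.reverse_append] at h
  simpa using h.insert ha

theorem LeftLift.unique {l : List B} {β : B → ℝ} {x y : G} (h : LeftLift M σ l β x)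
    (h' : LeftLift M σ l β y) : x = y := by
  induction h generalizing y with
  | base a l =>
    generalize hβ : simpleRoot a = β at h'
    cases h' with
    | base => rfl
    | drop _ _ _ _ h0 _ => simp [← hβ, simpleRoot] at h0
    | refl _ _ _ _ _ hne _ => exact absurd hβ.symm hne
  | drop a l β x h0 _ ih =>
    cases h' with
    | base => simp [simpleRoot] at h0
    | drop _ _ _ _ _ h => exact ih h
    | refl _ _ _ _ h0' _ _ => exact absurd h0 h0'
  | refl a l β x h0 hne _ ih =>
    cases h' with
    | base => exact absurd rfl hne
    | drop _ _ _ _ h0' _ => exact absurd h0' h0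
    | refl _ _ _ _ _ _ h => rw [ih h]

theorem RightLift.unique {l : List B} {β : B → ℝ} {x y : G} (h : RightLift M σ l β x)
    (h' : RightLift M σ l β y) : x = y :=
  MulOpposite.op_injective (LeftLift.unique h h')

theorem LeftLift.mem_closure {l : List B} {β : B → ℝ} {x : G} (h : LeftLift M σ l β x) :
    x ∈ Subgroup.closure (σ '' {b | β b ≠ 0}) := by
  induction h with
  | base a l => exact Subgroup.subset_closure ⟨a, by simp [simpleRoot], rfl⟩
  | drop a l β x _ _ ih => exact ih
  | refl a l β x h0 _ _ ih =>
    have ha : σ a ∈ Subgroup.closure (σ '' {b | β b ≠ 0}) := Subgroup.subset_closure ⟨a, h0, rfl⟩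
    refine mul_mem (mul_mem ha ?_) (inv_mem ha)
    refine Subgroup.closure_mono (Set.image_mono fun b hb => ?_) ih
    rcases eq_or_ne b a with rfl | hba
    · exact h0
    · exact fun h => hb ((M.reflect_simpleRoot_apply_of_ne hba β).trans h)

theorem prod_map_op (σ : B → G) (u : List B) :
    (u.map fun b => MulOpposite.op (σ b)).prod = MulOpposite.op (u.reverse.map σ).prod := by
  induction u with
  | nil => simp
  | cons a u ih => simp [ih]

theorem reverse_alternatingWord (i j : B) (m : ℕ) :
    (alternatingWord i j m).reverse =
      if Even m then alternatingWord j i m else alternatingWord i j m := by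
  induction m generalizing i j with
  | zero => simp [alternatingWord]
  | succ m ih =>
    conv_lhs => rw [alternatingWord_succ, List.concat_eq_append, List.reverse_append, ih]
    by_cases h : Even m <;>
      simp [h, Nat.even_add_one, alternatingWord_succ']

theorem CoxeterMatrix.IsBraided.op (h : M.IsBraided σ) :
    M.IsBraided fun b => MulOpposite.op (σ b) := by
  intro i j hij h0
  rw [prod_map_op, prod_map_op, reverse_alternatingWord, reverse_alternatingWord]
  split_ifs
  · rw [h i j hij h0]
  · rw [h i j hij h0]

variable {W : Type*} [Group W] {cs : CoxeterSystem M W}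

theorem CoxeterSystem.isReduced_cons {ω : List B} {i : B} (h : cs.IsReduced ω)
    (hi : 0 ≤ cs.rep (cs.wordProd ω)⁻¹ (simpleRoot i)) : cs.IsReduced (i :: ω) := by
  rw [← cs.isReduced_reverse_iff, List.reverse_cons]
  refine cs.isReduced_append_singleton h.reverse ?_
  rw [wordProd_reverse]
  exact cs.not_isRightDescent_of_rep_nonneg hi

theorem CoxeterSystem.isReduced_reverse_append {p u : List B} (hp : cs.IsReduced p)
    (hu : cs.IsReduced u) (h : ∀ γ, cs.IsPosRoot γ → cs.rep (cs.wordProd u)⁻¹ γ ≤ 0 →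
      ¬ cs.rep (cs.wordProd p)⁻¹ γ ≤ 0) : cs.IsReduced (p.reverse ++ u) := by
  induction u using List.reverseRecOn with
  | nil => simpa using hp
  | append_singleton u i ih =>
    have hi := cs.not_isRightDescent_of_isReduced hu
    have hpos : cs.IsPosRoot (cs.rep (cs.wordProd u) (simpleRoot i)) :=
      ⟨cs.rep_nonneg_of_not_isRightDescent hi, _, _, rfl⟩
    have hrep : ∀ γ, cs.rep (cs.wordProd (u ++ [i]))⁻¹ γ =
        cs.rep (cs.simple i) (cs.rep (cs.wordProd u)⁻¹ γ) := by
      intro γ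
      rw [wordProd_append, mul_inv_rev, wordProd_singleton, cs.inv_simple, cs.rep_mul_apply]
    have h1 := ih (cs.isReduced_of_append hu) ?_
    · rw [← List.append_assoc]
      refine cs.isReduced_append_singleton h1 (cs.not_isRightDescent_of_rep_nonneg ?_)
      rw [wordProd_append, wordProd_reverse, cs.rep_mul_apply]
      refine (hpos.rep_of_not_nonpos (h _ hpos ?_)).1
      rw [hrep, cs.rep_inv_rep, cs.rep_simple, M.reflect_self (M.form_simpleRoot_self i)]
      exact neg_nonpos.2 (cs.isPosRoot_simpleRoot i).1
    · intro γ hγ hle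
      refine h γ hγ ?_
      rw [hrep]
      have hδ : cs.IsPosRoot (-cs.rep (cs.wordProd u)⁻¹ γ) :=
        (hγ.rep_pos_or_neg _).resolve_left fun h' => h'.not_nonpos hle
      have hne : -cs.rep (cs.wordProd u)⁻¹ γ ≠ simpleRoot i := by
        intro heq
        rw [← heq, map_neg, cs.rep_rep_inv] at hpos
        exact hγ.not_nonpos (neg_nonneg.1 hpos.1)
      have := (hδ.reflect_simpleRoot hne).1
      rwa [map_neg, neg_nonneg, ← cs.rep_simple] at this

theorem SupportedIn.of_reflect {a : B} {l : List B} {β : B → ℝ}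
    (h : SupportedIn (l ++ [a]) (M.reflect (simpleRoot a) β)) : SupportedIn (a :: l) β := by
  intro b hb
  have hba : b ≠ a := fun h' => hb (by simp [h'])
  rw [← M.reflect_simpleRoot_apply_of_ne hba β]
  exact h b (by simpa [or_comm] using hb)

theorem SupportedIn.reflect {a : B} {l : List B} {β : B → ℝ}
    (h : SupportedIn (a :: l) β) : SupportedIn (l ++ [a]) (M.reflect (simpleRoot a) β) := by
  refine fun b hb => ?_
  have hba : b ≠ a := fun h' => hb (by simp [h'])
  rw [M.reflect_simpleRoot_apply_of_ne hba β]
  exact h b (by simpa [or_comm] using hb)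

theorem SupportedIn.of_cons {a : B} {l : List B} {β : B → ℝ}
    (h : SupportedIn (a :: l) β) (ha : β a = 0) : SupportedIn l β := by
  intro b hb
  rcases eq_or_ne b a with rfl | hba
  · exact ha
  · exact h b (by simp [hb, hba])

theorem SupportedIn.mono {l l' : List B} {β : B → ℝ} (h : SupportedIn l β) (hl : l ⊆ l') :
    SupportedIn l' β := fun b hb => h b fun h' => hb (hl h')

theorem supportedIn_simpleRoot {a : B} {l : List B} (h : a ∈ l) :
    SupportedIn l (simpleRoot a) := by
  intro b hb
  simp [simpleRoot, show b ≠ a from fun h' => hb (h' ▸ h)]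

theorem LeftLift.exists_word {l : List B} {β : B → ℝ} {x : G} (h : LeftLift M σ l β x)
    (hl : l.Nodup) (hβ : cs.IsPosRoot β) :
    SupportedIn l β ∧ ∃ u i, cs.IsReduced u ∧ cs.rep (cs.wordProd u) (simpleRoot i) = β ∧
      x = (u.map σ).prod * σ i * (u.map σ).prod⁻¹ ∧
      ∀ γ, cs.IsPosRoot γ → cs.rep (cs.wordProd u)⁻¹ γ ≤ 0 →
        SupportedIn l γ ∧ 0 < M.euler l γ β ∧ M.euler l β γ ≤ 0 := by
  induction h with
  | base a l =>
    refine ⟨supportedIn_simpleRoot List.mem_cons_self, [], a, by simp [CoxeterSystem.IsReduced],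
      by simp, by simp, fun γ hγ hle => absurd (by simpa using hle) hγ.not_nonpos⟩
  | drop a l β x h0 _ ih =>
    obtain ⟨hs, u, i, hu, hui, hx, hγ⟩ := ih hl.of_cons hβ
    refine ⟨hs.mono (List.subset_cons_self _ _), u, i, hu, hui, hx, fun γ hγpos hle => ?_⟩
    obtain ⟨h1, h2, h3⟩ := hγ γ hγpos hle
    have h4 := h1 a (List.nodup_cons.1 hl).1
    refine ⟨h1.mono (List.subset_cons_self _ _), ?_, ?_⟩
    · rwa [M.euler_cons, h0, mul_zero, zero_add]
    · rwa [M.euler_cons, h4, mul_zero, zero_add]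
  | refl a l β x h0 hne _ ih =>
    have ha := (List.nodup_cons.1 hl).1
    have hβ' := hβ.reflect_simpleRoot hne
    obtain ⟨hs, u, i, hu, hui, hx, hγ⟩ := ih (nodup_append_singleton_iff.2 hl) hβ'
    have hs' := hs.of_reflect
    have hpos : 0 < β a := lt_of_le_of_ne (hβ.1 a) (Ne.symm h0)
    have hαs : SupportedIn (a :: l) (simpleRoot a) := supportedIn_simpleRoot List.mem_cons_self
    have hred : cs.IsReduced (a :: u) := by
      refine cs.isReduced_cons hu ?_
      by_contra hcon
      have hle : cs.rep (cs.wordProd u)⁻¹ (simpleRoot a) ≤ 0 :=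
        (cs.nonneg_or_nonpos _ a).resolve_left hcon
      have h2 := (hγ _ (cs.isPosRoot_simpleRoot a) hle).2.1
      have h3 := M.euler_reflect hl hαs hs'
      rw [M.reflect_self (M.form_simpleRoot_self a), map_neg, LinearMap.neg_apply,
        M.euler_simpleRoot_left ha] at h3
      linarith
    refine ⟨hs', a :: u, i, hred, ?_, ?_, ?_⟩
    · rw [wordProd_cons, cs.rep_mul_apply, hui, cs.rep_simple,
        M.reflect_reflect (M.form_simpleRoot_self a)]
    · rw [hx, List.map_cons, List.prod_cons]
      group
    · intro γ hγpos hle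
      rw [wordProd_cons, mul_inv_rev, cs.inv_simple, cs.rep_mul_apply, cs.rep_simple] at hle
      rcases eq_or_ne γ (simpleRoot a) with rfl | hγne
      · refine ⟨hαs, by rwa [M.euler_simpleRoot_left ha], ?_⟩
        rw [M.euler_simpleRoot_right ha hs', neg_nonpos]
        exact hβ'.1 a
      · obtain ⟨h1, h2, h3⟩ := hγ _ (hγpos.reflect_simpleRoot hγne) hle
        have hsγ := h1.of_reflect
        rw [M.euler_reflect hl hsγ hs'] at h2
        rw [M.euler_reflect hl hs' hsγ] at h3
        exact ⟨hsγ, h2, h3⟩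

theorem LeftLift.eq_of_rightLift (hσ : M.IsBraided σ) {l : List B} {β : B → ℝ} {x y : G}
    (hl : l.Nodup) (hβ : cs.IsPosRoot β) (h : LeftLift M σ l β x) (h' : RightLift M σ l β y) :
    x = y := by
  obtain ⟨-, u, i, hu, hui, hx, hγ⟩ := h.exists_word hl hβ
  obtain ⟨-, p, j, hp, hpj, hy, hγ'⟩ := LeftLift.exists_word h' (List.nodup_reverse.2 hl) hβ
  have hred : cs.IsReduced (p.reverse ++ u) := by
    refine cs.isReduced_reverse_append hp hu fun γ hpos h1 h2 => ?_
    have h3 := (hγ γ hpos h1).2.2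
    have h4 := (hγ' γ hpos h2).2.1
    rw [M.euler_reverse hl] at h4
    linarith
  have hz : cs.rep (cs.wordProd (p.reverse ++ u)) (simpleRoot i) = simpleRoot j := by
    rw [wordProd_append, wordProd_reverse, cs.rep_mul_apply, hui, ← hpj, cs.rep_inv_rep]
  have h1 : cs.IsReduced ((p.reverse ++ u) ++ [i]) := by
    refine cs.isReduced_append_singleton hred (cs.not_isRightDescent_of_rep_nonneg ?_)
    rw [hz]
    exact (cs.isPosRoot_simpleRoot j).1
  have h2 : cs.IsReduced (j :: (p.reverse ++ u)) := by
    refine cs.isReduced_cons hred ?_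
    rw [← hz, cs.rep_inv_rep]
    exact (cs.isPosRoot_simpleRoot i).1
  have h3 := cs.prod_map_eq_of_isReduced hσ h1 h2 (by
    rw [wordProd_append, wordProd_singleton, wordProd_cons]
    exact cs.mul_simple_eq_of_rep_eq hz)
  rw [prod_map_op, ← MulOpposite.op_inv, ← MulOpposite.op_mul, ← MulOpposite.op_mul] at hy
  rw [hx, MulOpposite.op_injective hy]
  simp only [List.map_append, List.map_cons, List.map_nil, List.prod_append, List.prod_cons,
    List.prod_nil, mul_one] at h3
  rw [mul_inv_eq_iff_eq_mul]
  simp only [mul_assoc] at h3 ⊢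
  rw [← h3]
  group

end Lifts

section Rotation

variable {B : Type*} [Fintype B] [DecidableEq B] {M : CoxeterMatrix B}
  {G : Type*} [Group G] {σ : B → G}

theorem cos_pi_div_nonneg {m : ℕ} (hm : m ≠ 1) : 0 ≤ Real.cos (Real.pi / m) := by
  rcases Nat.eq_zero_or_pos m with rfl | h0
  · simp
  have h2 : (2 : ℝ) ≤ m := by exact_mod_cast (by omega : 2 ≤ m)
  apply Real.cos_nonneg_of_neg_pi_div_two_le_of_le
  · have : 0 ≤ Real.pi / m := by positivity
    linarith [Real.pi_pos]
  · gcongr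

theorem eq_two_of_cos_pi_div_eq_zero {m : ℕ} (hm : m ≠ 1) (h : Real.cos (Real.pi / m) = 0) :
    m = 2 := by
  rcases Nat.eq_zero_or_pos m with rfl | h0
  · simp at h
  by_contra hne
  have h3 : (3 : ℝ) ≤ m := by exact_mod_cast (by omega : 3 ≤ m)
  have : 0 < Real.cos (Real.pi / m) := by
    apply Real.cos_pos_of_mem_Ioo
    constructor
    · have : 0 ≤ Real.pi / m := by positivity
      linarith [Real.pi_pos]
    · rw [div_lt_div_iff₀ (by linarith) (by norm_num)]
      nlinarith [Real.pi_pos]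
  exact this.ne' h

theorem CoxeterMatrix.form_simpleRoot_nonpos {a b : B} (h : a ≠ b) :
    M.form (simpleRoot a) (simpleRoot b) ≤ 0 := by
  rw [M.form_simpleRoot, neg_nonpos]
  exact cos_pi_div_nonneg (M.off_diagonal a b h)

theorem eq_sum_smul_simpleRoot (x : B → ℝ) : x = ∑ b, x b • simpleRoot b := by
  ext c
  simp [simpleRoot, Finset.sum_apply, Pi.single_apply]

theorem CoxeterMatrix.IsBraided.commute (hσ : M.IsBraided σ) {a b : B} (hab : a ≠ b)
    (h : M.form (simpleRoot a) (simpleRoot b) = 0) : Commute (σ a) (σ b) := by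
  rw [M.form_simpleRoot, neg_eq_zero] at h
  have h2 := eq_two_of_cos_pi_div_eq_zero (M.off_diagonal a b hab) h
  have h3 := hσ a b hab (by omega)
  rw [h2] at h3
  simpa [alternatingWord, commute_iff_eq] using h3

theorem LeftLift.commute (hσ : M.IsBraided σ) {l : List B} {β : B → ℝ} {x : G}
    (h : LeftLift M σ l β x) (hβ : 0 ≤ β) {a : B} (ha : β a = 0)
    (hf : M.form (simpleRoot a) β = 0) : Commute (σ a) x := by
  have hz : ∀ b, β b ≠ 0 → M.form (simpleRoot a) (simpleRoot b) = 0 := by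
    rw [eq_sum_smul_simpleRoot β, map_sum] at hf
    simp only [map_smul, smul_eq_mul] at hf
    rw [Finset.sum_eq_zero_iff_of_nonpos] at hf
    · intro b hb
      exact (mul_eq_zero.1 (hf b (Finset.mem_univ b))).resolve_left hb
    · intro b _
      rcases eq_or_ne a b with rfl | hab
      · simp [ha]
      · exact mul_nonpos_of_nonneg_of_nonpos (hβ b) (M.form_simpleRoot_nonpos hab)
  have hle : Subgroup.closure (σ '' {b | β b ≠ 0}) ≤ Subgroup.centralizer {σ a} := by
    rw [Subgroup.closure_le]
    rintro _ ⟨b, hb, rfl⟩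
    have hab : a ≠ b := by
      rintro rfl
      exact hb ha
    exact Subgroup.mem_centralizer_singleton_iff.2 (hσ.commute hab (hz b hb)).symm
  exact (Subgroup.mem_centralizer_singleton_iff.1 (hle h.mem_closure)).symm

variable (M σ) in
/-- A lift of a positive root from either side. -/
def IsLift (l : List B) (β : B → ℝ) (x : G) : Prop :=
  LeftLift M σ l β x ∨ RightLift M σ l β x

theorem rightLift_op_iff {l : List B} {β : B → ℝ} {x : G} :
    RightLift M (fun b => MulOpposite.op (σ b)) l.reverse β (MulOpposite.op x) ↔
      LeftLift M σ l β x := by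
  unfold RightLift
  rw [List.reverse_reverse]
  exact ⟨fun h => h.map (MulEquiv.opOp G).symm.toMonoidHom,
    fun h => h.map (MulEquiv.opOp G).toMonoidHom⟩

theorem isLift_op_iff {l : List B} {β : B → ℝ} {x : G} :
    IsLift M (fun b => MulOpposite.op (σ b)) l.reverse β (MulOpposite.op x) ↔
      IsLift M σ l β x := by
  rw [IsLift, IsLift, rightLift_op_iff, or_comm]
  rfl

variable {W : Type*} [Group W] (cs : CoxeterSystem M W)

variable (σ) in
/-- All positive roots supported in `l` have lifts from both sides. -/
def CoxeterSystem.HasLifts (l : List B) : Prop :=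
  ∀ β, cs.IsPosRoot β → SupportedIn l β →
    (∃ x, LeftLift M σ l β x) ∧ ∃ x, RightLift M σ l β x

theorem CoxeterSystem.HasLifts.op {l : List B} (h : cs.HasLifts σ l) :
    cs.HasLifts (fun b => MulOpposite.op (σ b)) l.reverse := by
  intro β hβ hs
  obtain ⟨⟨x, hx⟩, y, hy⟩ := h β hβ fun b hb => hs b (by simpa using hb)
  exact ⟨⟨_, hy⟩, _, rightLift_op_iff.2 hx⟩

variable {cs}

theorem IsLift.unique (hσ : M.IsBraided σ) {l : List B} (hl : l.Nodup) {β : B → ℝ} {x y : G}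
    (hβ : cs.IsPosRoot β) (hx : IsLift M σ l β x) (hy : IsLift M σ l β y) : x = y := by
  rcases hx with hx | hx <;> rcases hy with hy | hy
  · exact hx.unique hy
  · exact hx.eq_of_rightLift hσ hl hβ hy
  · exact (hy.eq_of_rightLift hσ hl hβ hx).symm
  · exact hx.unique hy

theorem IsLift.rotate (hσ : M.IsBraided σ) {a : B} {l : List B} (hl : (a :: l).Nodup)
    (hT : cs.HasLifts σ l) {β : B → ℝ} {x : G} (hβ : cs.IsPosRoot β)
    (hs : SupportedIn (a :: l) β) (hne : β ≠ simpleRoot a) (h : IsLift M σ (a :: l) β x) :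
    IsLift M σ (l ++ [a]) (M.reflect (simpleRoot a) β) ((σ a)⁻¹ * x * σ a) := by
  have hl' := nodup_append_singleton_iff.2 hl
  have hself := M.form_simpleRoot_self a
  have hβ' := hβ.reflect_simpleRoot hne
  have hne' : M.reflect (simpleRoot a) β ≠ simpleRoot a := by
    intro heq
    rw [← M.reflect_reflect hself β, heq, M.reflect_self hself] at hβ
    exact hβ.not_nonpos (neg_nonpos.2 (cs.isPosRoot_simpleRoot a).1)
  rcases eq_or_ne (β a) 0 with h0 | h0
  · have hs' := hs.of_cons h0
    obtain ⟨⟨y, hy⟩, y', hy'⟩ := hT β hβ hs'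
    obtain rfl := hy.eq_of_rightLift hσ hl.of_cons hβ hy'
    obtain rfl := IsLift.unique hσ hl hβ h (Or.inl (.drop _ _ _ _ h0 hy))
    rcases eq_or_ne (M.reflect (simpleRoot a) β a) 0 with h1 | h1
    · have hf : M.form (simpleRoot a) β = 0 := by
        rw [M.reflect_simpleRoot_apply_self, h0] at h1
        linarith
      have hfix : M.reflect (simpleRoot a) β = β := by simp [M.reflect_apply, hf]
      have hc := hy.commute hσ hβ.1 h0 hf
      have hx : (σ a)⁻¹ * x * σ a = x := by rw [mul_assoc, ← hc.eq, inv_mul_cancel_left]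
      rw [hfix, hx]
      exact Or.inl (LeftLift.insert (l₁ := l) (l₂ := []) (by simpa using hy) h0)
    · refine Or.inr (.refl h1 hne' ?_)
      rw [M.reflect_reflect hself]
      exact RightLift.insert (l₁ := []) hy' h0
  · rcases h with h | h
    · cases h with
      | base => exact absurd rfl hne
      | drop _ _ _ _ h0' _ => exact absurd h0' h0
      | refl _ _ _ x _ _ h =>
        left
        simpa [mul_assoc] using h
    · rcases eq_or_ne (M.reflect (simpleRoot a) β a) 0 with h1 | h1
      · have hs' : SupportedIn l (M.reflect (simpleRoot a) β) := by
          intro b hb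
          rcases eq_or_ne b a with rfl | hba
          · exact h1
          · exact hs.reflect b (by simp [hb, hba])
        obtain ⟨⟨y, hy⟩, -⟩ := hT _ hβ' hs'
        have hy2 : LeftLift M σ (l ++ [a]) (M.reflect (simpleRoot a) β) y :=
          LeftLift.insert (l₁ := l) (l₂ := []) (by simpa using hy) h1
        obtain rfl := (LeftLift.refl a l β y h0 hne hy2).eq_of_rightLift hσ hl hβ h
        left
        simpa [mul_assoc] using hy2
      · refine Or.inr (.refl h1 hne' ?_)
        rwa [M.reflect_reflect hself]

variable (σ) (cs) in
/-- The lifts of reflections whose roots are supported in `l`. -/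
def CoxeterSystem.IsReflLift (l : List B) (r : W) (x : G) : Prop :=
  ∃ β, cs.IsPosRoot β ∧ SupportedIn l β ∧ cs.rep r = M.reflect β ∧ IsLift M σ l β x

theorem CoxeterSystem.IsReflLift.unique (hσ : M.IsBraided σ) {l : List B} (hl : l.Nodup) {r : W}
    {x y : G} (hx : cs.IsReflLift σ l r x) (hy : cs.IsReflLift σ l r y) : x = y := by
  obtain ⟨β, hβ, -, hr, hx⟩ := hx
  obtain ⟨γ, hγ, -, hr', hy⟩ := hy
  obtain rfl := hβ.eq_of_reflect_eq hγ (hr.symm.trans hr')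
  exact hx.unique hσ hl hβ hy

theorem CoxeterSystem.rep_simple_conj (a : B) (r : W) {β : B → ℝ} (h : cs.rep r = M.reflect β) :
    cs.rep (cs.simple a * r * cs.simple a) = M.reflect (M.reflect (simpleRoot a) β) := by
  rw [← cs.rep_simple, ← CoxeterMatrix.rep_reflect_rep_inv (cs := cs), ← h, ← map_mul, ← map_mul,
    cs.inv_simple]

theorem CoxeterSystem.IsReflLift.rotate (hσ : M.IsBraided σ) {a : B} {l : List B}
    (hl : (a :: l).Nodup) (hT : cs.HasLifts σ l) {r : W} {x : G}
    (h : cs.IsReflLift σ (a :: l) r x) :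
    cs.IsReflLift σ (l ++ [a]) (cs.simple a * r * cs.simple a) ((σ a)⁻¹ * x * σ a) := by
  obtain ⟨β, hβ, hs, hr, hx⟩ := h
  rcases eq_or_ne β (simpleRoot a) with rfl | hne
  · obtain rfl := hx.unique hσ hl hβ (Or.inl (.base a l))
    refine ⟨simpleRoot a, hβ, supportedIn_simpleRoot (by simp), ?_, Or.inr ?_⟩
    · rw [CoxeterSystem.rep_simple_conj a r hr, M.reflect_self hβ.form_self, M.reflect_neg]
    · simpa using RightLift.base (M := M) (σ := σ) a l
  · exact ⟨_, hβ.reflect_simpleRoot hne, hs.reflect, CoxeterSystem.rep_simple_conj a r hr,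
      hx.rotate hσ hl hT hβ hs hne⟩

theorem CoxeterSystem.isReflLift_op_iff {l : List B} {r : W} {x : G} :
    cs.IsReflLift (fun b => MulOpposite.op (σ b)) l.reverse r (MulOpposite.op x) ↔
      cs.IsReflLift σ l r x := by
  simp only [CoxeterSystem.IsReflLift, isLift_op_iff, SupportedIn, List.mem_reverse]

theorem CoxeterSystem.IsReflLift.rotate_symm (hσ : M.IsBraided σ) {a : B} {l : List B}
    (hl : (a :: l).Nodup) (hT : cs.HasLifts σ l) {r : W} {x : G}
    (h : cs.IsReflLift σ (l ++ [a]) r x) :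
    cs.IsReflLift σ (a :: l) (cs.simple a * r * cs.simple a) (σ a * x * (σ a)⁻¹) := by
  rw [← CoxeterSystem.isReflLift_op_iff, List.reverse_append] at h
  rw [← CoxeterSystem.isReflLift_op_iff, List.reverse_cons]
  have := CoxeterSystem.IsReflLift.rotate hσ.op (a := a) (l := l.reverse)
    (by simpa using hl) hT.op h
  simpa [mul_assoc] using this

end Rotation

section RootRotation

variable {B : Type*} [Fintype B] [DecidableEq B] {M : CoxeterMatrix B}
  {W : Type*} [Group W] {cs : CoxeterSystem M W}

theorem CoxeterSystem.rotation_induction_aux {Q : List B → (B → ℝ) → Prop} {l₀ : List B}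
    (base : ∀ a l, (a :: l).Perm l₀ → Q (a :: l) (simpleRoot a))
    (step : ∀ a l β, (a :: l).Perm l₀ → cs.IsPosRoot β → β ≠ simpleRoot a →
      Q (l ++ [a]) (M.reflect (simpleRoot a) β) → Q (a :: l) β)
    (u v : List B) (huv : (u ++ v).Perm l₀) {β : B → ℝ} (hβ : cs.IsPosRoot β)
    (h : cs.IsPosRoot (cs.rep (cs.wordProd u)⁻¹ β) →
      Q (v ++ u) (cs.rep (cs.wordProd u)⁻¹ β)) : Q (u ++ v) β := by
  induction u generalizing v β with
  | nil => simpa using h (by simpa using hβ)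
  | cons a u ih =>
    rcases eq_or_ne β (simpleRoot a) with rfl | hne
    · exact base a _ huv
    · have hinv : cs.rep (cs.wordProd u)⁻¹ (M.reflect (simpleRoot a) β) =
          cs.rep (cs.wordProd (a :: u))⁻¹ β := by
        rw [wordProd_cons, mul_inv_rev, cs.inv_simple, cs.rep_mul_apply, cs.rep_simple]
      refine step a (u ++ v) β huv hβ hne ?_
      rw [List.append_assoc]
      refine ih (v ++ [a]) ?_ (hβ.reflect_simpleRoot hne) ?_
      · rw [← List.append_assoc]
        exact (List.perm_append_singleton _ _).trans huv
      · rw [hinv]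
        simpa using h

/-- Induction on the rotations of a word applied to a root, for a root which is eventually made
negative. -/
theorem CoxeterSystem.rotation_induction {Q : List B → (B → ℝ) → Prop} {l₀ : List B}
    (base : ∀ a l, (a :: l).Perm l₀ → Q (a :: l) (simpleRoot a))
    (step : ∀ a l β, (a :: l).Perm l₀ → cs.IsPosRoot β → β ≠ simpleRoot a →
      Q (l ++ [a]) (M.reflect (simpleRoot a) β) → Q (a :: l) β)
    {l : List B} (hl : l.Perm l₀) {β : B → ℝ} (hβ : cs.IsPosRoot β) {n : ℕ}
    (hn : ¬ cs.IsPosRoot (cs.rep ((cs.wordProd l)⁻¹ ^ n) β)) : Q l β := by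
  induction n generalizing β with
  | zero => exact absurd (by simpa using hβ) hn
  | succ n ih =>
    rw [← l.append_nil]
    refine CoxeterSystem.rotation_induction_aux base step l [] (by simpa using hl) hβ fun hβ' => ?_
    refine ih hβ' ?_
    rwa [← cs.rep_mul_apply, ← pow_succ]

theorem CoxeterMatrix.form_eq_sum (x y : B → ℝ) :
    M.form x y = ∑ i, ∑ j, x i * y j * M.form (simpleRoot i) (simpleRoot j) := by
  conv_lhs => rw [eq_sum_smul_simpleRoot x, eq_sum_smul_simpleRoot y]
  simp only [map_sum, map_smul, LinearMap.sum_apply, LinearMap.smul_apply, smul_eq_mul]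
  rw [Finset.sum_comm]
  simp only [Finset.mul_sum]
  exact Finset.sum_congr rfl fun i _ => Finset.sum_congr rfl fun j _ => by ring

theorem CoxeterMatrix.form_simpleRoot_le_one (i j : B) :
    M.form (simpleRoot i) (simpleRoot j) ≤ 1 := by
  rw [M.form_simpleRoot]
  linarith [Real.neg_one_le_cos (Real.pi / M i j)]

theorem CoxeterSystem.IsPosRoot.one_le_sum {β : B → ℝ} (hβ : cs.IsPosRoot β) :
    1 ≤ ∑ b, β b := by
  have h : M.form β β ≤ (∑ b, β b) * ∑ b, β b := by
    rw [M.form_eq_sum, Finset.sum_mul_sum]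
    refine Finset.sum_le_sum fun i _ => Finset.sum_le_sum fun j _ => ?_
    exact mul_le_of_le_one_right (mul_nonneg (hβ.1 i) (hβ.1 j)) (M.form_simpleRoot_le_one i j)
  rw [hβ.form_self] at h
  have h0 : 0 ≤ ∑ b, β b := Finset.sum_nonneg fun b _ => hβ.1 b
  nlinarith

variable (M) in
/-- The canonical form is positive definite on the span of the simple roots in `l`. -/
def CoxeterMatrix.PosDefOn (l : List B) : Prop :=
  ∀ x, SupportedIn l x → x ≠ 0 → 0 < M.form x x

theorem CoxeterMatrix.PosDefOn.mono {l l' : List B} (h : M.PosDefOn l') (hl : l ⊆ l') :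
    M.PosDefOn l := fun x hx => h x (hx.mono hl)

theorem CoxeterMatrix.PosDefOn.nonneg {l : List B} (h : M.PosDefOn l) {x : B → ℝ}
    (hx : SupportedIn l x) : 0 ≤ M.form x x := by
  rcases eq_or_ne x 0 with rfl | h0
  · simp
  · exact (h x hx h0).le

theorem SupportedIn.add {l : List B} {x y : B → ℝ} (hx : SupportedIn l x) (hy : SupportedIn l y) :
    SupportedIn l (x + y) := fun b hb => by simp [hx b hb, hy b hb]

theorem SupportedIn.smul {l : List B} {x : B → ℝ} (t : ℝ) (hx : SupportedIn l x) :
    SupportedIn l (t • x) := fun b hb => by simp [hx b hb]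

theorem SupportedIn.sub {l : List B} {x y : B → ℝ} (hx : SupportedIn l x) (hy : SupportedIn l y) :
    SupportedIn l (x - y) := fun b hb => by simp [hx b hb, hy b hb]

theorem SupportedIn.map_eq_sum {l : List B} {y : B → ℝ} (hy : SupportedIn l y)
    (f : (B → ℝ) →ₗ[ℝ] ℝ) : f y = ∑ b, if b ∈ l then y b * f (simpleRoot b) else 0 := by
  conv_lhs => rw [eq_sum_smul_simpleRoot y]
  rw [map_sum]
  refine Finset.sum_congr rfl fun b _ => ?_
  split_ifs with hb
  · simp
  · simp [hy b hb]

theorem CoxeterMatrix.PosDefOn.exists_form_eq {l : List B} (h : M.PosDefOn l)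
    (f : (B → ℝ) →ₗ[ℝ] ℝ) :
    ∃ x, SupportedIn l x ∧ ∀ y, SupportedIn l y → M.form x y = f y := by
  let T : (B → ℝ) →ₗ[ℝ] (B → ℝ) := LinearMap.pi fun b =>
    if b ∈ l then M.form (simpleRoot b) else LinearMap.proj b
  have hT : ∀ x b, T x b = if b ∈ l then M.form (simpleRoot b) x else x b := by
    intro x b
    simp only [T, LinearMap.pi_apply]
    split_ifs <;> rfl
  have hinj : Function.Injective T := by
    rw [← LinearMap.ker_eq_bot, LinearMap.ker_eq_bot']
    intro x hx
    have hs : SupportedIn l x := fun b hb => by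
      have := congrFun hx b
      rwa [hT, if_neg hb] at this
    by_contra h0
    refine (h x hs h0).ne' ?_
    rw [hs.map_eq_sum]
    refine Finset.sum_eq_zero fun b _ => ?_
    split_ifs with hb
    · have := congrFun hx b
      rw [hT, if_pos hb] at this
      simp [M.form_comm x, this]
    · rfl
  obtain ⟨x, hx⟩ := LinearMap.injective_iff_surjective.1 hinj
    fun b => if b ∈ l then f (simpleRoot b) else 0
  refine ⟨x, fun b hb => ?_, fun y hy => ?_⟩
  · have := congrFun hx b
    simpa only [hT, if_neg hb] using this
  · rw [hy.map_eq_sum, hy.map_eq_sum]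
    refine Finset.sum_congr rfl fun b _ => ?_
    split_ifs with hb
    · have := congrFun hx b
      simp only [hT, if_pos hb] at this
      rw [M.form_comm, this]
    · rfl

theorem abs_form_le {x y : B → ℝ} (hy : M.form y y = 1) (h₁ : 0 ≤ M.form (x + y) (x + y))
    (h₂ : 0 ≤ M.form (x - y) (x - y)) : |2 * M.form x y| ≤ M.form x x + 1 := by
  simp only [map_add, map_sub, LinearMap.add_apply, LinearMap.sub_apply, hy,
    M.form_comm y x] at h₁ h₂
  rw [abs_le]
  constructor <;> linarith

theorem CoxeterSystem.rep_wordProd_inv_pow_supportedIn {l : List B} {x : B → ℝ}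
    (hx : SupportedIn l x) (n : ℕ) : SupportedIn l (cs.rep ((cs.wordProd l)⁻¹ ^ n) x) := by
  induction n with
  | zero => simpa using hx
  | succ n ih =>
    intro b hb
    rw [pow_succ', cs.rep_mul_apply, cs.rep_wordProd_inv_apply_of_notMem hb, ih b hb]

theorem CoxeterMatrix.PosDefOn.exists_not_isPosRoot {l : List B} (hl : l.Nodup)
    (h : M.PosDefOn l) {β : B → ℝ} (hs : SupportedIn l β) :
    ∃ n, ¬ cs.IsPosRoot (cs.rep ((cs.wordProd l)⁻¹ ^ n) β) := by
  by_contra! hpos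
  obtain ⟨x, hx, hxf⟩ := h.exists_form_eq (∑ b, LinearMap.proj b)
  obtain ⟨x', hx', hxf'⟩ := h.exists_form_eq (M.euler l x)
  set γ : ℕ → B → ℝ := fun n => cs.rep ((cs.wordProd l)⁻¹ ^ n) β with hγ
  have hsγ : ∀ n, SupportedIn l (γ n) := CoxeterSystem.rep_wordProd_inv_pow_supportedIn hs
  have hbound : ∀ n, |2 * M.form x' (γ n)| ≤ M.form x' x' + 1 := fun n =>
    abs_form_le (hpos n).form_self (h.nonneg (hx'.add (hsγ n))) (h.nonneg (hx'.sub (hsγ n)))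
  have hdec : ∀ n, M.form x' (γ (n + 1)) ≤ M.form x' (γ n) - 2 := by
    intro n
    have h1 := cs.euler_sub_rep_inv hl x (γ n)
    rw [restrictTo_of_supportedIn hx, hxf _ (hsγ n), ← hxf' _ ((hsγ n).sub _)] at h1
    · rw [map_sub, ← cs.rep_mul_apply, ← pow_succ'] at h1
      have h2 := (hpos n).one_le_sum
      simp only [LinearMap.sum_apply, LinearMap.proj_apply] at h1
      change 1 ≤ ∑ b, γ n b at h2
      linarith
    · rw [← cs.rep_mul_apply, ← pow_succ']
      exact hsγ (n + 1)
  have hdec' : ∀ n : ℕ, M.form x' (γ n) ≤ M.form x' (γ 0) - 2 * n := by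
    intro n
    induction n with
    | zero => simp
    | succ n ih =>
      push_cast
      linarith [hdec n]
  obtain ⟨n, hn⟩ := exists_nat_gt (M.form x' x' + 1)
  have h1 := (abs_le.1 (hbound n)).1
  have h2 := (abs_le.1 (hbound 0)).2
  linarith [hdec' n, hn, h.nonneg hx']

variable {G : Type*} [Group G] {σ : B → G}

theorem LeftLift.exists_of_posDefOn {l : List B} (hl : l.Nodup) (h : M.PosDefOn l)
    {β : B → ℝ} (hβ : cs.IsPosRoot β) (hs : SupportedIn l β) : ∃ x, LeftLift M σ l β x := by
  induction hlen : l.length generalizing l β with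
  | zero =>
    rw [List.length_eq_zero_iff] at hlen
    subst hlen
    exact absurd (funext fun b => hs b (by simp)) hβ.ne_zero
  | succ k ih =>
    obtain ⟨n, hn⟩ := h.exists_not_isPosRoot (cs := cs) hl hs
    refine CoxeterSystem.rotation_induction
      (Q := fun l β => SupportedIn l β → ∃ x, LeftLift M σ l β x) (l₀ := l) ?_ ?_
      (List.Perm.refl l) hβ hn hs
    · intro a l' _ _
      exact ⟨_, .base a l'⟩
    · intro a l' γ hperm hγ hne hQ hsγ
      rcases eq_or_ne (γ a) 0 with h0 | h0
      · have hnd := hperm.nodup_iff.2 hl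
        obtain ⟨x, hx⟩ := ih hnd.of_cons
          (h.mono fun b hb => hperm.subset (List.mem_cons_of_mem _ hb)) hγ (hsγ.of_cons h0)
          (by simpa [hlen] using hperm.length_eq)
        exact ⟨x, .drop _ _ _ _ h0 hx⟩
      · obtain ⟨x, hx⟩ := hQ hsγ.reflect
        exact ⟨_, .refl _ _ _ _ h0 hne hx⟩

theorem CoxeterMatrix.PosDefOn.hasLifts {l : List B} (hl : l.Nodup) (h : M.PosDefOn l) :
    cs.HasLifts σ l := by
  intro β hβ hs
  refine ⟨LeftLift.exists_of_posDefOn hl h hβ hs, ?_⟩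
  obtain ⟨x, hx⟩ := LeftLift.exists_of_posDefOn (σ := fun b => MulOpposite.op (σ b))
    (List.nodup_reverse.2 hl) (h.mono (by simp)) hβ fun b hb => hs b (by simpa using hb)
  exact ⟨x.unop, hx⟩

end RootRotation

section Hurwitz

variable {G : Type*} [Group G]

/-- Two tuples in a group are Hurwitz equivalent if they are related by a sequence of Hurwitz
moves. -/
def HurwitzEquiv : List G → List G → Prop :=
  Relation.EqvGen fun f g => ∃ u a b v, f = u ++ a :: b :: v ∧ g = u ++ a * b * a⁻¹ :: a :: v

namespace HurwitzEquiv

theorem refl (f : List G) : HurwitzEquiv f f := Relation.EqvGen.refl f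

theorem symm {f g : List G} (h : HurwitzEquiv f g) : HurwitzEquiv g f := Relation.EqvGen.symm _ _ h

theorem trans {f g h : List G} (h₁ : HurwitzEquiv f g) (h₂ : HurwitzEquiv g h) :
    HurwitzEquiv f h := Relation.EqvGen.trans _ _ _ h₁ h₂

theorem swap (u : List G) (a b : G) (v : List G) :
    HurwitzEquiv (u ++ a :: b :: v) (u ++ a * b * a⁻¹ :: a :: v) :=
  Relation.EqvGen.rel _ _ ⟨u, a, b, v, rfl, rfl⟩

/-- An induction principle for properties that are preserved by Hurwitz moves both ways. -/
theorem iff_of_swap {p : List G → Prop}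
    (hp : ∀ u a b v, p (u ++ a :: b :: v) ↔ p (u ++ a * b * a⁻¹ :: a :: v))
    {f g : List G} (h : HurwitzEquiv f g) : p f ↔ p g := by
  induction h with
  | rel f g h =>
    obtain ⟨u, a, b, v, rfl, rfl⟩ := h
    exact hp u a b v
  | refl => rfl
  | symm _ _ _ ih => exact ih.symm
  | trans _ _ _ _ _ ih₁ ih₂ => exact ih₁.trans ih₂

theorem of_swap {H : Type*} [Group H] {F : List G → List H}
    (hF : ∀ u a b v, HurwitzEquiv (F (u ++ a :: b :: v)) (F (u ++ a * b * a⁻¹ :: a :: v)))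
    {f g : List G} (h : HurwitzEquiv f g) : HurwitzEquiv (F f) (F g) := by
  induction h with
  | rel f g h =>
    obtain ⟨u, a, b, v, rfl, rfl⟩ := h
    exact hF u a b v
  | refl => exact refl _
  | symm _ _ _ ih => exact ih.symm
  | trans _ _ _ _ _ ih₁ ih₂ => exact ih₁.trans ih₂

theorem prod_eq {f g : List G} (h : HurwitzEquiv f g) : f.prod = g.prod :=
  ((h.symm.iff_of_swap (p := fun x => x.prod = g.prod)) fun u a b v => by simp [mul_assoc]).1 rfl

theorem append_left (u : List G) {f g : List G} (h : HurwitzEquiv f g) :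
    HurwitzEquiv (u ++ f) (u ++ g) :=
  h.of_swap fun u' a b v => by simpa using swap (u ++ u') a b v

theorem cons (a : G) {f g : List G} (h : HurwitzEquiv f g) :
    HurwitzEquiv (a :: f) (a :: g) := h.append_left [a]

theorem map {H : Type*} [Group H] (φ : G →* H) {f g : List G} (h : HurwitzEquiv f g) :
    HurwitzEquiv (f.map φ) (g.map φ) :=
  h.of_swap fun u a b v => by simpa using swap (u.map φ) (φ a) (φ b) (v.map φ)

theorem cons_append_map_conj (a : G) (f : List G) :
    HurwitzEquiv (a :: f) (f.map (fun x => a * x * a⁻¹) ++ [a]) := by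
  induction f with
  | nil => exact refl _
  | cons b f ih => exact (swap [] a b f).trans (ih.cons _)

theorem map_conj (a : G) {f g : List G} (h : HurwitzEquiv f g) :
    HurwitzEquiv (f.map fun x => a * x * a⁻¹) (g.map fun x => a * x * a⁻¹) :=
   h.map (MulAut.conj a).toMonoidHom

theorem conj_prod_cons (a : G) (f : List G) :
    HurwitzEquiv ((f.prod * a * f.prod⁻¹) :: f) (f ++ [a]) := by
  induction f with
  | nil => simpa using refl _
  | cons b f ih =>
    have h := (swap [] b (f.prod * a * f.prod⁻¹) f).symm.trans (ih.cons b)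
    simpa [mul_assoc] using h

end HurwitzEquiv

end Hurwitz

section HurwitzLift

variable {B : Type*} [Fintype B] [DecidableEq B] {M : CoxeterMatrix B}
  {W : Type*} [Group W] {cs : CoxeterSystem M W} {G : Type*} [Group G] {σ : B → G}

variable (cs σ) in
/-- The elements of `f` have lifts which form a tuple Hurwitz equivalent to the tuple of
generators indexed by `l`. -/
def CoxeterSystem.HasHurwitzLift (l : List B) (f : List W) : Prop :=
  ∃ xs, List.Forall₂ (cs.IsReflLift σ l) f xs ∧ HurwitzEquiv xs (l.map σ)

variable (cs) in
/-- The element `r` acts as the reflection in some positive root. -/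
def CoxeterSystem.IsRootReflection (r : W) : Prop :=
  ∃ β, cs.IsPosRoot β ∧ cs.rep r = M.reflect β

theorem CoxeterSystem.IsRootReflection.conj {r : W} (h : cs.IsRootReflection r) (g : W) :
    cs.IsRootReflection (g * r * g⁻¹) := by
  obtain ⟨β, hβ, hr⟩ := h
  have : cs.rep (g * r * g⁻¹) = M.reflect (cs.rep g β) := by
    rw [map_mul, map_mul, hr, CoxeterMatrix.rep_reflect_rep_inv]
  rcases hβ.rep_pos_or_neg g with h | h
  · exact ⟨_, h, this⟩
  · exact ⟨_, h, by rw [this, M.reflect_neg]⟩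

theorem CoxeterSystem.HasHurwitzLift.of_rotate (hσ : M.IsBraided σ) {a : B} {l : List B}
    (hl : (a :: l).Nodup) (hT : cs.HasLifts σ l) {f : List W}
    (h : cs.HasHurwitzLift σ (l ++ [a]) (f.map fun x => cs.simple a * x * cs.simple a)) :
    cs.HasHurwitzLift σ (a :: l) f := by
  obtain ⟨xs, hf, hx⟩ := h
  refine ⟨xs.map fun x => σ a * x * (σ a)⁻¹, ?_, ?_⟩
  · rw [List.forall₂_map_left_iff] at hf
    rw [List.forall₂_map_right_iff]
    refine hf.imp fun r x hrx => ?_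
    simpa [mul_assoc] using CoxeterSystem.IsReflLift.rotate_symm hσ hl hT hrx
  · refine (hx.map_conj (σ a)).trans ?_
    simpa using (HurwitzEquiv.cons_append_map_conj (σ a) (l.map σ)).symm

theorem CoxeterSystem.IsReflLift.cons {a : B} {l : List B} (ha : a ∉ l) {r : W} {x : G}
    (h : cs.IsReflLift σ l r x) : cs.IsReflLift σ (a :: l) r x := by
  obtain ⟨β, hβ, hs, hr, hx⟩ := h
  refine ⟨β, hβ, hs.mono (List.subset_cons_self a l), hr, ?_⟩
  rcases hx with hx | hx
  · exact Or.inl (.drop _ _ _ _ (hs a ha) hx)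
  · exact Or.inr (RightLift.insert (l₁ := []) hx (hs a ha))

theorem CoxeterSystem.isReflLift_simple (a : B) (l : List B) :
    cs.IsReflLift σ (a :: l) (cs.simple a) (σ a) :=
  ⟨_, cs.isPosRoot_simpleRoot a, supportedIn_simpleRoot (by simp), cs.rep_simple a,
    Or.inl (.base a l)⟩

theorem CoxeterSystem.HasHurwitzLift.cons {a : B} {l : List B} (ha : a ∉ l) {f : List W}
    (h : cs.HasHurwitzLift σ l f) : cs.HasHurwitzLift σ (a :: l) (cs.simple a :: f) := by
  obtain ⟨xs, hf, hx⟩ := h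
  exact ⟨σ a :: xs, .cons (CoxeterSystem.isReflLift_simple a l) (hf.imp fun _ _ h => h.cons ha),
    hx.cons (σ a)⟩

theorem CoxeterSystem.rep_prod_sub_mem_span {f : List W} {bs : List (B → ℝ)}
    (h : List.Forall₂ (fun r β => cs.rep r = M.reflect β) f bs) (x : B → ℝ) :
    x - cs.rep f.prod x ∈ Submodule.span ℝ {β | β ∈ bs} := by
  induction h with
  | nil => simp
  | @cons r β f bs hr _ ih =>
    have h2 : x - cs.rep (r :: f).prod x = (x - cs.rep f.prod x) +
        (2 * M.form β (cs.rep f.prod x)) • β := by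
      rw [List.prod_cons, cs.rep_mul_apply, hr, M.reflect_apply]
      module
    rw [h2]
    refine add_mem (Submodule.span_mono (fun γ hγ => ?_) ih)
      (Submodule.smul_mem _ _ (Submodule.subset_span ?_))
    · exact List.mem_cons_of_mem _ hγ
    · exact List.mem_cons_self

theorem finrank_span_list_le (bs : List (B → ℝ)) :
    Module.finrank ℝ (Submodule.span ℝ {β | β ∈ bs}) ≤ bs.length := by
  classical
  have : {β | β ∈ bs} = (bs.toFinset : Set (B → ℝ)) := by
    ext
    simp
  rw [this]
  exact (finrank_span_finset_le_card _).trans bs.toFinset_card_le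

theorem CoxeterMatrix.PosDefOn.exists_sub_rep_eq {l : List B} (hl : l.Nodup) (h : M.PosDefOn l)
    {b : B} (hb : b ∈ l) : ∃ x, x - cs.rep (cs.wordProd l) x = simpleRoot b := by
  let T : (B → ℝ) →ₗ[ℝ] (B → ℝ) := LinearMap.pi fun b =>
    if b ∈ l then LinearMap.proj b ∘ₗ (LinearMap.id - cs.rep (cs.wordProd l))
      else LinearMap.proj b
  have hT : ∀ x b, T x b = if b ∈ l then x b - cs.rep (cs.wordProd l) x b else x b := by
    intro x b
    simp only [T, LinearMap.pi_apply]
    split_ifs <;> rfl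
  have hinj : Function.Injective T := by
    rw [← LinearMap.ker_eq_bot, LinearMap.ker_eq_bot']
    intro x hx
    have hs : SupportedIn l x := fun b hb => by
      have := congrFun hx b
      rwa [hT, if_neg hb] at this
    have hfix : cs.rep (cs.wordProd l) x = x := by
      ext b
      by_cases hb : b ∈ l
      · have := congrFun hx b
        rw [hT, if_pos hb] at this
        exact (sub_eq_zero.1 this).symm
      · exact cs.rep_wordProd_apply_of_notMem hb x
    by_contra h0
    have h1 := cs.euler_sub_rep_inv hl x x
    rw [restrictTo_of_supportedIn hs] at h1
    nth_rewrite 3 [← hfix] at h1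
    rw [cs.rep_inv_rep, sub_self, map_zero] at h1
    linarith [h x hs h0]
  obtain ⟨x, hx⟩ := LinearMap.injective_iff_surjective.1 hinj (simpleRoot b)
  refine ⟨x, funext fun c => ?_⟩
  by_cases hc : c ∈ l
  · rw [← hx, hT, if_pos hc]
    rfl
  · rw [supportedIn_simpleRoot hb c hc]
    rw [Pi.sub_apply, cs.rep_wordProd_apply_of_notMem hc, sub_self]

theorem linearIndependent_simpleRoot :
    LinearIndependent ℝ (simpleRoot : B → B → ℝ) := by
  have : (simpleRoot : B → B → ℝ) = Pi.basisFun ℝ B := by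
    ext1 b
    simp [simpleRoot]
  rw [this]
  exact (Pi.basisFun ℝ B).linearIndependent

theorem CoxeterMatrix.PosDefOn.supportedIn_of_prod_eq {l : List B} (hl : l.Nodup)
    (h : M.PosDefOn l) {f : List W} {bs : List (B → ℝ)}
    (hf : List.Forall₂ (fun r β => cs.rep r = M.reflect β) f bs) (hlen : f.length = l.length)
    (hprod : f.prod = cs.wordProd l) {β : B → ℝ} (hβ : β ∈ bs) : SupportedIn l β := by
  set U := Submodule.span ℝ (Set.range fun i : Fin l.length => (simpleRoot (l.get i) : B → ℝ))
    with hU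
  have hle : U ≤ Submodule.span ℝ {β | β ∈ bs} := by
    rw [hU, Submodule.span_le]
    rintro _ ⟨i, rfl⟩
    obtain ⟨x, hx⟩ := h.exists_sub_rep_eq (cs := cs) hl (List.get_mem l i)
    have := CoxeterSystem.rep_prod_sub_mem_span hf x
    rwa [hprod, hx] at this
  have hfin : Module.finrank ℝ U = l.length := by
    rw [hU, finrank_span_eq_card, Fintype.card_fin]
    exact linearIndependent_simpleRoot.comp _ (List.nodup_iff_injective_get.1 hl)
  have heq := Submodule.eq_of_le_of_finrank_le hle
    (by rw [hfin, ← hlen, hf.length_eq]; exact finrank_span_list_le bs)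
  have hmem : β ∈ U := by
    rw [heq]
    exact Submodule.subset_span hβ
  rw [hU] at hmem
  clear hle hfin heq hβ
  induction hmem using Submodule.span_induction with
  | mem x hx =>
    obtain ⟨i, rfl⟩ := hx
    exact supportedIn_simpleRoot (List.get_mem l i)
  | zero => exact fun _ _ => rfl
  | add x y _ _ hx hy => exact hx.add hy
  | smul t x _ hx => exact hx.smul t

theorem CoxeterSystem.exists_forall₂_isPosRoot {f : List W} (h : ∀ r ∈ f, cs.IsRootReflection r) :
    ∃ bs, List.Forall₂ (fun r β => cs.IsPosRoot β ∧ cs.rep r = M.reflect β) f bs := by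
  induction f with
  | nil => exact ⟨[], .nil⟩
  | cons r f ih =>
    obtain ⟨bs, hbs⟩ := ih fun r hr => h r (List.mem_cons_of_mem _ hr)
    obtain ⟨β, hβ⟩ := h r List.mem_cons_self
    exact ⟨β :: bs, .cons hβ hbs⟩

theorem prod_map_simple_conj (a : B) (f : List W) :
    (f.map fun x => cs.simple a * x * cs.simple a).prod = cs.simple a * f.prod * cs.simple a := by
  induction f with
  | nil => simp
  | cons r f ih =>
    rw [List.map_cons, List.prod_cons, ih, List.prod_cons]
    simp [mul_assoc]

/-- One step of the rotation of a factorization whose first reflection has a given root. -/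
theorem CoxeterSystem.hasHurwitzLift_of_rotate (hσ : M.IsBraided σ) {a : B} {l : List B}
    (hl : (a :: l).Nodup) (hT : cs.HasLifts σ l) {β : B → ℝ}
    (h : ∀ r f, cs.rep r = M.reflect (M.reflect (simpleRoot a) β) →
      (∀ x ∈ f, cs.IsRootReflection x) → f.length = l.length →
      r * f.prod = cs.wordProd (l ++ [a]) → cs.HasHurwitzLift σ (l ++ [a]) (r :: f))
    {r : W} {f : List W} (hr : cs.rep r = M.reflect β) (hf : ∀ x ∈ f, cs.IsRootReflection x)
    (hlen : f.length = l.length) (hprod : r * f.prod = cs.wordProd (a :: l)) :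
    cs.HasHurwitzLift σ (a :: l) (r :: f) := by
  refine .of_rotate hσ hl hT ?_
  refine h _ _ (CoxeterSystem.rep_simple_conj a r hr) ?_ (by simpa using hlen) ?_
  · intro x hx
    obtain ⟨y, hy, rfl⟩ := List.mem_map.1 hx
    simpa using (hf y hy).conj (cs.simple a)
  · rw [prod_map_simple_conj, wordProd_append, wordProd_singleton]
    rw [wordProd_cons] at hprod
    have h2 : cs.simple a * (r * f.prod) = cs.wordProd l := by rw [hprod]; simp
    rw [← h2]
    simp [mul_assoc]

theorem CoxeterMatrix.PosDefOn.hasHurwitzLift (hσ : M.IsBraided σ) {l : List B} (hl : l.Nodup)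
    (h : M.PosDefOn l) {f : List W} (hf : ∀ r ∈ f, cs.IsRootReflection r)
    (hlen : f.length = l.length) (hprod : f.prod = cs.wordProd l) :
    cs.HasHurwitzLift σ l f := by
  induction hk : l.length generalizing l f with
  | zero =>
    rw [List.length_eq_zero_iff] at hk
    subst hk
    rw [List.length_nil, List.length_eq_zero_iff] at hlen
    subst hlen
    exact ⟨[], .nil, .refl _⟩
  | succ k ih =>
    obtain ⟨r, f, rfl⟩ := List.exists_cons_of_length_eq_add_one (hlen.trans hk)
    obtain ⟨bs, hbs⟩ := CoxeterSystem.exists_forall₂_isPosRoot hf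
    obtain ⟨β, bs, ⟨hβ, hr⟩, hbs', rfl⟩ := List.forall₂_cons_left_iff.1 hbs
    have hs := h.supportedIn_of_prod_eq hl (hbs.imp fun _ _ h => h.2) hlen hprod
      List.mem_cons_self
    obtain ⟨n, hn⟩ := h.exists_not_isPosRoot (cs := cs) hl hs
    refine CoxeterSystem.rotation_induction (cs := cs) (l₀ := l)
      (Q := fun l β => ∀ r f, cs.rep r = M.reflect β → (∀ x ∈ f, cs.IsRootReflection x) →
        f.length + 1 = l.length → r * f.prod = cs.wordProd l → cs.HasHurwitzLift σ l (r :: f))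
      ?_ ?_ (List.Perm.refl l) hβ hn r f hr (fun x hx => hf x (List.mem_cons_of_mem _ hx))
      (by simpa using hlen) (by simpa using hprod)
    · intro a l' hperm r f hr hf hlen hprod
      have hnd := hperm.nodup_iff.2 hl
      rw [← cs.rep_simple] at hr
      obtain rfl := cs.rep_injective hr
      refine .cons (List.nodup_cons.1 hnd).1 (ih hnd.of_cons (h.mono fun b hb =>
        hperm.subset (List.mem_cons_of_mem _ hb)) hf (by simpa using hlen) ?_ ?_)
      · simpa [wordProd_cons] using hprod
      · simpa [hk] using hperm.length_eq
    · intro a l' γ hperm hγ hne hQ r f hr hf hlen hprod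
      have hnd := hperm.nodup_iff.2 hl
      refine CoxeterSystem.hasHurwitzLift_of_rotate hσ hnd
        (CoxeterMatrix.PosDefOn.hasLifts hnd.of_cons (h.mono fun b hb =>
          hperm.subset (List.mem_cons_of_mem _ hb))) (fun r f hr hf hlen hprod => ?_) hr hf
        (by simpa using hlen) hprod
      exact hQ r f hr hf (by simpa using hlen) hprod

end HurwitzLift

theorem HurwitzEquiv.map_conj_prod_append {G : Type*} [Group G] (u v : List G) :
    HurwitzEquiv (v ++ u) ((u.map fun x => (v ++ u).prod * x * (v ++ u).prod⁻¹) ++ v) := by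
  induction u using List.reverseRecOn generalizing v with
  | nil => simpa using HurwitzEquiv.refl v
  | append_singleton u a ih =>
    have h := (HurwitzEquiv.conj_prod_cons a (v ++ u)).symm
    rw [List.append_assoc] at h
    have h2 := h.trans (ih (((v ++ u).prod * a * (v ++ u).prod⁻¹) :: v))
    rw [List.cons_append, ← h.prod_eq] at h2
    simpa [mul_assoc] using h2

theorem HurwitzEquiv.map_conj_prod {G : Type*} [Group G] (f : List G) :
    HurwitzEquiv f (f.map fun x => f.prod * x * f.prod⁻¹) := by
  simpa using HurwitzEquiv.map_conj_prod_append f []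

section Affine

variable {B : Type*} [Fintype B] [DecidableEq B] {M : CoxeterMatrix B}
  {W : Type*} [Group W] {cs : CoxeterSystem M W}

/-- The canonical form is positive semidefinite with radical spanned by a vector `δ` with positive
coordinates. -/
structure CoxeterMatrix.IsAffine (M : CoxeterMatrix B) (δ : B → ℝ) : Prop where
  pos : ∀ b, 0 < δ b
  form_left : ∀ x, M.form δ x = 0
  nonneg : ∀ x, 0 ≤ M.form x x
  exists_eq_smul : ∀ x, M.form x x = 0 → ∃ t : ℝ, x = t • δ

theorem supportedIn_of_forall_mem {l : List B} (h : ∀ b, b ∈ l) (x : B → ℝ) : SupportedIn l x :=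
  fun b hb => absurd (h b) hb

theorem CoxeterMatrix.exists_euler_eq {l : List B} (hl : l.Nodup) (f : (B → ℝ) →ₗ[ℝ] ℝ) :
    ∃ p, ∀ y, M.euler l p y = f (restrictTo l y) := by
  induction l with
  | nil => exact ⟨0, fun y => by simp [restrictTo_nil]⟩
  | cons a l ih =>
    have ha := (List.nodup_cons.1 hl).1
    obtain ⟨p, hp⟩ := ih hl.of_cons
    set q := Function.update p a
      (f (simpleRoot a) - 2 * M.form (simpleRoot a) (restrictTo l p)) with hq
    have hqp : ∀ b ∈ l, q b = p b := fun b hb =>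
      Function.update_of_ne (fun h : b = a => ha (h ▸ hb)) _ _
    refine ⟨q, fun y => ?_⟩
    rw [M.euler_cons, M.euler_congr hqp fun _ _ => rfl, hp, restrictTo_cons ha,
      restrictTo_congr hqp, hq, Function.update_self, map_add, map_smul, smul_eq_mul]
    ring

namespace CoxeterMatrix.IsAffine

variable {δ : B → ℝ} (hM : M.IsAffine δ)
include hM

theorem posDefOn {l : List B} {b : B} (hb : b ∉ l) : M.PosDefOn l := by
  intro x hx h0
  refine (hM.nonneg x).lt_of_ne fun h => h0 ?_
  obtain ⟨t, rfl⟩ := hM.exists_eq_smul x h.symm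
  have := hx b hb
  rw [Pi.smul_apply, smul_eq_mul, mul_eq_zero] at this
  rw [this.resolve_right (hM.pos b).ne', zero_smul]

theorem form_right (x : B → ℝ) : M.form x δ = 0 := by
  rw [M.form_comm, hM.form_left]

theorem exists_form_eq (f : (B → ℝ) →ₗ[ℝ] ℝ) (hf : f δ = 0) : ∃ x, ∀ y, M.form x y = f y := by
  classical
  rcases isEmpty_or_nonempty B with hB | ⟨⟨b⟩⟩
  · exact ⟨0, fun y => by simp [Subsingleton.elim y 0]⟩
  have hb : b ∉ (Finset.univ.erase b).toList := by simp
  obtain ⟨x, -, hx⟩ := (hM.posDefOn hb).exists_form_eq f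
  refine ⟨x, fun y => ?_⟩
  have h := hx (y - (y b / δ b) • δ) fun c hc => by
    obtain rfl : c = b := by simpa using hc
    simp [div_mul_cancel₀ _ (hM.pos c).ne']
  simpa [hM.form_right, hf] using h

variable {l : List B} (hl : l.Nodup) (hc : ∀ b, b ∈ l)
include hl hc

omit hM in
theorem euler_sub_rep_inv (x y : B → ℝ) :
    M.euler l x (y - cs.rep (cs.wordProd l)⁻¹ y) = 2 * M.form x y := by
  rw [cs.euler_sub_rep_inv hl, restrictTo_of_supportedIn (supportedIn_of_forall_mem hc x)]

theorem euler_right (x : B → ℝ) : M.euler l x δ = -M.euler l δ x := by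
  have := M.euler_add_euler hl x δ
  rw [restrictTo_of_supportedIn (supportedIn_of_forall_mem hc x),
    restrictTo_of_supportedIn (supportedIn_of_forall_mem hc δ), hM.form_right] at this
  linarith

theorem euler_rep_inv (x : B → ℝ) :
    M.euler l δ (cs.rep (cs.wordProd l)⁻¹ x) = M.euler l δ x := by
  have := euler_sub_rep_inv (M := M) (cs := cs) hl hc δ x
  rw [hM.form_left, map_sub] at this
  linarith

theorem exists_sum_eq_euler [Nonempty B] : ∃ p, (∀ y, M.euler l p y = ∑ b, y b) ∧
    M.euler l δ p ≠ 0 := by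
  obtain ⟨p, hp⟩ := M.exists_euler_eq hl (∑ b, LinearMap.proj b)
  have hp' : ∀ y, M.euler l p y = ∑ b, y b := fun y => by
    rw [hp, restrictTo_of_supportedIn (supportedIn_of_forall_mem hc y)]
    simp
  refine ⟨p, hp', fun h => ?_⟩
  have h1 := hM.euler_right hl hc p
  rw [h, hp'] at h1
  have h2 : 0 < ∑ b, δ b := Finset.sum_pos (fun b _ => hM.pos b) Finset.univ_nonempty
  linarith

omit hl hc in
theorem exists_form_eq_comp_rep_prod_sub (d f₀ : (B → ℝ) →ₗ[ℝ] ℝ) {f : List W}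
    {bs : List (B → ℝ)} (hf : List.Forall₂ (fun r β => cs.rep r = M.reflect β) f bs)
    (hd : ∀ β ∈ bs, d β = 0) :
    ∃ y, d y = 0 ∧ ∀ x, f₀ (cs.rep f.prod x) - f₀ x = M.form y x := by
  induction hf with
  | nil => exact ⟨0, by simp, by simp⟩
  | @cons r β f bs hr hf ih =>
    obtain ⟨y, hy, hyx⟩ := ih fun β hβ => hd β (List.mem_cons_of_mem _ hβ)
    have hβ := hd β List.mem_cons_self
    have h1 : d (cs.rep f.prod⁻¹ β) = 0 := by
      have h2 := CoxeterSystem.rep_prod_sub_mem_span hf (cs.rep f.prod⁻¹ β)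
      have h3 : Submodule.span ℝ {β | β ∈ bs} ≤ LinearMap.ker d :=
        Submodule.span_le.2 fun γ hγ => hd γ (List.mem_cons_of_mem _ hγ)
      have h4 := h3 h2
      rw [cs.rep_rep_inv, LinearMap.mem_ker, map_sub, hβ, sub_zero] at h4
      exact h4
    refine ⟨y - (2 * f₀ β) • cs.rep f.prod⁻¹ β, by simp [hy, h1], fun x => ?_⟩
    rw [List.prod_cons, cs.rep_mul_apply, hr, M.reflect_apply, map_sub, map_sub, map_smul, map_smul,
      LinearMap.sub_apply, LinearMap.smul_apply, ← hyx,
      ← cs.form_rep f.prod (cs.rep f.prod⁻¹ β) x, cs.rep_rep_inv]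
    simp only [smul_eq_mul]
    ring

/-- The radical of the canonical form pairs nontrivially with some root of a reflection
factorization of a Coxeter element. -/
theorem exists_euler_ne_zero [Nonempty B] {f : List W} {bs : List (B → ℝ)}
    (hf : List.Forall₂ (fun r β => cs.rep r = M.reflect β) f bs)
    (hprod : f.prod = cs.wordProd l) : ∃ β ∈ bs, M.euler l δ β ≠ 0 := by
  by_contra! hd
  obtain ⟨p, -, hp⟩ := hM.exists_sum_eq_euler hl hc
  obtain ⟨y, hy, hyx⟩ :=
    hM.exists_form_eq_comp_rep_prod_sub (M.euler l δ) (M.euler l p) hf hd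
  set z := (2 : ℝ) • cs.rep (cs.wordProd l)⁻¹ p - y with hz
  have h1 : M.form z z = 0 := by
    have h2 := hyx z
    have h3 := euler_sub_rep_inv (M := M) (cs := cs) hl hc p (cs.rep (cs.wordProd l) z)
    rw [cs.rep_inv_rep, map_sub] at h3
    rw [hprod, h3, ← cs.form_rep (cs.wordProd l)⁻¹, cs.rep_inv_rep] at h2
    have h6 : ∀ u, M.form z u = 2 * M.form (cs.rep (cs.wordProd l)⁻¹ p) u - M.form y u :=
      fun u => by simp [hz]
    rw [h6, h2, sub_self]
  obtain ⟨t, ht⟩ := hM.exists_eq_smul z h1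
  have h4 : M.euler l δ δ = 0 := by
    have := hM.euler_right hl hc δ
    linarith
  have h5 : M.euler l δ z = 2 * M.euler l δ p := by
    rw [hz, map_sub, hy, map_smul, hM.euler_rep_inv hl hc]
    simp
  rw [ht, map_smul, h4, smul_zero] at h5
  exact hp (by linarith)

/-- A positive root pairing nontrivially with the radical is eventually made negative by the powers
of a Coxeter element, in at least one direction. -/
theorem exists_not_isPosRoot {β : B → ℝ} (hd : M.euler l δ β ≠ 0) :
    ∃ n, ¬ cs.IsPosRoot (cs.rep ((cs.wordProd l)⁻¹ ^ n) β) ∨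
      ¬ cs.IsPosRoot (cs.rep (cs.wordProd l ^ n) β) := by
  by_contra! hpos
  have hB : Nonempty B := by
    by_contra hB
    rw [not_nonempty_iff] at hB
    exact hd (by simp [Subsingleton.elim β 0])
  obtain ⟨p, hp, hdp⟩ := hM.exists_sum_eq_euler hl hc
  have hδ : M.euler l δ δ = 0 := by
    have := hM.euler_right hl hc δ
    linarith
  obtain ⟨a, ha⟩ := hM.exists_form_eq (M.euler l δ) hδ
  have hda : M.euler l δ a ≠ 0 := by
    rw [← ha]
    intro h
    obtain ⟨t, rfl⟩ := hM.exists_eq_smul a h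
    rw [← ha, map_smul, LinearMap.smul_apply, hM.form_left, smul_zero] at hd
    exact hd rfl
  set κ := M.euler l δ p / M.euler l δ a with hκ
  have hκ0 : κ ≠ 0 := div_ne_zero hdp hda
  set e := p - κ • a with he
  have hde : M.euler l e δ = 0 := by
    rw [hM.euler_right hl hc, he, map_sub, map_smul, hκ, smul_eq_mul, div_mul_cancel₀ _ hda,
      sub_self, neg_zero]
  obtain ⟨e', he'⟩ := hM.exists_form_eq (M.euler l e) hde
  set F : (B → ℝ) → ℝ := fun y => ∑ b, y b - M.form e' y with hF
  have hstep : ∀ y, F (cs.rep (cs.wordProd l)⁻¹ y) = F y - 2 * κ * M.euler l δ y := by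
    intro y
    have h1 := euler_sub_rep_inv (M := M) (cs := cs) hl hc p y
    have h2 := euler_sub_rep_inv (M := M) (cs := cs) hl hc e y
    rw [map_sub, hp, hp] at h1
    rw [map_sub, ← he', ← he', he, map_sub, LinearMap.sub_apply, map_smul, LinearMap.smul_apply, ha,
      smul_eq_mul] at h2
    simp only [hF]
    linarith
  have hinv : ∀ n y, M.euler l δ (cs.rep ((cs.wordProd l)⁻¹ ^ n) y) = M.euler l δ y := by
    intro n y
    induction n with
    | zero => simp
    | succ n ih => rw [pow_succ', cs.rep_mul_apply, hM.euler_rep_inv hl hc, ih]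
  have hpow : ∀ (n : ℕ) y, F (cs.rep ((cs.wordProd l)⁻¹ ^ n) y) =
      F y - n * (2 * κ * M.euler l δ y) := by
    intro n y
    induction n with
    | zero => simp
    | succ n ih =>
      rw [pow_succ', cs.rep_mul_apply, hstep, ih, hinv]
      push_cast
      ring
  have hpow' : ∀ (n : ℕ) y, F (cs.rep (cs.wordProd l ^ n) y) =
      F y + n * (2 * κ * M.euler l δ y) := by
    intro n y
    have h1 := hpow n (cs.rep (cs.wordProd l ^ n) y)
    have h2 := hinv n (cs.rep (cs.wordProd l ^ n) y)
    rw [inv_pow, cs.rep_inv_rep] at h1 h2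
    rw [← h2] at h1
    linarith
  have hlow : ∀ γ, cs.IsPosRoot γ → -(M.form e' e' + 1) ≤ 2 * F γ := by
    intro γ hγ
    have h1 := (abs_le.1 (abs_form_le hγ.form_self (hM.nonneg (e' + γ))
      (hM.nonneg (e' - γ)))).2
    have h2 : 0 ≤ ∑ b, γ b := Finset.sum_nonneg fun b _ => hγ.1 b
    simp only [hF]
    linarith
  have hne : |2 * (2 * κ * M.euler l δ β)| ≠ 0 := by
    rw [abs_ne_zero]
    positivity
  obtain ⟨n, hn⟩ := exists_nat_gt
    ((M.form e' e' + 1 + 2 * F β) / |2 * (2 * κ * M.euler l δ β)|)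
  rw [div_lt_iff₀ (lt_of_le_of_ne (abs_nonneg _) hne.symm)] at hn
  have h1 := hlow _ (hpos n).1
  have h2 := hlow _ (hpos n).2
  rw [hpow] at h1
  rw [hpow'] at h2
  rcases abs_choice (2 * (2 * κ * M.euler l δ β)) with h | h <;> rw [h] at hn <;> linarith

end CoxeterMatrix.IsAffine

end Affine

section AffineFactorizations

variable {B : Type*} [Fintype B] [DecidableEq B] {M : CoxeterMatrix B}
  {W : Type*} [Group W] {cs : CoxeterSystem M W} {G : Type*} [Group G] {σ : B → G}

namespace CoxeterMatrix.IsAffine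

variable {δ : B → ℝ} (hM : M.IsAffine δ) (hσ : M.IsBraided σ)
include hM hσ

theorem isReflLift_append_conj (u v : List B) (hl : (u ++ v).Nodup) {r : W} {x : G}
    (h : cs.IsReflLift σ (v ++ u) r x) :
    cs.IsReflLift σ (u ++ v) (cs.wordProd u * r * (cs.wordProd u)⁻¹)
      ((u.map σ).prod * x * (u.map σ).prod⁻¹) := by
  induction u generalizing v with
  | nil => simpa using h
  | cons a u ih =>
    rw [List.cons_append] at hl
    have hl' : ((u ++ v) ++ [a]).Nodup := nodup_append_singleton_iff.2 hl
    have h1 := ih (v ++ [a]) (by simpa using hl') (by simpa using h)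
    rw [← List.append_assoc] at h1
    have h2 := h1.rotate_symm hσ hl
      (CoxeterMatrix.PosDefOn.hasLifts hl.of_cons (hM.posDefOn (List.nodup_cons.1 hl).1))
    simpa [wordProd_cons, mul_assoc] using h2

theorem isReflLift_append_inv_conj (u v : List B) (hl : (u ++ v).Nodup) {r : W} {x : G}
    (h : cs.IsReflLift σ (u ++ v) r x) :
    cs.IsReflLift σ (v ++ u) ((cs.wordProd u)⁻¹ * r * cs.wordProd u)
      ((u.map σ).prod⁻¹ * x * (u.map σ).prod) := by
  induction u generalizing v r x with
  | nil => simpa using h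
  | cons a u ih =>
    rw [List.cons_append] at hl h
    have hl' : ((u ++ v) ++ [a]).Nodup := nodup_append_singleton_iff.2 hl
    have h2 := h.rotate hσ hl
      (CoxeterMatrix.PosDefOn.hasLifts hl.of_cons (hM.posDefOn (List.nodup_cons.1 hl).1))
    have h1 := ih (v ++ [a]) (by simpa using hl') (by simpa using h2)
    simpa [wordProd_cons, mul_assoc] using h1

variable {l : List B} (hl : l.Nodup)
include hl

theorem isReflLift_conj {r : W} {x : G} (h : cs.IsReflLift σ l r x) :
    cs.IsReflLift σ l (cs.wordProd l * r * (cs.wordProd l)⁻¹)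
      ((l.map σ).prod * x * (l.map σ).prod⁻¹) := by
  simpa using hM.isReflLift_append_conj hσ l [] (by simpa using hl) (by simpa using h)

theorem isReflLift_inv_conj {r : W} {x : G} (h : cs.IsReflLift σ l r x) :
    cs.IsReflLift σ l ((cs.wordProd l)⁻¹ * r * cs.wordProd l)
      ((l.map σ).prod⁻¹ * x * (l.map σ).prod) := by
  simpa using hM.isReflLift_append_inv_conj hσ l [] (by simpa using hl) (by simpa using h)

theorem hasHurwitzLift_cons {r : W} {f : List W} (h : cs.HasHurwitzLift σ l
    (f ++ [(cs.wordProd l)⁻¹ * r * cs.wordProd l])) : cs.HasHurwitzLift σ l (r :: f) := by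
  obtain ⟨xs, hf, hx⟩ := h
  have h1 := (List.forall₂_take_append _ _ _ hf.flip).flip
  have h2 := (List.forall₂_drop_append _ _ _ hf.flip).flip
  obtain ⟨y, t, hy, ht, hxy⟩ := List.forall₂_cons_left_iff.1 h2
  rw [List.forall₂_nil_left_iff.1 ht] at hxy
  set ys := xs.take f.length
  have hxs : ys ++ [y] = xs := by rw [← hxy, List.take_append_drop]
  rw [← hxs] at hx
  have hD : ys.prod * y = (l.map σ).prod := by simpa using hx.prod_eq
  refine ⟨_, .cons ?_ h1, (HurwitzEquiv.conj_prod_cons y ys).trans hx⟩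
  have h3 := hM.isReflLift_conj hσ hl hy
  rw [← hD] at h3
  simpa [mul_assoc] using h3

theorem hasHurwitzLift_of_conj {f : List W} (h : cs.HasHurwitzLift σ l
    (f.map fun x => cs.wordProd l * x * (cs.wordProd l)⁻¹)) : cs.HasHurwitzLift σ l f := by
  obtain ⟨xs, hf, hx⟩ := h
  refine ⟨xs.map fun x => (l.map σ).prod⁻¹ * x * (l.map σ).prod, ?_, ?_⟩
  · rw [List.forall₂_map_left_iff] at hf
    rw [List.forall₂_map_right_iff]
    refine hf.imp fun r x hrx => ?_
    simpa [mul_assoc] using hM.isReflLift_inv_conj hσ hl hrx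
  · have h1 := hx.trans (HurwitzEquiv.map_conj_prod (l.map σ))
    have h2 := h1.map_conj (l.map σ).prod⁻¹
    rw [List.map_map] at h2
    simpa [mul_assoc, Function.comp_def] using h2

theorem hasHurwitzLift_of_conj_pow (n : ℕ) {f : List W} (h : cs.HasHurwitzLift σ l
    (f.map fun x => cs.wordProd l ^ n * x * (cs.wordProd l ^ n)⁻¹)) :
    cs.HasHurwitzLift σ l f := by
  induction n generalizing f with
  | zero => simpa using h
  | succ n ih =>
    refine hM.hasHurwitzLift_of_conj hσ hl (ih ?_)
    simpa [pow_succ, mul_assoc, Function.comp_def] using h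

theorem hasHurwitzLift_of_not_isPosRoot {β : B → ℝ} {n : ℕ}
    (hβ : cs.IsPosRoot β) (hn : ¬ cs.IsPosRoot (cs.rep ((cs.wordProd l)⁻¹ ^ n) β))
    {r : W} {f : List W} (hr : cs.rep r = M.reflect β) (hf : ∀ x ∈ f, cs.IsRootReflection x)
    (hlen : f.length + 1 = l.length) (hprod : r * f.prod = cs.wordProd l) :
    cs.HasHurwitzLift σ l (r :: f) := by
  refine CoxeterSystem.rotation_induction (cs := cs) (l₀ := l)
    (Q := fun l β => ∀ r f, cs.rep r = M.reflect β → (∀ x ∈ f, cs.IsRootReflection x) →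
      f.length + 1 = l.length → r * f.prod = cs.wordProd l → cs.HasHurwitzLift σ l (r :: f))
    ?_ ?_ (List.Perm.refl l) hβ hn r f hr hf hlen hprod
  · intro a l' hperm r f hr hf hlen hprod
    have hnd := hperm.nodup_iff.2 hl
    rw [← cs.rep_simple] at hr
    obtain rfl := cs.rep_injective hr
    refine .cons (List.nodup_cons.1 hnd).1 (CoxeterMatrix.PosDefOn.hasHurwitzLift hσ hnd.of_cons
      (hM.posDefOn (List.nodup_cons.1 hnd).1) hf (by simpa using hlen) ?_)
    simpa [wordProd_cons] using hprod
  · intro a l' γ hperm hγ hne hQ r f hr hf hlen hprod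
    have hnd := hperm.nodup_iff.2 hl
    refine CoxeterSystem.hasHurwitzLift_of_rotate hσ hnd
      (CoxeterMatrix.PosDefOn.hasLifts hnd.of_cons (hM.posDefOn (List.nodup_cons.1 hnd).1))
      (fun r f hr hf hlen hprod => ?_) hr hf (by simpa using hlen) hprod
    exact hQ r f hr hf (by simpa using hlen) hprod

variable (hc : ∀ b, b ∈ l)
include hc

theorem hasHurwitzLift_of_euler_ne_zero {β : B → ℝ} (hβ : cs.IsPosRoot β)
    (hd : M.euler l δ β ≠ 0) {r : W} {f : List W} (hr : cs.rep r = M.reflect β)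
    (hf : ∀ x ∈ f, cs.IsRootReflection x) (hlen : f.length + 1 = l.length)
    (hprod : r * f.prod = cs.wordProd l) : cs.HasHurwitzLift σ l (r :: f) := by
  obtain ⟨n, hn | hn⟩ := hM.exists_not_isPosRoot (cs := cs) hl hc hd
  · exact hM.hasHurwitzLift_of_not_isPosRoot hσ hl hβ hn hr hf hlen hprod
  · refine hM.hasHurwitzLift_of_conj_pow hσ hl n ?_
    have hneg := (hβ.rep_pos_or_neg (cs.wordProd l ^ n)).resolve_left hn
    rw [List.map_cons]
    refine hM.hasHurwitzLift_of_not_isPosRoot hσ hl hneg (n := n) ?_ ?_ ?_ (by simpa using hlen) ?_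
    · rw [map_neg, inv_pow, cs.rep_inv_rep]
      exact fun h => hβ.not_nonpos (neg_nonneg.1 h.1)
    · rw [map_mul, map_mul, hr, CoxeterMatrix.rep_reflect_rep_inv, M.reflect_neg]
    · intro x hx
      obtain ⟨y, hy, rfl⟩ := List.mem_map.1 hx
      exact (hf y hy).conj _
    · have h1 : (f.map fun x => cs.wordProd l ^ n * x * (cs.wordProd l ^ n)⁻¹).prod =
          cs.wordProd l ^ n * f.prod * (cs.wordProd l ^ n)⁻¹ :=
        (map_list_prod (MulAut.conj (cs.wordProd l ^ n)) f).symm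
      rw [h1, ← hprod]
      have h2 : ∀ g : W, g ^ n * r * (g ^ n)⁻¹ * (g ^ n * f.prod * (g ^ n)⁻¹) =
          g ^ n * (r * f.prod) * (g ^ n)⁻¹ := fun g => by group
      rw [h2, ← pow_succ, pow_succ', mul_inv_cancel_right]

/-- Every factorization of a Coxeter element of an affine Coxeter group into as many reflections as
there are generators lifts to a tuple which is Hurwitz equivalent to the tuple of generators. -/
theorem hasHurwitzLift [Nonempty B] {f : List W} (hf : ∀ r ∈ f, cs.IsRootReflection r)
    (hlen : f.length = l.length) (hprod : f.prod = cs.wordProd l) :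
    cs.HasHurwitzLift σ l f := by
  obtain ⟨bs, hbs⟩ := CoxeterSystem.exists_forall₂_isPosRoot hf
  obtain ⟨β, hβ, hd⟩ := hM.exists_euler_ne_zero hl hc (hbs.imp fun _ _ h => h.2) hprod
  obtain ⟨r, hr, hβ, hrβ⟩ : ∃ r ∈ f, cs.IsPosRoot β ∧ cs.rep r = M.reflect β := by
    clear hf hlen hprod hd
    induction hbs with
    | nil => simp at hβ
    | cons h _ ih =>
      rcases List.mem_cons.1 hβ with rfl | hβ
      · exact ⟨_, List.mem_cons_self, h⟩
      · obtain ⟨r, hr, h⟩ := ih hβ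
        exact ⟨r, List.mem_cons_of_mem _ hr, h⟩
  obtain ⟨u, v, rfl⟩ := List.append_of_mem hr
  clear hbs hr
  induction u generalizing v with
  | nil =>
    exact hM.hasHurwitzLift_of_euler_ne_zero hσ hl hc hβ hd hrβ
      (fun x hx => hf x (by simp [hx])) (by simpa using hlen) (by simpa using hprod)
  | cons s u ih =>
    refine hM.hasHurwitzLift_cons hσ hl ?_
    change cs.HasHurwitzLift σ l ((u ++ r :: v) ++ [_])
    rw [List.append_assoc, List.cons_append]
    refine ih (v ++ [_]) ?_ ?_ ?_
    · intro x hx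
      simp only [List.mem_append, List.mem_cons, List.not_mem_nil, or_false] at hx
      rcases hx with hx | hx | hx | rfl
      · exact hf x (by simp [hx])
      · exact hf x (by simp [hx])
      · exact hf x (by simp [hx])
      · simpa using (hf s (by simp)).conj (cs.wordProd l)⁻¹
    · simp only [List.length_append, List.length_cons, List.length_nil] at hlen ⊢
      omega
    · rw [← hprod]
      simp [mul_assoc]

end CoxeterMatrix.IsAffine

end AffineFactorizations

section ReflectionLength

variable {B : Type*} [Fintype B] [DecidableEq B] {M : CoxeterMatrix B}
  {W : Type*} [Group W] {cs : CoxeterSystem M W}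

theorem CoxeterSystem.isRootReflection_conj_simple (w : W) (i : B) :
    cs.IsRootReflection (w * cs.simple i * w⁻¹) :=
  CoxeterSystem.exists_isPosRoot_of_isConj w i

theorem CoxeterSystem.isRootReflection_simple (i : B) : cs.IsRootReflection (cs.simple i) :=
  ⟨_, cs.isPosRoot_simpleRoot i, cs.rep_simple i⟩

theorem CoxeterSystem.IsRootReflection.lengthParity_eq {r : W} (h : cs.IsRootReflection r) :
    cs.lengthParity r = Multiplicative.ofAdd 1 := by
  obtain ⟨β, ⟨-, w, i, rfl⟩, hr⟩ := h
  rw [← cs.rep_conj_simple] at hr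
  rw [cs.rep_injective hr, map_mul, map_mul, mul_comm, ← mul_assoc, map_inv, inv_mul_cancel,
    one_mul, cs.lengthParity_simple]

theorem CoxeterSystem.lengthParity_prod {f : List W} (hf : ∀ r ∈ f, cs.IsRootReflection r) :
    cs.lengthParity f.prod = Multiplicative.ofAdd (f.length : ZMod 2) := by
  induction f with
  | nil => simp
  | cons r f ih =>
    rw [List.prod_cons, map_mul, ih fun r hr => hf r (List.mem_cons_of_mem _ hr),
      (hf r List.mem_cons_self).lengthParity_eq, List.length_cons, Nat.cast_succ, add_comm,
      ofAdd_add]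

theorem CoxeterMatrix.IsAffine.length_le {δ : B → ℝ} (hM : M.IsAffine δ) {l : List B}
    (hl : l.Nodup) (hc : ∀ b, b ∈ l) {f : List W} (hf : ∀ r ∈ f, cs.IsRootReflection r)
    (hprod : f.prod = cs.wordProd l) : l.length ≤ f.length := by
  have hcard : l.length = Module.finrank ℝ (B → ℝ) := by
    rw [Module.finrank_fintype_fun_eq_card, ← List.toFinset_card_of_nodup hl, ← Finset.card_univ]
    congr
    ext b
    simp [hc]
  obtain ⟨bs, hbs⟩ := CoxeterSystem.exists_forall₂_isPosRoot hf
  set T : Module.End ℝ (B → ℝ) := LinearMap.id - cs.rep (cs.wordProd l) with hT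
  have hrange : LinearMap.range T ≤ Submodule.span ℝ {β | β ∈ bs} := by
    rintro _ ⟨x, rfl⟩
    simpa [hT, hprod] using
      CoxeterSystem.rep_prod_sub_mem_span (hbs.imp fun _ _ h => h.2) x
  have hker : LinearMap.ker T ≤ Submodule.span ℝ {δ} := by
    intro x hx
    have hx' : cs.rep (cs.wordProd l) x = x := (sub_eq_zero.1 hx).symm
    have h1 := CoxeterMatrix.IsAffine.euler_sub_rep_inv (M := M) (cs := cs) hl hc x x
    nth_rewrite 3 [← hx'] at h1
    rw [cs.rep_inv_rep, sub_self, map_zero] at h1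
    obtain ⟨t, rfl⟩ := hM.exists_eq_smul x (by linarith)
    exact Submodule.smul_mem _ t (Submodule.mem_span_singleton_self δ)
  have h1 := LinearMap.finrank_range_add_finrank_ker T
  have h2 := (Submodule.finrank_mono hrange).trans (finrank_span_list_le bs)
  have h3 : Module.finrank ℝ (LinearMap.ker T) ≤ 1 :=
    (Submodule.finrank_mono hker).trans ((finrank_span_le_card _).trans_eq (by simp))
  have h4 : l.length ≤ f.length + 1 := by
    rw [hbs.length_eq]
    omega
  have h5 : (f.length : ZMod 2) = l.length := by
    have h6 := CoxeterSystem.lengthParity_prod (cs := cs) (f := l.map cs.simple) fun r hr => by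
      obtain ⟨i, -, rfl⟩ := List.mem_map.1 hr
      exact CoxeterSystem.isRootReflection_simple i
    have h7 := CoxeterSystem.lengthParity_prod hf
    rw [hprod, wordProd, h6, List.length_map] at h7
    exact (Multiplicative.ofAdd.injective h7).symm
  rw [ZMod.natCast_eq_natCast_iff'] at h5
  omega

variable {G : Type*} [Group G] {σ : B → G}

theorem LeftLift.rep_eq (π : G →* W) (hπ : ∀ b, π (σ b) = cs.simple b) {l : List B}
    {β : B → ℝ} {x : G} (h : LeftLift M σ l β x) : cs.rep (π x) = M.reflect β := by
  induction h with
  | base a l => rw [hπ, cs.rep_simple]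
  | drop _ _ _ _ _ _ ih => exact ih
  | refl a l β x _ _ _ ih =>
    have h1 : π (σ a * x * (σ a)⁻¹) = cs.simple a * π x * cs.simple a := by
      rw [map_mul, map_mul, map_inv, hπ, cs.inv_simple]
    rw [h1, CoxeterSystem.rep_simple_conj a _ ih, M.reflect_reflect (M.form_simpleRoot_self a)]

theorem IsLift.rep_eq (π : G →* W) (hπ : ∀ b, π (σ b) = cs.simple b) {l : List B}
    {β : B → ℝ} {x : G} (hβ : cs.IsPosRoot β) (h : IsLift M σ l β x) :
    cs.rep (π x) = M.reflect β := by
  rcases h with h | h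
  · exact h.rep_eq π hπ
  · let π' : Gᵐᵒᵖ →* W := (MulEquiv.inv' W).symm.toMonoidHom.comp π.op
    have h1 : cs.rep (π x)⁻¹ = M.reflect β := LeftLift.rep_eq π' (fun b => by
      simp [π', hπ]) h
    refine LinearMap.ext fun y => ?_
    rw [← cs.rep_rep_inv (π x) (M.reflect β y), h1, M.reflect_reflect hβ.form_self]

theorem CoxeterSystem.IsReflLift.map_eq (π : G →* W) (hπ : ∀ b, π (σ b) = cs.simple b)
    {l : List B} {r : W} {x : G} (h : cs.IsReflLift σ l r x) : π x = r := by
  obtain ⟨β, hβ, -, hr, hx⟩ := h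
  exact cs.rep_injective ((hx.rep_eq π hπ hβ).trans hr.symm)

theorem CoxeterSystem.isReflLift_simple_of_mem {l : List B} (hl : l.Nodup) {b : B} (hb : b ∈ l) :
    cs.IsReflLift σ l (cs.simple b) (σ b) := by
  induction l with
  | nil => simp at hb
  | cons a l ih =>
    rcases List.mem_cons.1 hb with rfl | hb
    · exact CoxeterSystem.isReflLift_simple b l
    · exact (ih hl.of_cons hb).cons (List.nodup_cons.1 hl).1

theorem CoxeterSystem.HasHurwitzLift.hurwitzEquiv (π : G →* W)
    (hπ : ∀ b, π (σ b) = cs.simple b) {l : List B} {f : List W}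
    (h : cs.HasHurwitzLift σ l f) : HurwitzEquiv f (l.map cs.simple) := by
  obtain ⟨xs, hf, hx⟩ := h
  have h1 : f = xs.map π := by
    clear hx
    induction hf with
    | nil => rfl
    | cons h _ ih => rw [List.map_cons, h.map_eq π hπ, ← ih]
  have h2 := hx.map π
  rw [List.map_map, ← h1] at h2
  rwa [← show π ∘ σ = cs.simple from funext hπ]

end ReflectionLength

section Alternating

variable {B G : Type*} [Group G]

theorem prod_map_alternatingWord_two_mul (σ : B → G) (i j : B) (k : ℕ) :
    ((alternatingWord i j (2 * k)).map σ).prod = (σ i * σ j) ^ k := by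
  induction k with
  | zero => simp [alternatingWord]
  | succ k ih =>
    rw [show 2 * (k + 1) = 2 * k + 1 + 1 by ring, alternatingWord_succ', alternatingWord_succ']
    simp [ih, pow_succ', mul_assoc, parity_simps]

theorem prod_map_alternatingWord_two_mul_add_one (σ : B → G) (i j : B) (k : ℕ) :
    ((alternatingWord i j (2 * k + 1)).map σ).prod = σ j * (σ i * σ j) ^ k := by
  rw [alternatingWord_succ']
  simp [prod_map_alternatingWord_two_mul]

/-- The braid relation follows from the periodicity of the associated dual sequence. -/
theorem prod_map_alternatingWord_eq_of_periodic {σ : B → G} {i j : B} {m : ℕ} {Y : ℕ → G}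
    (h0 : Y 0 = σ i) (h1 : Y 1 = σ j) (hY : ∀ n, Y n * Y (n + 1) = σ i * σ j)
    (hm : Y m = Y 0) :
    ((alternatingWord i j m).map σ).prod = ((alternatingWord j i m).map σ).prod := by
  set D := σ i * σ j with hD
  have hstep : ∀ n, Y (n + 2) = D⁻¹ * Y n * D := by
    intro n
    have h2 := hY n
    have h3 := hY (n + 1)
    rw [← h2, mul_inv_rev]
    rw [← h2] at h3
    rw [eq_inv_mul_of_mul_eq h3]
    group
  have heven : ∀ k, D ^ k * Y (2 * k) = σ i * D ^ k := by
    intro k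
    induction k with
    | zero => simp [h0]
    | succ k ih =>
      rw [show 2 * (k + 1) = 2 * k + 2 by ring, hstep, pow_succ, ← mul_assoc (σ i), ← ih]
      group
  have hodd : ∀ k, D ^ k * Y (2 * k + 1) = σ j * D ^ k := by
    intro k
    induction k with
    | zero => simp [h1]
    | succ k ih =>
      rw [show 2 * (k + 1) + 1 = 2 * k + 1 + 2 by ring, hstep, pow_succ, ← mul_assoc (σ j), ← ih]
      group
  have hconj : ∀ k, (σ j * σ i) ^ k = (σ i)⁻¹ * D ^ k * σ i := by
    intro k
    have h2 := conj_pow (a := (σ i)⁻¹) (b := D) (i := k)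
    rw [inv_inv] at h2
    rw [← h2, hD]
    group
  rcases Nat.even_or_odd' m with ⟨k, rfl | rfl⟩
  · rw [prod_map_alternatingWord_two_mul, prod_map_alternatingWord_two_mul, hconj, ← hD]
    have h2 := heven k
    rw [hm, h0] at h2
    rw [mul_assoc, h2]
    group
  · rw [prod_map_alternatingWord_two_mul_add_one, prod_map_alternatingWord_two_mul_add_one, hconj,
      ← hD]
    have h2 := hodd k
    rw [hm, h0] at h2
    rw [← h2]
    group

end Alternating

section ArtinLift

variable {B : Type*} {M : CoxeterMatrix B} {G : Type*} [Group G]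

theorem map_freeWord (φ : FreeGroup B →* G) (l : List B) :
    φ (freeWord l) = (l.map fun b => φ (FreeGroup.of b)).prod := by
  rw [freeWord, map_list_prod, List.map_map]
  rfl

theorem ArtinGroup.isBraided_of (M : CoxeterMatrix B) : M.IsBraided (ArtinGroup.of M) := by
  intro i j hij hm
  have h : freeWord (alternatingWord i j (M i j)) * (freeWord (alternatingWord j i (M i j)))⁻¹ ∈
      artinRelationsSet M := ⟨i, j, hij, hm, rfl⟩
  have h1 := PresentedGroup.one_of_mem h
  rw [map_mul, map_inv, map_freeWord, map_freeWord] at h1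
  exact mul_inv_eq_one.1 h1

theorem CoxeterMatrix.isBraided_simple (M : CoxeterMatrix B) : M.IsBraided M.simple := by
  intro i j _ _
  have h := M.toCoxeterSystem.wordProd_braidWord_eq i j
  rw [braidWord, braidWord, M.symmetric j i] at h
  exact h

/-- The homomorphism from the Artin group of `M` determined by a braided family. -/
def ArtinGroup.lift {f : B → G} (hf : M.IsBraided f) : ArtinGroup M →* G :=
  PresentedGroup.toGroup (f := f) (rels := artinRelationsSet M) fun r hr => by
    obtain ⟨i, j, hij, hm, rfl⟩ := hr
    rw [map_mul, map_inv, map_freeWord, map_freeWord, mul_inv_eq_one]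
    simpa using hf i j hij hm

@[simp]
theorem ArtinGroup.lift_of {f : B → G} (hf : M.IsBraided f) (b : B) :
    ArtinGroup.lift hf (ArtinGroup.of M b) = f b :=
  PresentedGroup.toGroup.of _

theorem ArtinGroup.hom_ext {φ ψ : ArtinGroup M →* G}
    (h : ∀ b, φ (ArtinGroup.of M b) = ψ (ArtinGroup.of M b)) : φ = ψ :=
  PresentedGroup.ext h

end ArtinLift

section DualArtinLift

variable {B : Type*} {M : CoxeterMatrix B} {l : List B} {G : Type*} [Group G]

open Classical in
/-- The element of the dual Artin group corresponding to a reflection in `dualGens M l`, and `1`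
for the other elements of the Coxeter group. -/
noncomputable def DualArtinGroup.gen (M : CoxeterMatrix B) (l : List B) (r : M.Group) :
    DualArtinGroup M l :=
  if h : r ∈ dualGens M l then PresentedGroup.of ⟨r, h⟩ else 1

theorem DualArtinGroup.gen_of_mem {r : M.Group} (h : r ∈ dualGens M l) :
    DualArtinGroup.gen M l r = PresentedGroup.of ⟨r, h⟩ :=
  dif_pos h

theorem DualArtinGroup.prod_map_gen_eq {f g : List M.Group} (hf : IsMinFactorization M l f)
    (hg : IsMinFactorization M l g) :
    (f.map (DualArtinGroup.gen M l)).prod = (g.map (DualArtinGroup.gen M l)).prod := by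
  have hf' : ∀ r ∈ f, r ∈ dualGens M l := fun r hr => ⟨f, hf, hr⟩
  have hg' : ∀ r ∈ g, r ∈ dualGens M l := fun r hr => ⟨g, hg, hr⟩
  lift f to List ↥(dualGens M l) using hf'
  lift g to List ↥(dualGens M l) using hg'
  have h : (f.map FreeGroup.of).prod * ((g.map FreeGroup.of).prod)⁻¹ ∈ dualRels M l :=
    ⟨f, g, hf, hg, rfl⟩
  have h1 := PresentedGroup.one_of_mem h
  rw [map_mul, map_inv, mul_inv_eq_one, map_list_prod, map_list_prod, List.map_map,
    List.map_map] at h1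
  have h2 : DualArtinGroup.gen M l ∘ Subtype.val =
      PresentedGroup.mk (dualRels M l) ∘ FreeGroup.of :=
    funext fun r => DualArtinGroup.gen_of_mem r.2
  rw [List.map_map, List.map_map, h2]
  exact h1

/-- The homomorphism from the dual Artin group determined by a map that is constant on minimal
factorizations. -/
def DualArtinGroup.lift (f : M.Group → G) (c : G)
    (hf : ∀ g, IsMinFactorization M l g → (g.map f).prod = c) : DualArtinGroup M l →* G :=
  PresentedGroup.toGroup (f := fun r : ↥(dualGens M l) => f r) (rels := dualRels M l)
    fun r hr => by
      obtain ⟨f₁, f₂, h₁, h₂, rfl⟩ := hr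
      have h3 := (hf _ h₁).trans (hf _ h₂).symm
      rw [List.map_map, List.map_map] at h3
      have h4 : FreeGroup.lift (fun r : ↥(dualGens M l) => f r) ∘ FreeGroup.of =
          f ∘ Subtype.val := funext fun r => FreeGroup.lift_apply_of
      rw [map_mul, map_inv, mul_inv_eq_one, map_list_prod, map_list_prod, List.map_map,
        List.map_map, h4, h3]

theorem DualArtinGroup.lift_of (f : M.Group → G) (c : G)
    (hf : ∀ g, IsMinFactorization M l g → (g.map f).prod = c) (r : ↥(dualGens M l)) :
    DualArtinGroup.lift f c hf (PresentedGroup.of r) = f r :=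
  PresentedGroup.toGroup.of (f := fun r : ↥(dualGens M l) => f r) _

end DualArtinLift

section Isomorphism

variable {B : Type*} [Fintype B] [DecidableEq B] {M : CoxeterMatrix B} {δ : B → ℝ} {l : List B}

theorem isRootReflection_of_mem_reflections {r : M.Group} (hr : r ∈ reflections M) :
    M.toCoxeterSystem.IsRootReflection r := by
  obtain ⟨i, g, rfl⟩ := hr
  exact CoxeterSystem.isRootReflection_conj_simple g i

theorem simple_mem_reflections (b : B) : M.simple b ∈ reflections M := ⟨b, 1, by simp⟩

theorem conj_mem_reflections {r : M.Group} (hr : r ∈ reflections M) (g : M.Group) :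
    g * r * g⁻¹ ∈ reflections M := by
  obtain ⟨i, h, rfl⟩ := hr
  exact ⟨i, g * h, by group⟩

theorem CoxeterMatrix.IsAffine.wordLength_coxeterElt (hM : M.IsAffine δ) (hl : l.Nodup)
    (hc : ∀ b, b ∈ l) : wordLength (reflections M) (coxeterElt M l) = l.length := by
  refine le_antisymm (Nat.sInf_le ⟨l.map M.simple, by simp, ?_, rfl⟩) ?_
  · intro x hx
    obtain ⟨b, -, rfl⟩ := List.mem_map.1 hx
    exact simple_mem_reflections b
  · refine le_csInf ⟨_, l.map M.simple, rfl, ?_, rfl⟩ ?_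
    · intro x hx
      obtain ⟨b, -, rfl⟩ := List.mem_map.1 hx
      exact simple_mem_reflections b
    · rintro _ ⟨f, rfl, hf, hprod⟩
      exact hM.length_le (cs := M.toCoxeterSystem) hl hc
        (fun r hr => isRootReflection_of_mem_reflections (hf r hr)) hprod

theorem CoxeterMatrix.IsAffine.isMinFactorization_iff (hM : M.IsAffine δ) (hl : l.Nodup)
    (hc : ∀ b, b ∈ l) {f : List M.Group} : IsMinFactorization M l f ↔
      f.length = l.length ∧ (∀ r ∈ f, r ∈ reflections M) ∧
        f.prod = (l.map M.simple).prod := by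
  rw [IsMinFactorization, hM.wordLength_coxeterElt hl hc]
  rfl

theorem CoxeterMatrix.IsAffine.isMinFactorization_map_simple (hM : M.IsAffine δ) (hl : l.Nodup)
    (hc : ∀ b, b ∈ l) : IsMinFactorization M l (l.map M.simple) := by
  rw [hM.isMinFactorization_iff hl hc]
  refine ⟨by simp, fun x hx => ?_, rfl⟩
  obtain ⟨b, -, rfl⟩ := List.mem_map.1 hx
  exact simple_mem_reflections b

theorem CoxeterMatrix.IsAffine.simple_mem_dualGens (hM : M.IsAffine δ) (hl : l.Nodup)
    (hc : ∀ b, b ∈ l) (b : B) : M.simple b ∈ dualGens M l :=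
  ⟨_, hM.isMinFactorization_map_simple hl hc, List.mem_map_of_mem (hc b)⟩

/-- The dual braid relation between two reflections whose product occurs as a subword of the
Coxeter element. -/
theorem CoxeterMatrix.IsAffine.gen_mul_gen_eq (hM : M.IsAffine δ) (hl : l.Nodup)
    (hc : ∀ b, b ∈ l) {u v t : List B} {a b : B} (h : l = u ++ a :: (v ++ b :: t))
    {x y x' y' : M.Group} (hx : x ∈ reflections M) (hy : y ∈ reflections M)
    (hx' : x' ∈ reflections M) (hy' : y' ∈ reflections M)
    (hxy : x * y = M.simple a * M.simple b) (hxy' : x' * y' = M.simple a * M.simple b) :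
    DualArtinGroup.gen M l x * DualArtinGroup.gen M l y =
      DualArtinGroup.gen M l x' * DualArtinGroup.gen M l y' := by
  set c : List M.Group :=
    (v.map fun i => (M.simple b)⁻¹ * M.simple i * M.simple b) ++ t.map M.simple with hcdef
  have hcprod : M.simple b * c.prod =
      (v.map M.simple).prod * (M.simple b * (t.map M.simple).prod) := by
    have h1 : (v.map fun i => (M.simple b)⁻¹ * M.simple i * M.simple b).prod =
        (M.simple b)⁻¹ * (v.map M.simple).prod * M.simple b := by
      clear h hcdef
      induction v with
      | nil => simp
      | cons i v ih =>
        rw [List.map_cons, List.prod_cons, List.map_cons, List.prod_cons, ih]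
        group
    rw [hcdef, List.prod_append, h1]
    group
  have hcmem : ∀ r ∈ c, r ∈ reflections M := by
    intro r hr
    rcases List.mem_append.1 hr with hr | hr
    · obtain ⟨i, -, rfl⟩ := List.mem_map.1 hr
      simpa using conj_mem_reflections (simple_mem_reflections i) (M.simple b)⁻¹
    · obtain ⟨i, -, rfl⟩ := List.mem_map.1 hr
      exact simple_mem_reflections i
  have key : ∀ x y : M.Group, x ∈ reflections M → y ∈ reflections M →
      x * y = M.simple a * M.simple b →
      IsMinFactorization M l (u.map M.simple ++ x :: y :: c) := by
    intro x y hx hy hxy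
    rw [hM.isMinFactorization_iff hl hc]
    refine ⟨?_, ?_, ?_⟩
    · simp only [h, hcdef, List.length_append, List.length_cons, List.length_map]
      omega
    · intro r hr
      simp only [List.mem_append, List.mem_cons] at hr
      rcases hr with hr | rfl | rfl | hr
      · obtain ⟨i, -, rfl⟩ := List.mem_map.1 hr
        exact simple_mem_reflections i
      · exact hx
      · exact hy
      · exact hcmem r hr
    · rw [List.prod_append, List.prod_cons, List.prod_cons, ← mul_assoc x, hxy, mul_assoc, hcprod,
        h]
      simp
  have h1 := DualArtinGroup.prod_map_gen_eq (key x y hx hy hxy) (key x' y' hx' hy' hxy')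
  simp only [List.map_append, List.map_cons, List.prod_append, List.prod_cons,
    mul_right_inj] at h1
  rwa [← mul_assoc, ← mul_assoc, mul_left_inj] at h1

theorem CoxeterMatrix.IsAffine.isBraided_gen (hM : M.IsAffine δ) (hl : l.Nodup)
    (hc : ∀ b, b ∈ l) : M.IsBraided fun b => DualArtinGroup.gen M l (M.simple b) := by
  have main : ∀ i j : B, (∃ u v t : List B, l = u ++ i :: (v ++ j :: t)) →
      ((alternatingWord i j (M i j)).map fun b => DualArtinGroup.gen M l (M.simple b)).prod =
      ((alternatingWord j i (M i j)).map fun b => DualArtinGroup.gen M l (M.simple b)).prod := by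
    rintro i j ⟨u, v, t, h⟩
    obtain ⟨d, hd⟩ : ∃ d : M.Group, d = M.simple i * M.simple j := ⟨_, rfl⟩
    have hi : M.simple i * M.simple i = 1 := M.toCoxeterSystem.simple_mul_simple_self i
    have hj : M.simple j * M.simple j = 1 := M.toCoxeterSystem.simple_mul_simple_self j
    have hdm : d ^ M i j = 1 := hd ▸ M.toCoxeterSystem.simple_mul_simple_pow i j
    have hid : d⁻¹ * M.simple i = M.simple i * d := by
      rw [hd, mul_inv_rev, inv_mul_cancel_right, ← mul_assoc, hi, one_mul,
        inv_eq_of_mul_eq_one_left hj]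
    have hstep : ∀ n, M.simple i * d ^ (n + 2) = d⁻¹ * (M.simple i * d ^ n) * d⁻¹⁻¹ := by
      intro n
      rw [inv_inv, ← mul_assoc, hid, pow_succ, pow_succ']
      simp only [mul_assoc]
    have hrefl : ∀ n, M.simple i * d ^ n ∈ reflections M := by
      intro n
      induction n using Nat.strong_induction_on with
      | _ n ih =>
        match n with
        | 0 => simpa using simple_mem_reflections i
        | 1 =>
          rw [pow_one, hd, ← mul_assoc, hi, one_mul]
          exact simple_mem_reflections j
        | n + 2 =>
          rw [hstep]
          exact conj_mem_reflections (ih n (by omega)) _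
    have hmul : ∀ n, M.simple i * d ^ n * (M.simple i * d ^ (n + 1)) = d := by
      intro n
      induction n with
      | zero => rw [pow_zero, mul_one, zero_add, pow_one, ← mul_assoc, hi, one_mul]
      | succ n ih =>
        rw [hstep, pow_succ]
        have h2 : M.simple i * d ^ n * d * (d⁻¹ * (M.simple i * d ^ n) * d⁻¹⁻¹) =
          M.simple i * d ^ n * (M.simple i * (d ^ n * d)) := by group
        rw [← mul_assoc (M.simple i), h2, ← pow_succ, ih]
    refine prod_map_alternatingWord_eq_of_periodic
      (Y := fun n => DualArtinGroup.gen M l (M.simple i * d ^ n)) ?_ ?_ ?_ ?_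
    · simp
    · simp only [pow_one]
      rw [hd, ← mul_assoc, hi, one_mul]
    · intro n
      exact hM.gen_mul_gen_eq hl hc h (hrefl n) (hrefl (n + 1)) (simple_mem_reflections i)
        (simple_mem_reflections j) ((hmul n).trans hd) rfl
    · simp [hdm]
  intro i j hij _
  obtain ⟨u, w, h⟩ := List.append_of_mem (hc i)
  have hj := hc j
  rw [h] at hj
  rcases List.mem_append.1 hj with hj | hj
  · obtain ⟨u', v, rfl⟩ := List.append_of_mem hj
    have h1 := main j i ⟨u', v, w, by rw [h]; simp⟩
    rw [M.symmetric j i] at h1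
    exact h1.symm
  · obtain ⟨v, t, rfl⟩ := List.append_of_mem ((List.mem_cons.1 hj).resolve_left hij.symm)
    exact main i j ⟨u, v, t, h⟩

theorem CoxeterMatrix.IsAffine.hurwitzEquiv_of_isMinFactorization [Nonempty B]
    (hM : M.IsAffine δ) (hl : l.Nodup) (hc : ∀ b, b ∈ l) {f : List M.Group}
    (hf : IsMinFactorization M l f) : HurwitzEquiv f (l.map M.simple) := by
  rw [hM.isMinFactorization_iff hl hc] at hf
  exact (hM.hasHurwitzLift (cs := M.toCoxeterSystem) (ArtinGroup.isBraided_of M) hl hc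
    (fun r hr => isRootReflection_of_mem_reflections (hf.2.1 r hr)) hf.1 hf.2.2).hurwitzEquiv
    (ArtinGroup.lift M.isBraided_simple) (ArtinGroup.lift_of _)

theorem CoxeterMatrix.IsAffine.gen_mem_range_iff (hM : M.IsAffine δ) (hl : l.Nodup)
    (hc : ∀ b, b ∈ l) (H : Subgroup (DualArtinGroup M l)) {f g : List M.Group}
    (hf : HurwitzEquiv f g) :
    (IsMinFactorization M l f ∧ ∀ r ∈ f, DualArtinGroup.gen M l r ∈ H) ↔
      (IsMinFactorization M l g ∧ ∀ r ∈ g, DualArtinGroup.gen M l r ∈ H) := by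
  refine HurwitzEquiv.iff_of_swap
    (p := fun f => IsMinFactorization M l f ∧ ∀ r ∈ f, DualArtinGroup.gen M l r ∈ H) ?_ hf
  intro u a b v
  have h1 : IsMinFactorization M l (u ++ a :: b :: v) ↔
      IsMinFactorization M l (u ++ a * b * a⁻¹ :: a :: v) := by
    rw [hM.isMinFactorization_iff hl hc, hM.isMinFactorization_iff hl hc]
    refine and_congr (by simp) (and_congr ?_ (by simp [mul_assoc]))
    simp only [List.mem_append, List.mem_cons, or_imp, forall_and, forall_eq]
    refine and_congr_right fun _ => ⟨fun h => ⟨conj_mem_reflections h.2.1 a, h.1, h.2.2⟩,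
      fun h => ⟨h.2.1, ?_, h.2.2⟩⟩
    have h2 := conj_mem_reflections h.1 a⁻¹
    rwa [show a⁻¹ * (a * b * a⁻¹) * a⁻¹⁻¹ = b by group] at h2
  show (_ ∧ _) ↔ (_ ∧ _)
  rw [← h1]
  refine and_congr_right fun h => ?_
  have h2 := DualArtinGroup.prod_map_gen_eq h (h1.1 h)
  simp only [List.map_append, List.map_cons, List.prod_append, List.prod_cons,
    mul_right_inj] at h2
  rw [← mul_assoc, ← mul_assoc, mul_left_inj] at h2
  simp only [List.mem_append, List.mem_cons, or_imp, forall_and, forall_eq]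
  refine and_congr_right fun _ => ⟨fun h => ⟨?_, h.1, h.2.2⟩, fun h => ⟨h.2.1, ?_, h.2.2⟩⟩
  · rw [eq_mul_inv_of_mul_eq h2.symm]
    exact H.mul_mem (H.mul_mem h.1 h.2.1) (H.inv_mem h.1)
  · rw [eq_inv_mul_of_mul_eq h2]
    exact H.mul_mem (H.inv_mem h.2.1) (H.mul_mem h.1 h.2.1)

theorem CoxeterMatrix.IsAffine.exists_dualArtin_lift [Nonempty B] (hM : M.IsAffine δ)
    (hl : l.Nodup) (hc : ∀ b, b ∈ l) :
    ∃ ψ : DualArtinGroup M l →* ArtinGroup M,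
      ∀ b, ψ (DualArtinGroup.gen M l (M.simple b)) = ArtinGroup.of M b := by
  have hσ := ArtinGroup.isBraided_of M
  have hex : ∀ g, IsMinFactorization M l g →
      M.toCoxeterSystem.HasHurwitzLift (ArtinGroup.of M) l g := by
    intro g hg
    rw [hM.isMinFactorization_iff hl hc] at hg
    exact hM.hasHurwitzLift hσ hl hc
      (fun r hr => isRootReflection_of_mem_reflections (hg.2.1 r hr)) hg.1 hg.2.2
  have hlift : ∀ r : M.Group, ∃ x, (∃ y, M.toCoxeterSystem.IsReflLift (ArtinGroup.of M) l r y) →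
      M.toCoxeterSystem.IsReflLift (ArtinGroup.of M) l r x := by
    intro r
    by_cases h : ∃ y, M.toCoxeterSystem.IsReflLift (ArtinGroup.of M) l r y
    · exact ⟨h.choose, fun _ => h.choose_spec⟩
    · exact ⟨1, fun h' => (h h').elim⟩
  choose Λ hΛ using hlift
  have hΛ' : ∀ r x, M.toCoxeterSystem.IsReflLift (ArtinGroup.of M) l r x → Λ r = x :=
    fun r x hx => (hΛ r ⟨x, hx⟩).unique hσ hl hx
  refine ⟨DualArtinGroup.lift Λ ((l.map (ArtinGroup.of M)).prod) ?_, fun b => ?_⟩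
  · intro g hg
    obtain ⟨xs, hxs, hequiv⟩ := hex g hg
    rw [← hequiv.prod_eq]
    congr 1
    clear hequiv hg
    induction hxs with
    | nil => rfl
    | cons h _ ih => rw [List.map_cons, ih, hΛ' _ _ h]
  · rw [DualArtinGroup.gen_of_mem (hM.simple_mem_dualGens hl hc b), DualArtinGroup.lift_of]
    exact hΛ' _ _ (CoxeterSystem.isReflLift_simple_of_mem (cs := M.toCoxeterSystem) hl (hc b))

theorem CoxeterMatrix.IsAffine.bijective_artin_lift [Nonempty B] (hM : M.IsAffine δ)
    (hl : l.Nodup) (hc : ∀ b, b ∈ l) :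
    Function.Bijective (ArtinGroup.lift (hM.isBraided_gen hl hc)) := by
  set φ := ArtinGroup.lift (hM.isBraided_gen hl hc) with hφ
  refine ⟨?_, ?_⟩
  · obtain ⟨ψ, hψ⟩ := hM.exists_dualArtin_lift hl hc
    have h1 : ψ.comp φ = MonoidHom.id _ := ArtinGroup.hom_ext fun b => by
      simp [hφ, hψ]
    exact Function.LeftInverse.injective (g := ψ) fun x => DFunLike.congr_fun h1 x
  · rw [← MonoidHom.range_eq_top, eq_top_iff]
    refine (PresentedGroup.closure_range_of (dualRels M l)).symm.le.trans
      ((Subgroup.closure_le _).2 ?_)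
    rintro _ ⟨⟨r, hr⟩, rfl⟩
    rw [← DualArtinGroup.gen_of_mem hr]
    obtain ⟨f, hf, hrf⟩ := hr
    refine ((hM.gen_mem_range_iff hl hc φ.range
      (hM.hurwitzEquiv_of_isMinFactorization hl hc hf)).2
      ⟨hM.isMinFactorization_map_simple hl hc, fun x hx => ?_⟩).2 r hrf
    obtain ⟨b, -, rfl⟩ := List.mem_map.1 hx
    exact ⟨ArtinGroup.of M b, ArtinGroup.lift_of _ b⟩

theorem CoxeterMatrix.IsAffine.exists_mulEquiv [Nonempty B] (hM : M.IsAffine δ)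
    (hl : l.Nodup) (hc : ∀ b, b ∈ l) :
    ∃ hS : ∀ b : B, M.simple b ∈ dualGens M l,
      ∃ φ : ArtinGroup M ≃* DualArtinGroup M l,
        ∀ b : B, φ (ArtinGroup.of M b) = PresentedGroup.of ⟨M.simple b, hS b⟩ :=
  ⟨hM.simple_mem_dualGens hl hc, MulEquiv.ofBijective _ (hM.bijective_artin_lift hl hc), fun b =>
    (ArtinGroup.lift_of (hM.isBraided_gen hl hc) b).trans
      (DualArtinGroup.gen_of_mem (hM.simple_mem_dualGens hl hc b))⟩

end Isomorphism

section AffineCriterion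

variable {B : Type*} [Fintype B] [DecidableEq B] {M : CoxeterMatrix B}

theorem CoxeterMatrix.form_simpleRoot_ne_zero {i j : B} (h : M i j ≠ 2) :
    M.form (simpleRoot i) (simpleRoot j) ≠ 0 := by
  rcases eq_or_ne i j with rfl | hij
  · simp [M.form_simpleRoot_self]
  rw [M.form_simpleRoot, neg_ne_zero]
  have h1 : M i j ≠ 1 := M.off_diagonal i j hij
  rcases Nat.eq_zero_or_pos (M i j) with h0 | h0
  · simp [h0]
  have h3 : (3 : ℝ) ≤ M i j := by
    have : 3 ≤ M i j := by omega
    exact_mod_cast this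
  refine (Real.cos_pos_of_mem_Ioo ⟨?_, ?_⟩).ne'
  · have : 0 ≤ Real.pi / M i j := by positivity
    linarith [Real.pi_pos]
  · gcongr
    linarith

theorem CoxeterMatrix.isAffine_of_rank {δ : B → ℝ} (hpos : ∀ b, 0 < δ b)
    (hrow : ∀ i, ∑ j, Real.cos (Real.pi / M i j) * δ j = 0) (r : B) (rank : B → ℕ)
    (hrank : ∀ i, i ≠ r → ∃ j, rank j < rank i ∧ M i j ≠ 2) : M.IsAffine δ := by
  have hrow' : ∀ i, ∑ j, M.form (simpleRoot i) (simpleRoot j) * δ j = 0 := by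
    intro i
    rw [← neg_eq_zero, ← Finset.sum_neg_distrib, ← hrow i]
    exact Finset.sum_congr rfl fun j _ => by rw [M.form_simpleRoot]; ring
  have hsos : ∀ x, M.form x x = ∑ i, ∑ j,
      -(1 / 2) * M.form (simpleRoot i) (simpleRoot j) * δ i * δ j *
        (x i / δ i - x j / δ j) ^ 2 := by
    intro x
    have h1 : ∑ i, ∑ j, (x i) ^ 2 / δ i * (M.form (simpleRoot i) (simpleRoot j) * δ j) = 0 := by
      simp_rw [← Finset.mul_sum, hrow', mul_zero, Finset.sum_const_zero]
    have h2 : ∑ i, ∑ j, (x j) ^ 2 / δ j * (M.form (simpleRoot j) (simpleRoot i) * δ i) = 0 := by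
      rw [Finset.sum_comm]
      exact h1
    rw [M.form_eq_sum]
    have h3 : ∑ i, ∑ j, x i * x j * M.form (simpleRoot i) (simpleRoot j) =
        ∑ i, ∑ j, (-(1 / 2) * M.form (simpleRoot i) (simpleRoot j) * δ i * δ j *
          (x i / δ i - x j / δ j) ^ 2 +
          (1 / 2 * ((x i) ^ 2 / δ i * (M.form (simpleRoot i) (simpleRoot j) * δ j)) +
          1 / 2 * ((x j) ^ 2 / δ j * (M.form (simpleRoot j) (simpleRoot i) * δ i)))) := by
      refine Finset.sum_congr rfl fun i _ => Finset.sum_congr rfl fun j _ => ?_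
      rw [M.form_comm (simpleRoot j)]
      have hi := (hpos i).ne'
      have hj := (hpos j).ne'
      field_simp
      ring
    rw [h3]
    simp_rw [Finset.sum_add_distrib, ← Finset.mul_sum]
    rw [h2]
    simp [hrow']
  have hterm : ∀ x : B → ℝ, ∀ i j, 0 ≤ -(1 / 2) * M.form (simpleRoot i) (simpleRoot j) * δ i * δ j *
        (x i / δ i - x j / δ j) ^ 2 := by
    intro x i j
    rcases eq_or_ne i j with rfl | hij
    · simp
    have h1 := M.form_simpleRoot_nonpos hij
    have h2 : 0 ≤ -(1 / 2) * M.form (simpleRoot i) (simpleRoot j) := by linarith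
    have hi := hpos i
    have hj := hpos j
    positivity
  refine ⟨hpos, fun x => ?_, fun x => ?_, fun x hx => ?_⟩
  · rw [M.form_comm, M.form_eq_sum]
    refine Finset.sum_eq_zero fun i _ => ?_
    have h1 := congrArg (x i * ·) (hrow' i)
    simp only [mul_zero, Finset.mul_sum] at h1
    rw [← h1]
    exact Finset.sum_congr rfl fun j _ => by ring
  · rw [hsos]
    exact Finset.sum_nonneg fun i _ => Finset.sum_nonneg fun j _ => hterm x i j
  · rw [hsos] at hx
    have h1 : ∀ i j, M i j ≠ 2 → x i / δ i = x j / δ j := by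
      intro i j hij
      have h2 := (Finset.sum_eq_zero_iff_of_nonneg fun i _ =>
        Finset.sum_nonneg fun j _ => hterm x i j).1 hx i (Finset.mem_univ i)
      have h3 := (Finset.sum_eq_zero_iff_of_nonneg fun j _ => hterm x i j).1 h2 j
        (Finset.mem_univ j)
      have h4 := M.form_simpleRoot_ne_zero hij
      have hi := (hpos i).ne'
      have hj := (hpos j).ne'
      simpa [h4, hi, hj, sub_eq_zero] using h3
    have h2 : ∀ k i, rank i = k → x i / δ i = x r / δ r := by
      intro k
      induction k using Nat.strong_induction_on with
      | _ k ih =>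
        rintro i rfl
        rcases eq_or_ne i r with rfl | hir
        · rfl
        · obtain ⟨j, hj, hij⟩ := hrank i hir
          rw [h1 i j hij, ih _ hj j rfl]
    refine ⟨x r / δ r, funext fun i => ?_⟩
    rw [Pi.smul_apply, smul_eq_mul, ← h2 _ i rfl, div_mul_cancel₀ _ (hpos i).ne']

theorem CoxeterMatrix.IsAffine.reindex {B' : Type*} [Fintype B'] [DecidableEq B'] {δ : B → ℝ}
    (hM : M.IsAffine δ) (e : B ≃ B') : (M.reindex e).IsAffine (δ ∘ e.symm) := by
  have hform : ∀ x y, (M.reindex e).form x y = M.form (x ∘ e) (y ∘ e) := by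
    intro x y
    rw [CoxeterMatrix.form_eq_sum, CoxeterMatrix.form_eq_sum, ← e.sum_comp]
    refine Finset.sum_congr rfl fun i _ => ?_
    rw [← e.sum_comp]
    refine Finset.sum_congr rfl fun j _ => ?_
    have h : (M.reindex e) (e i) (e j) = M i j := by simp [CoxeterMatrix.reindex]
    rw [CoxeterMatrix.form_simpleRoot, CoxeterMatrix.form_simpleRoot, h]
    rfl
  have hδ : (δ ∘ e.symm) ∘ e = δ := by
    ext i
    simp
  refine ⟨fun b => hM.pos _, fun x => ?_, fun x => ?_, fun x hx => ?_⟩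
  · rw [hform, hδ, hM.form_left]
  · rw [hform]
    exact hM.nonneg _
  · rw [hform] at hx
    obtain ⟨t, ht⟩ := hM.exists_eq_smul _ hx
    refine ⟨t, funext fun i => ?_⟩
    simpa using congrFun ht (e.symm i)

theorem edgeCoxeterMatrix_apply (f : B → B → ℕ) (i j : B) : edgeCoxeterMatrix f i j =
    if i = j then 1
    else if f i j ⊔ f j i = 0 then 2
    else if f i j ⊔ f j i = 1 then 0
    else f i j ⊔ f j i := rfl

theorem edgeCoxeterMatrix_ne_two {f : B → B → ℕ} {i j : B} (h : 3 ≤ f i j ⊔ f j i) :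
    edgeCoxeterMatrix f i j ≠ 2 := by
  rw [edgeCoxeterMatrix_apply]
  split_ifs <;> omega

/-- The vanishing of a row of the Gram matrix on a vector, in terms of a list of the neighbours of
a vertex and of their edge labels. -/
theorem sum_cos_edgeCoxeterMatrix {f : B → B → ℕ} {δ : B → ℝ} {i : B} (T : List (B × ℕ))
    (hnd : (i :: T.map Prod.fst).Nodup)
    (hT : ∀ p ∈ T, f i p.1 ⊔ f p.1 i = p.2 ∧ 3 ≤ p.2)
    (h0 : ∀ j, j ≠ i → (∀ p ∈ T, j ≠ p.1) → f i j ⊔ f j i = 0)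
    (hsum : (T.map fun p => Real.cos (Real.pi / p.2) * δ p.1).sum = δ i) :
    ∑ j, Real.cos (Real.pi / edgeCoxeterMatrix f i j) * δ j = 0 := by
  have h1 : ∑ j, Real.cos (Real.pi / edgeCoxeterMatrix f i j) * δ j =
      ∑ j ∈ (i :: T.map Prod.fst).toFinset,
        Real.cos (Real.pi / edgeCoxeterMatrix f i j) * δ j := by
    refine (Finset.sum_subset (Finset.subset_univ _) fun j _ hj => ?_).symm
    simp only [List.toFinset_cons, Finset.mem_insert, List.mem_toFinset, List.mem_map, not_or,
      not_exists, not_and] at hj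
    have h2 := h0 j hj.1 fun p hp h => hj.2 p hp h.symm
    rw [edgeCoxeterMatrix_apply, if_neg (Ne.symm hj.1), if_pos h2]
    simp
  rw [h1, List.sum_toFinset _ hnd, List.map_cons, List.sum_cons, List.map_map]
  have h2 : (T.map ((fun j => Real.cos (Real.pi / edgeCoxeterMatrix f i j) * δ j) ∘ Prod.fst)) =
      T.map fun p => Real.cos (Real.pi / p.2) * δ p.1 := by
    refine List.map_congr_left fun p hp => ?_
    have hne : i ≠ p.1 := fun h => (List.nodup_cons.1 hnd).1 (h ▸ List.mem_map_of_mem hp)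
    obtain ⟨h3, h4⟩ := hT p hp
    have h5 : edgeCoxeterMatrix f i p.1 = p.2 := by
      rw [edgeCoxeterMatrix_apply, if_neg hne, h3]
      split_ifs <;> omega
    simp [h5]
  rw [h2, hsum, edgeCoxeterMatrix_apply, if_pos rfl]
  simp

end AffineCriterion

section AffineTypes

theorem isAffine_tildeA1 : tildeA1.IsAffine fun _ => 1 := by
  refine CoxeterMatrix.isAffine_of_rank (fun _ => one_pos) ?_ 0 Fin.val ?_
  · intro i
    fin_cases i <;> simp [tildeA1, edgeCoxeterMatrix_apply, Fin.sum_univ_succ]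
  · intro i
    fin_cases i <;> decide

theorem isAffine_tildeG2 : tildeG2.IsAffine ![√3, 2, 1] := by
  refine CoxeterMatrix.isAffine_of_rank ?_ ?_ 0 Fin.val ?_
  · intro i
    fin_cases i <;> simp
  · intro i
    fin_cases i <;> simp [tildeG2, edgeCoxeterMatrix_apply, Fin.sum_univ_succ] <;>
      ring_nf <;> norm_num
  · intro i
    fin_cases i <;> decide

theorem isAffine_tildeF4 : tildeF4.IsAffine ![√2, 2 * √2, 3, 2, 1] := by
  refine CoxeterMatrix.isAffine_of_rank ?_ ?_ 0 Fin.val ?_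
  · intro i
    fin_cases i <;> simp
  · intro i
    fin_cases i <;> simp [tildeF4, edgeCoxeterMatrix_apply, Fin.sum_univ_succ] <;>
      ring_nf <;> norm_num
  · intro i
    fin_cases i <;> decide

theorem isAffine_tildeE6 : tildeE6.IsAffine ![1, 2, 3, 2, 1, 2, 1] := by
  refine CoxeterMatrix.isAffine_of_rank ?_ ?_ 0 Fin.val ?_
  · intro i
    fin_cases i <;> simp
  · intro i
    fin_cases i <;> simp [tildeE6, edgeCoxeterMatrix_apply, Fin.sum_univ_succ] <;> norm_num
  · intro i
    fin_cases i <;> decide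

theorem isAffine_tildeE7 : tildeE7.IsAffine ![1, 2, 3, 4, 3, 2, 1, 2] := by
  refine CoxeterMatrix.isAffine_of_rank ?_ ?_ 0 Fin.val ?_
  · intro i
    fin_cases i <;> simp
  · intro i
    fin_cases i <;> simp [tildeE7, edgeCoxeterMatrix_apply, Fin.sum_univ_succ] <;> norm_num
  · intro i
    fin_cases i <;> decide

theorem isAffine_tildeE8 : tildeE8.IsAffine ![2, 4, 6, 5, 4, 3, 2, 1, 3] := by
  refine CoxeterMatrix.isAffine_of_rank ?_ ?_ 0 Fin.val ?_
  · intro i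
    fin_cases i <;> simp
  · intro i
    fin_cases i <;> simp [tildeE8, edgeCoxeterMatrix_apply, Fin.sum_univ_succ] <;> norm_num
  · intro i
    fin_cases i <;> decide

end AffineTypes

section AffineSeries

theorem isAffine_tildeA {n : ℕ} (hn : 2 ≤ n) : (tildeA n).IsAffine fun _ => 1 := by
  have : Fact (1 < n + 1) := ⟨by omega⟩
  have h2 : (2 : ZMod (n + 1)) ≠ 0 := by
    intro h
    have h1 := (ZMod.natCast_eq_zero_iff 2 (n + 1)).1 (by exact_mod_cast h)
    exact absurd (Nat.le_of_dvd (by norm_num) h1) (by omega)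
  have h3 : ∀ i : ZMod (n + 1), i ≠ i + 1 + 1 := by
    intro i h
    rw [add_assoc, one_add_one_eq_two, left_eq_add] at h
    exact h2 h
  refine CoxeterMatrix.isAffine_of_rank (fun _ => one_pos) (fun i => ?_) 0 ZMod.val fun i hi => ?_
  · refine sum_cos_edgeCoxeterMatrix [(i + 1, 3), (i - 1, 3)] ?_ ?_ ?_ ?_
    · have h4 : i + 1 ≠ i - 1 := fun h => h3 (i - 1) (by rw [sub_add_cancel, h])
      simp [h4]
      simp [eq_sub_iff_add_eq]
    · have h4 := h3 i
      have h5 : i - 1 ≠ i + 1 := fun h => h3 (i - 1) (by rw [sub_add_cancel, ← h])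
      simp [h4, h5]
    · intro j h4 h5
      simp only [List.mem_cons, List.not_mem_nil, or_false, forall_eq_or_imp, forall_eq] at h5
      have h6 : i ≠ j + 1 := fun h => h5.2 (by rw [h]; ring)
      simp [h5.1, h6]
    · norm_num
  · refine ⟨i - 1, ?_, edgeCoxeterMatrix_ne_two ?_⟩
    · have h4 : i.val ≠ 0 := fun h => hi ((ZMod.val_eq_zero i).1 h)
      have h5 : (1 : ZMod (n + 1)).val = 1 := ZMod.val_one _
      rw [ZMod.val_sub (by omega), h5]
      omega
    · simp

theorem isAffine_tildeC {n : ℕ} (hn : 2 ≤ n) :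
    (tildeC n).IsAffine fun i => if (i : ℕ) = 0 ∨ (i : ℕ) = n then 1 else √2 := by
  refine CoxeterMatrix.isAffine_of_rank (fun i => by split_ifs <;> positivity)
    (fun i => ?_) 0 Fin.val fun i hi => ?_
  · rcases eq_or_ne (i : ℕ) 0 with h0 | h0
    · refine sum_cos_edgeCoxeterMatrix [(⟨1, by omega⟩, 4)] (by grind) (by grind)
        (fun j _ hT => by simp only [List.forall_mem_cons] at hT; grind) ?_
      simp only [List.map_cons, List.map_nil, List.sum_cons, List.sum_nil, Nat.cast_ofNat,
        Real.cos_pi_div_four]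
      split_ifs <;> first | (exfalso; grind) | (ring_nf; done) | (ring_nf; norm_num)
    rcases eq_or_ne (i : ℕ) n with hin | hin
    · refine sum_cos_edgeCoxeterMatrix [(⟨n - 1, by omega⟩, 4)] (by grind) (by grind)
        (fun j _ hT => by simp only [List.forall_mem_cons] at hT; grind) ?_
      simp only [List.map_cons, List.map_nil, List.sum_cons, List.sum_nil, Nat.cast_ofNat,
        Real.cos_pi_div_four]
      split_ifs <;> first | (exfalso; grind) | (ring_nf; done) | (ring_nf; norm_num)
    · refine sum_cos_edgeCoxeterMatrix [(⟨i - 1, by omega⟩, if (i : ℕ) = 1 then 4 else 3),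
        (⟨i + 1, by omega⟩, if (i : ℕ) + 1 = n then 4 else 3)] (by grind) (by grind)
        (fun j _ hT => by simp only [List.forall_mem_cons] at hT; grind) ?_
      simp only [List.map_cons, List.map_nil, List.sum_cons, List.sum_nil, Nat.cast_ite,
        Nat.cast_ofNat]
      split_ifs <;> first
        | (exfalso; grind)
        | (simp only [Real.cos_pi_div_three, Real.cos_pi_div_four]; ring_nf)
  · have h0 : (i : ℕ) ≠ 0 := fun h => hi (Fin.ext h)
    refine ⟨⟨i - 1, by omega⟩, by simp only; omega, edgeCoxeterMatrix_ne_two ?_⟩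
    simp only
    split_ifs <;> omega

theorem isAffine_tildeB {n : ℕ} (hn : 3 ≤ n) :
    (tildeB n).IsAffine fun i =>
      if (i : ℕ) = 0 then √2 else if n - 1 ≤ (i : ℕ) then 1 else 2 := by
  refine CoxeterMatrix.isAffine_of_rank (fun i => by split_ifs <;> positivity)
    (fun i => ?_) 0 Fin.val fun i hi => ?_
  · rcases eq_or_ne (i : ℕ) 0 with h0 | h0
    · refine sum_cos_edgeCoxeterMatrix [(⟨1, by omega⟩, 4)] (by grind) (by grind)
        (fun j _ hT => by simp only [List.forall_mem_cons] at hT; grind) ?_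
      simp only [List.map_cons, List.map_nil, List.sum_cons, List.sum_nil, Nat.cast_ofNat,
        Real.cos_pi_div_four]
      split_ifs <;> first | (exfalso; grind) | ring_nf
    rcases le_or_gt (n - 1) i with h1 | h1
    · refine sum_cos_edgeCoxeterMatrix [(⟨n - 2, by omega⟩, 3)] (by grind) (by grind)
        (fun j _ hT => by simp only [List.forall_mem_cons] at hT; grind) ?_
      simp only [List.map_cons, List.map_nil, List.sum_cons, List.sum_nil, Nat.cast_ofNat,
        Real.cos_pi_div_three]
      split_ifs <;> first | (exfalso; grind) | ring_nf
    rcases eq_or_ne (i : ℕ) (n - 2) with h2 | h2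
    · refine sum_cos_edgeCoxeterMatrix [(⟨n - 3, by omega⟩, if n = 3 then 4 else 3),
        (⟨n - 1, by omega⟩, 3), (⟨n, by omega⟩, 3)]
        (by grind) (by
          simp only [List.forall_mem_cons]
          exact ⟨⟨by grind, by grind⟩, ⟨by grind, le_rfl⟩, ⟨by grind, le_rfl⟩, by simp⟩)
        (fun j _ hT => by simp only [List.forall_mem_cons] at hT; grind) ?_
      by_cases h3 : n = 3 <;>
      simp only [List.map_cons, List.map_nil, List.sum_cons, List.sum_nil, Nat.cast_ofNat,
        h3, if_true, if_false,
        Real.cos_pi_div_three, Real.cos_pi_div_four] <;>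
      split_ifs <;> first | (exfalso; grind) | (ring_nf; done) | (ring_nf; norm_num)
    · refine sum_cos_edgeCoxeterMatrix [(⟨i - 1, by omega⟩, if (i : ℕ) = 1 then 4 else 3),
        (⟨i + 1, by omega⟩, 3)] (by grind) (by grind)
        (fun j _ hT => by simp only [List.forall_mem_cons] at hT; grind) ?_
      by_cases h3 : (i : ℕ) = 1 <;>
      simp only [List.map_cons, List.map_nil, List.sum_cons, List.sum_nil, Nat.cast_ofNat,
        h3, if_true, if_false,
        Real.cos_pi_div_three, Real.cos_pi_div_four] <;>
      split_ifs <;> first | (exfalso; grind) | (ring_nf; done) | (ring_nf; norm_num)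
  · have h0 : (i : ℕ) ≠ 0 := fun h => hi (Fin.ext h)
    rcases eq_or_ne (i : ℕ) n with hin | hin
    · refine ⟨⟨n - 2, by omega⟩, by simp only; omega, edgeCoxeterMatrix_ne_two ?_⟩
      grind
    · refine ⟨⟨i - 1, by omega⟩, by simp only; omega, edgeCoxeterMatrix_ne_two ?_⟩
      grind

theorem isAffine_tildeD {n : ℕ} (hn : 4 ≤ n) :
    (tildeD n).IsAffine fun i => if (i : ℕ) ≤ 1 ∨ n - 1 ≤ (i : ℕ) then 1 else 2 := by
  refine CoxeterMatrix.isAffine_of_rank (fun i => by split_ifs <;> positivity)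
    (fun i => ?_) ⟨2, by omega⟩ (fun i : Fin (n + 1) => if (i : ℕ) ≤ 1 then n + 1 else i)
    fun i hi => ?_
  · rcases le_or_gt (i : ℕ) 1 with h0 | h0
    · refine sum_cos_edgeCoxeterMatrix [(⟨2, by omega⟩, 3)] (by grind) (by grind)
        (fun j _ hT => by simp only [List.forall_mem_cons] at hT; grind) ?_
      simp only [List.map_cons, List.map_nil, List.sum_cons, List.sum_nil, Nat.cast_ofNat,
        Real.cos_pi_div_three]
      split_ifs <;> first | (exfalso; grind) | ring_nf
    rcases le_or_gt (n - 1) i with h1 | h1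
    · refine sum_cos_edgeCoxeterMatrix [(⟨n - 2, by omega⟩, 3)] (by grind) (by grind)
        (fun j _ hT => by simp only [List.forall_mem_cons] at hT; grind) ?_
      simp only [List.map_cons, List.map_nil, List.sum_cons, List.sum_nil, Nat.cast_ofNat,
        Real.cos_pi_div_three]
      split_ifs <;> first | (exfalso; grind) | ring_nf
    rcases eq_or_ne (i : ℕ) (n - 2) with h2 | h2 <;> rcases eq_or_ne (i : ℕ) 2 with h3 | h3
    · obtain rfl : n = 4 := by omega
      refine sum_cos_edgeCoxeterMatrix [(0, 3), (1, 3), (3, 3), (4, 3)]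
        (by simp [Fin.ext_iff, h3]) (by simp [h3])
        (fun j _ hT => by simp only [List.forall_mem_cons] at hT; grind) ?_
      simp only [List.map_cons, List.map_nil, List.sum_cons, List.sum_nil, Nat.cast_ofNat,
        Real.cos_pi_div_three]
      split_ifs <;> first | (exfalso; grind) | ring_nf
    · refine sum_cos_edgeCoxeterMatrix [(⟨n - 3, by omega⟩, 3), (⟨n - 1, by omega⟩, 3),
        (⟨n, by omega⟩, 3)] (by grind) (by
          simp only [List.forall_mem_cons]
          exact ⟨⟨by grind, le_rfl⟩, ⟨by grind, le_rfl⟩, ⟨by grind, le_rfl⟩, by simp⟩)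
        (fun j _ hT => by simp only [List.forall_mem_cons] at hT; grind) ?_
      simp only [List.map_cons, List.map_nil, List.sum_cons, List.sum_nil, Nat.cast_ofNat,
        Real.cos_pi_div_three]
      split_ifs <;> first | (exfalso; grind) | ring_nf
    · refine sum_cos_edgeCoxeterMatrix [(⟨0, by omega⟩, 3), (⟨1, by omega⟩, 3), (⟨3, by omega⟩, 3)]
        (by grind) (by grind)
        (fun j _ hT => by simp only [List.forall_mem_cons] at hT; grind) ?_
      simp only [List.map_cons, List.map_nil, List.sum_cons, List.sum_nil, Nat.cast_ofNat,
        Real.cos_pi_div_three]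
      split_ifs <;> first | (exfalso; grind) | ring_nf
    · refine sum_cos_edgeCoxeterMatrix [(⟨i - 1, by omega⟩, 3), (⟨i + 1, by omega⟩, 3)]
        (by grind) (by grind)
        (fun j _ hT => by simp only [List.forall_mem_cons] at hT; grind) ?_
      simp only [List.map_cons, List.map_nil, List.sum_cons, List.sum_nil, Nat.cast_ofNat,
        Real.cos_pi_div_three]
      split_ifs <;> first | (exfalso; grind) | ring_nf
  · have h0 : (i : ℕ) ≠ 2 := fun h => hi (Fin.ext h)
    rcases le_or_gt (i : ℕ) 1 with h1 | h1
    · refine ⟨⟨2, by omega⟩, by simp only; split_ifs <;> omega, edgeCoxeterMatrix_ne_two ?_⟩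
      grind
    rcases eq_or_ne (i : ℕ) n with hin | hin
    · refine ⟨⟨n - 2, by omega⟩, by simp only; split_ifs <;> omega, edgeCoxeterMatrix_ne_two ?_⟩
      grind
    · refine ⟨⟨i - 1, by omega⟩, by simp only; split_ifs <;> omega, edgeCoxeterMatrix_ne_two ?_⟩
      grind

end AffineSeries

theorem IsIrreducibleEuclidean.exists_isAffine {B : Type*} [Fintype B] [DecidableEq B]
    {M : CoxeterMatrix B} (hM : IsIrreducibleEuclidean M) :
    Nonempty B ∧ ∃ δ : B → ℝ, M.IsAffine δ := by
  rcases hM with ⟨e, rfl⟩ | ⟨n, hn, e, rfl⟩ | ⟨n, hn, e, rfl⟩ | ⟨n, hn, e, rfl⟩ |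
    ⟨n, hn, e, rfl⟩ | ⟨e, rfl⟩ | ⟨e, rfl⟩ | ⟨e, rfl⟩ | ⟨e, rfl⟩ | ⟨e, rfl⟩ <;>
    refine ⟨⟨e 0⟩, ?_⟩
  · exact ⟨_, isAffine_tildeA1.reindex e⟩
  · exact ⟨_, (isAffine_tildeA hn).reindex e⟩
  · exact ⟨_, (isAffine_tildeB hn).reindex e⟩
  · exact ⟨_, (isAffine_tildeC hn).reindex e⟩
  · exact ⟨_, (isAffine_tildeD hn).reindex e⟩
  · exact ⟨_, isAffine_tildeG2.reindex e⟩
  · exact ⟨_, isAffine_tildeF4.reindex e⟩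
  · exact ⟨_, isAffine_tildeE6.reindex e⟩
  · exact ⟨_, isAffine_tildeE7.reindex e⟩
  · exact ⟨_, isAffine_tildeE8.reindex e⟩

/-- Let `M` be an irreducible euclidean Coxeter matrix, let `W` be its Coxeter group with
simple generators `S` and reflections `R`, and let `w` be the Coxeter element obtained as
the product of the simple generators in the order given by a list `l` enumerating `S`.
Then every simple generator lies in the set `R₀` of reflections occurring in minimal-length
reflection factorizations of `w`, and the map `s ↦ s` on simple generators extends to an
isomorphism from the Artin group of `M` onto the dual Artin group `W_w`. -/
theorem artin_iso_dual_artin {B : Type*} (M : CoxeterMatrix B)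
    (hM : IsIrreducibleEuclidean M)
    (l : List B) (hnodup : l.Nodup) (hcomplete : ∀ b : B, b ∈ l) :
    ∃ hS : ∀ b : B, M.simple b ∈ dualGens M l,
      ∃ φ : ArtinGroup M ≃* DualArtinGroup M l,
        ∀ b : B, φ (ArtinGroup.of M b) = PresentedGroup.of ⟨M.simple b, hS b⟩ := by
  classical
  let _ : Fintype B := ⟨l.toFinset, fun b => List.mem_toFinset.2 (hcomplete b)⟩
  obtain ⟨hB, δ, hδ⟩ := hM.exists_isAffine
  exact hδ.exists_mulEquiv hnodup hcomplete
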